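/- Let Ω ⊂ ℝⁿ be a convex smooth bounded domain with n ≥ 5 and let f : [0,∞) → ℝ be an increasing positive C¹ function (in particular f(0) > 0) with f(t)/t → ∞ as t → ∞. Let λ* ∈ (0,∞) and, for each λ ∈ (0,λ*), let u_λ, smooth on the closure of Ω, be a positive semi-stable classical solution of −Δu_λ = λ f(u_λ) in Ω with u_λ = 0 on ∂Ω; assume the family is nondecreasing in λ (u_λ ≤ u_μ pointwise whenever λ ≤ μ) and that the pointwise limit u* := lim_{λ↑λ*} u_λ belongs to L¹(Ω) and satisfies ∫_Ω f(u*(x)) · dist(x,∂Ω) dx < ∞. Then u* ∈ L^{2n/(n−4)}(Ω), i.e. ∫_Ω (u*)^{2n/(n−4)} dx < ∞. -/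

import Mathlib

open MeasureTheory Filter Bornology
open scoped ENNReal Topology

/-- Divergence of a vector field on `ℝⁿ = EuclideanSpace ℝ (Fin n)`. -/
noncomputable def divg {n : ℕ} (V : EuclideanSpace ℝ (Fin n) → EuclideanSpace ℝ (Fin n))
    (x : EuclideanSpace ℝ (Fin n)) : ℝ :=
  ∑ i, fderiv ℝ V x (EuclideanSpace.single i 1) i

/-- `H_u(x) = -(1/(n-1)) div(∇u/|∇u|)(x)`, the mean curvature of the level set of `|u|`
through `x` (at points where `∇u(x) ≠ 0`). -/
noncomputable def meanCurv {n : ℕ} (u : EuclideanSpace ℝ (Fin n) → ℝ)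
    (x : EuclideanSpace ℝ (Fin n)) : ℝ :=
  -(1 / ((n : ℝ) - 1)) * divg (fun y => ‖gradient u y‖⁻¹ • gradient u y) x

/-- The Laplacian `Δu = div ∇u` on `ℝⁿ`. -/
noncomputable def lap {n : ℕ} (u : EuclideanSpace ℝ (Fin n) → ℝ)
    (x : EuclideanSpace ℝ (Fin n)) : ℝ :=
  divg (gradient u) x

/-- Semi-stability of a solution `u` of `-Δu = g(u)` in `Ω`, `u = 0` on `∂Ω`:
`∫_Ω (|∇ξ|² - g'(u) ξ²) dx ≥ 0` for every `C¹` function `ξ` vanishing on `∂Ω`. -/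
def SemiStable {n : ℕ} (Ω : Set (EuclideanSpace ℝ (Fin n))) (g : ℝ → ℝ)
    (u : EuclideanSpace ℝ (Fin n) → ℝ) : Prop :=
  ∀ ξ : EuclideanSpace ℝ (Fin n) → ℝ, ContDiff ℝ 1 ξ → (∀ x ∈ frontier Ω, ξ x = 0) →
    0 ≤ ∫ x in Ω, (‖gradient ξ x‖ ^ 2 - deriv g (u x) * ξ x ^ 2)

open scoped ContDiff RealInnerProductSpace

/-- Euclidean space of dimension `n`. -/
abbrev Eu (n : ℕ) := EuclideanSpace ℝ (Fin n)

/-- The standard basis vectors. -/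
noncomputable abbrev bv {n : ℕ} (i : Fin n) : Eu n := EuclideanSpace.single i (1 : ℝ)

/-- Directional derivative of `g` along the constant vector `v`. -/
noncomputable def dd {n : ℕ} (v : Eu n) (g : Eu n → ℝ) (x : Eu n) : ℝ := fderiv ℝ g x v

section Calculus

variable {n : ℕ} {g h : Eu n → ℝ} {v w : Eu n} {x : Eu n}

theorem ContDiff.dd (hg : ContDiff ℝ ∞ g) (v : Eu n) : ContDiff ℝ ∞ (dd v g) :=
  (hg.fderiv_right (m := ∞) (by simp)).clm_apply contDiff_const

theorem ContDiff.diffAt (hg : ContDiff ℝ ∞ g) (x : Eu n) : DifferentiableAt ℝ g x :=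
  hg.differentiable (by simp) x

theorem dd_smul_vec (c : ℝ) : dd (c • v) g = fun x => c * dd v g x := by
  ext x; simp [dd]

theorem dd_sub_vec : dd (v - w) g = fun x => dd v g x - dd w g x := by
  ext x; simp [dd]

theorem dd_sum_vec {ι : Type*} (s : Finset ι) (f : ι → Eu n) :
    dd (∑ i ∈ s, f i) g = fun x => ∑ i ∈ s, dd (f i) g x := by
  ext x; simp [dd]

theorem dd_add (hg : ContDiff ℝ ∞ g) (hh : ContDiff ℝ ∞ h) :
    dd v (fun x => g x + h x) = fun x => dd v g x + dd v h x := by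
  ext x; simp [dd, fderiv_fun_add (hg.diffAt x) (hh.diffAt x)]

theorem dd_sub (hg : ContDiff ℝ ∞ g) (hh : ContDiff ℝ ∞ h) :
    dd v (fun x => g x - h x) = fun x => dd v g x - dd v h x := by
  ext x; simp [dd, fderiv_fun_sub (hg.diffAt x) (hh.diffAt x)]

theorem dd_const (c : ℝ) : dd v (fun _ : Eu n => c) = fun _ => 0 := by
  ext x; simp [dd]

theorem dd_const_mul (c : ℝ) (hg : ContDiff ℝ ∞ g) :
    dd v (fun x => c * g x) = fun x => c * dd v g x := by
  ext x; simp [dd, fderiv_const_mul (hg.diffAt x)]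

theorem dd_mul (hg : ContDiff ℝ ∞ g) (hh : ContDiff ℝ ∞ h) :
    dd v (fun x => g x * h x) = fun x => dd v g x * h x + g x * dd v h x := by
  ext x; simp [dd, fderiv_fun_mul (hg.diffAt x) (hh.diffAt x)]; ring

theorem dd_sum {ι : Type*} (s : Finset ι) (f : ι → Eu n → ℝ) (hf : ∀ i ∈ s, ContDiff ℝ ∞ (f i)) :
    dd v (fun x => ∑ i ∈ s, f i x) = fun x => ∑ i ∈ s, dd v (f i) x := by
  ext x
  simp [dd, fderiv_fun_sum fun i hi => (hf i hi).diffAt x]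

theorem dd_comm (hg : ContDiff ℝ ∞ g) (v w : Eu n) (x : Eu n) :
    dd v (dd w g) x = dd w (dd v g) x := by
  have hs : IsSymmSndFDerivAt ℝ g x := hg.contDiffAt.isSymmSndFDerivAt
    (by simpa using ENat.LEInfty.out)
  have key : ∀ a b : Eu n, dd a (dd b g) x = fderiv ℝ (fderiv ℝ g) x a b := by
    intro a b
    have h1 : DifferentiableAt ℝ (fderiv ℝ g) x :=
      (hg.fderiv_right (m := ∞) (by simp)).differentiable (by simp) x
    change fderiv ℝ (fun y => fderiv ℝ g y b) x a = _
    rw [fderiv_clm_apply h1 (differentiableAt_const b)]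
    simp
  rw [key, key, hs.eq]

theorem inner_gradient : ⟪gradient g x, v⟫ = dd v g x := by
  simp [gradient, dd]

theorem gradient_apply (i : Fin n) : gradient g x i = dd (bv i) g x := by
  have := EuclideanSpace.inner_single_right (𝕜 := ℝ) i (1 : ℝ) (gradient g x)
  simp [gradient] at this
  simp [dd, bv, gradient, this]

theorem norm_gradient : ‖gradient g x‖ = ‖fderiv ℝ g x‖ := by
  simp [gradient]

theorem norm_gradient_sq : ‖gradient g x‖ ^ 2 = ∑ i, dd (bv i) g x ^ 2 := by
  rw [EuclideanSpace.norm_sq_eq]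
  simp [gradient_apply]

theorem dd_eq_sum (v : Eu n) : dd v g x = ∑ i, v i * dd (bv i) g x := by
  have : v = ∑ i, v i • bv i := by
    ext j; simp [bv, Finset.sum_apply, Pi.single_apply]
  conv_lhs => rw [this, dd_sum_vec]
  simp [dd_smul_vec]

theorem abs_dd_le : |dd v g x| ≤ ‖gradient g x‖ * ‖v‖ := by
  rw [norm_gradient]
  exact (fderiv ℝ g x).le_opNorm v

theorem lap_eq (hg : ContDiff ℝ ∞ g) : lap g x = ∑ i, dd (bv i) (dd (bv i) g) x := by
  unfold lap divg
  refine Finset.sum_congr rfl fun i _ => ?_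
  have h1 : DifferentiableAt ℝ (gradient g) x := by
    unfold gradient
    exact ((InnerProductSpace.toDual ℝ (Eu n)).symm.toContinuousLinearEquiv.differentiable _).comp x
      ((hg.fderiv_right (m := ∞) (by simp)).differentiable (by simp) x)
  have h2 : dd (bv i) g = fun y => EuclideanSpace.proj (𝕜 := ℝ) i (gradient g y) := by
    ext y; simp [gradient_apply]
  rw [h2]
  change _ = fderiv ℝ (EuclideanSpace.proj (𝕜 := ℝ) i ∘ gradient g) x _
  rw [fderiv_comp x (EuclideanSpace.proj (𝕜 := ℝ) i).differentiableAt h1,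
    ContinuousLinearMap.fderiv]
  rfl

theorem ContDiff.lap (hg : ContDiff ℝ ∞ g) : ContDiff ℝ ∞ (lap g) := by
  have : _root_.lap g = fun x => ∑ i, _root_.dd (bv i) (_root_.dd (bv i) g) x := by
    ext x; exact lap_eq hg
  rw [this]
  exact ContDiff.sum fun i _ => (hg.dd _).dd _

theorem lap_add (hg : ContDiff ℝ ∞ g) (hh : ContDiff ℝ ∞ h) :
    lap (fun x => g x + h x) x = lap g x + lap h x := by
  rw [lap_eq (hg.add hh), lap_eq hg, lap_eq hh, ← Finset.sum_add_distrib]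
  simp_rw [dd_add hg hh, dd_add (hg.dd _) (hh.dd _)]

theorem lap_sub (hg : ContDiff ℝ ∞ g) (hh : ContDiff ℝ ∞ h) :
    lap (fun x => g x - h x) x = lap g x - lap h x := by
  rw [lap_eq (hg.sub hh), lap_eq hg, lap_eq hh, ← Finset.sum_sub_distrib]
  simp_rw [dd_sub hg hh, dd_sub (hg.dd _) (hh.dd _)]

theorem lap_const_mul (c : ℝ) (hg : ContDiff ℝ ∞ g) :
    lap (fun x => c * g x) x = c * lap g x := by
  rw [lap_eq (contDiff_const.mul hg), lap_eq hg, Finset.mul_sum]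
  simp_rw [dd_const_mul c hg, dd_const_mul c (hg.dd _)]

theorem lap_neg (hg : ContDiff ℝ ∞ g) : lap (fun x => - g x) x = - lap g x := by
  have := lap_const_mul (x := x) (-1) hg
  simpa using this

theorem lap_const (c : ℝ) : lap (fun _ : Eu n => c) x = 0 := by
  rw [lap_eq contDiff_const]
  simp [dd_const]

theorem lap_mul (hg : ContDiff ℝ ∞ g) (hh : ContDiff ℝ ∞ h) :
    lap (fun x => g x * h x) x = lap g x * h x + g x * lap h x
      + 2 * ∑ i, dd (bv i) g x * dd (bv i) h x := by
  rw [lap_eq (hg.mul hh), lap_eq hg, lap_eq hh, Finset.sum_mul, Finset.mul_sum, Finset.mul_sum,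
    ← Finset.sum_add_distrib, ← Finset.sum_add_distrib]
  refine Finset.sum_congr rfl fun i _ => ?_
  rw [dd_mul hg hh, dd_add ((hg.dd _).mul hh) (hg.mul (hh.dd _)), dd_mul (hg.dd _) hh,
    dd_mul hg (hh.dd _)]
  ring

theorem lap_dd (hg : ContDiff ℝ ∞ g) : lap (dd v g) x = dd v (lap g) x := by
  have : lap g = fun x => ∑ i, dd (bv i) (dd (bv i) g) x := by
    ext x; exact lap_eq hg
  rw [this, dd_sum _ _ fun i _ => (hg.dd _).dd _, lap_eq (hg.dd v)]
  refine Finset.sum_congr rfl fun i _ => ?_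
  have h1 : dd (bv i) (dd v g) = dd v (dd (bv i) g) := by
    ext y; exact dd_comm hg _ _ _
  rw [h1, dd_comm (hg.dd _)]

theorem contDiff_inner_sub (ν p : Eu n) : ContDiff ℝ ∞ fun x : Eu n => ⟪ν, x - p⟫ :=
  contDiff_const.inner ℝ (contDiff_id.sub contDiff_const)

theorem dd_inner_sub (ν p : Eu n) : dd v (fun x : Eu n => ⟪ν, x - p⟫) = fun _ => ⟪ν, v⟫ := by
  ext x
  have : HasFDerivAt (fun x : Eu n => ⟪ν, x - p⟫) (innerSL ℝ ν) x :=
    (innerSL ℝ ν).hasFDerivAt.comp x ((hasFDerivAt_id x).sub_const p)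
  simp [dd, this.fderiv]

theorem lap_inner_sub (ν p : Eu n) : lap (fun x : Eu n => ⟪ν, x - p⟫) x = 0 := by
  rw [lap_eq (contDiff_inner_sub ν p)]
  simp [dd_inner_sub, dd_const]

theorem sum_inner_bv_sq (ν : Eu n) : ∑ i, ⟪ν, bv i⟫ * ⟪ν, bv i⟫ = ‖ν‖ ^ 2 := by
  rw [EuclideanSpace.norm_sq_eq]
  simp [bv, EuclideanSpace.inner_single_right, pow_two]

theorem lap_inner_sub_sq (ν p : Eu n) :
    lap (fun x : Eu n => ⟪ν, x - p⟫ ^ 2) x = 2 * ‖ν‖ ^ 2 := by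
  simp_rw [pow_two (⟪ν, _⟫)]
  rw [lap_mul (contDiff_inner_sub ν p) (contDiff_inner_sub ν p)]
  simp only [lap_inner_sub, dd_inner_sub, sum_inner_bv_sq]
  ring

theorem contDiff_normSq_sub (p : Eu n) : ContDiff ℝ ∞ fun x : Eu n => ‖x - p‖ ^ 2 :=
  (contDiff_id.sub contDiff_const).norm_sq ℝ

theorem dd_normSq_sub (p : Eu n) : dd v (fun x : Eu n => ‖x - p‖ ^ 2) = fun x => 2 * ⟪v, x - p⟫ := by
  ext x
  have : HasFDerivAt (fun x : Eu n => ‖x - p‖ ^ 2) _ x :=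
    ((hasFDerivAt_id x).sub_const p).norm_sq
  simp [dd, this.fderiv, real_inner_comm, inner_sub_right]

theorem lap_normSq_sub (p : Eu n) : lap (fun x : Eu n => ‖x - p‖ ^ 2) x = 2 * n := by
  rw [lap_eq (contDiff_normSq_sub p)]
  simp_rw [dd_normSq_sub, dd_const_mul 2 (contDiff_inner_sub _ _), dd_inner_sub]
  simp [bv]
  ring

/-- Reflection in the hyperplane `⟪e, x⟫ = c`. -/
noncomputable def hrefl (e : Eu n) (c : ℝ) (x : Eu n) : Eu n := x - (2 * (⟪e, x⟫ - c)) • e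

theorem contDiff_hrefl (e : Eu n) (c : ℝ) : ContDiff ℝ ∞ (hrefl e c) := by
  unfold hrefl
  exact contDiff_id.sub ((contDiff_const.mul ((contDiff_const.inner ℝ contDiff_id).sub
    contDiff_const)).smul contDiff_const)

theorem dd_comp_hrefl (hg : ContDiff ℝ ∞ g) (e : Eu n) (c : ℝ) :
    dd v (fun x => g (hrefl e c x)) = fun x => dd (v - (2 * ⟪e, v⟫) • e) g (hrefl e c x) := by
  ext x
  have h1 : HasFDerivAt (fun x : Eu n => 2 * (⟪e, x⟫ - c)) ((2 : ℝ) • innerSL ℝ e) x :=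
    (((innerSL ℝ e).hasFDerivAt).sub_const c).const_mul 2
  have h2 : HasFDerivAt (hrefl e c) _ x := (hasFDerivAt_id x).sub (h1.smul_const e)
  have h3 : HasFDerivAt (fun x => g (hrefl e c x)) _ x := (hg.diffAt _).hasFDerivAt.comp x h2
  simp [dd, h3.fderiv]

theorem lap_comp_hrefl (hg : ContDiff ℝ ∞ g) {e : Eu n} (he : ‖e‖ = 1) (c : ℝ) :
    lap (fun x => g (hrefl e c x)) x = lap g (hrefl e c x) := by
  rw [lap_eq (g := fun x => g (hrefl e c x)) (hg.comp (contDiff_hrefl e c)), lap_eq hg]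
  have h1 : ∀ i : Fin n, dd (bv i) (dd (bv i) (fun x => g (hrefl e c x))) x =
      dd (bv i) (dd (bv i) g) (hrefl e c x) - 4 * (e i * dd (bv i) (dd e g) (hrefl e c x))
        + 4 * e i ^ 2 * dd e (dd e g) (hrefl e c x) := by
    intro i
    rw [dd_comp_hrefl hg, dd_comp_hrefl (hg.dd _)]
    simp only [dd_sub_vec, dd_smul_vec]
    rw [dd_sub (hg.dd _) (contDiff_const.mul (hg.dd _)), dd_sub (hg.dd _) (contDiff_const.mul (hg.dd _))]
    simp only [dd_const_mul _ (hg.dd _)]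
    rw [dd_comm hg e (bv i)]
    simp [bv, EuclideanSpace.inner_single_right]
    ring
  simp_rw [h1, Finset.sum_add_distrib, Finset.sum_sub_distrib, ← Finset.mul_sum, ← Finset.sum_mul,
    ← Finset.mul_sum]
  rw [← dd_eq_sum (g := dd e g) e]
  have : ∑ i, e i ^ 2 = 1 := by
    have := EuclideanSpace.norm_sq_eq e
    rw [he] at this; simpa using this.symm
  rw [this]; ring

end Calculus

section MaximumPrinciple

variable {n : ℕ}

theorem hasDerivAt_line {g : Eu n → ℝ} (hg : ContDiff ℝ ∞ g) (x e : Eu n) (t : ℝ) :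
    HasDerivAt (fun t : ℝ => g (x + t • e)) (dd e g (x + t • e)) t := by
  have h1 : HasDerivAt (fun t : ℝ => x + t • e) e t := by
    simpa using ((hasDerivAt_id t).smul_const e).const_add x
  exact (hg.diffAt _).hasFDerivAt.comp_hasDerivAt t h1

theorem dd_dd_nonneg_of_isLocalMin {v : Eu n → ℝ} (hv : ContDiff ℝ ∞ v) {x : Eu n}
    (hx : IsLocalMin v x) (e : Eu n) : 0 ≤ dd e (dd e v) x := by
  by_contra! hneg
  set φ : ℝ → ℝ := fun t => v (x + t • e) with hφ
  have hd : deriv φ = fun t => dd e v (x + t • e) := by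
    ext t; exact (hasDerivAt_line hv x e t).deriv
  have hdd : deriv (deriv φ) 0 = dd e (dd e v) x := by
    rw [hd, (hasDerivAt_line (hv.dd e) x e 0).deriv]; simp
  have hcont : Continuous fun t : ℝ => x + t • e := by fun_prop
  have hmin : IsLocalMin φ 0 := by
    have : Tendsto (fun t : ℝ => x + t • e) (𝓝 0) (𝓝 x) := by
      simpa using hcont.tendsto 0
    have h := this.eventually hx
    simpa [IsLocalMin, IsMinFilter, hφ] using h
  have hmax : IsLocalMax φ 0 :=
    isLocalMax_of_deriv_deriv_neg (by rw [hdd]; exact hneg) hmin.deriv_eq_zero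
      (hv.continuous.comp hcont).continuousAt
  have hconst : φ =ᶠ[𝓝 0] fun _ => φ 0 := by
    filter_upwards [hmin, hmax] with t h1 h2 using le_antisymm h2 h1
  have h2 : deriv φ =ᶠ[𝓝 0] fun _ => 0 := by
    simpa using hconst.deriv
  have h3 := h2.deriv_eq
  rw [hdd] at h3
  simp at h3
  linarith

theorem lap_nonneg_of_isLocalMin {v : Eu n → ℝ} (hv : ContDiff ℝ ∞ v) {x : Eu n}
    (hx : IsLocalMin v x) : 0 ≤ lap v x := by
  rw [lap_eq hv]
  exact Finset.sum_nonneg fun i _ => dd_dd_nonneg_of_isLocalMin hv hx _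

/-- Weak minimum principle for strictly superharmonic functions. -/
theorem nonneg_of_lap_neg {v : Eu n → ℝ} (hv : ContDiff ℝ ∞ v) {U : Set (Eu n)} (hU : IsOpen U)
    (hb : IsBounded U) (hl : ∀ x ∈ U, lap v x < 0) (hf : ∀ x ∈ frontier U, 0 ≤ v x) :
    ∀ x ∈ U, 0 ≤ v x := by
  by_contra! h
  obtain ⟨x, hx, hneg⟩ := h
  obtain ⟨y, hy, hmin⟩ := hb.isCompact_closure.exists_isMinOn ⟨x, subset_closure hx⟩
    hv.continuous.continuousOn
  have hy0 : v y < 0 := (hmin (subset_closure hx)).trans_lt hneg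
  have hyU : y ∈ U := by
    by_contra hyn
    exact absurd (hf y ⟨hy, by rwa [hU.interior_eq]⟩) (not_le.2 hy0)
  have hloc : IsLocalMin v y :=
    hmin.isLocalMin (mem_of_superset (hU.mem_nhds hyU) subset_closure)
  exact absurd (lap_nonneg_of_isLocalMin hv hloc) (not_le.2 (hl y hyU))

set_option maxHeartbeats 1000000 in
/-- Interior Bernstein-type estimate for a directional derivative of a solution. -/
theorem bernstein_estimate (hn : 0 < n) {u : Eu n → ℝ} (hu : ContDiff ℝ ∞ u) {U : Set (Eu n)}
    (hU : IsOpen U) {p : Eu n} {ρ : ℝ} (hρ : 0 < ρ) (hUρ : U ⊆ Metric.closedBall p ρ)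
    {M Λ L C : ℝ} (hM : 0 ≤ M) (hΛ : 0 ≤ Λ) (hL : 0 ≤ L) {e : Eu n} (he : ‖e‖ = 1)
    (huM : ∀ x ∈ U, |u x| ≤ M) (hlap : ∀ x ∈ U, |lap u x| ≤ Λ)
    (hw : ∀ x ∈ U, |lap (dd e u) x| ≤ L * |dd e u x|)
    (hfr : ∀ x ∈ frontier U, ‖x - p‖ = ρ ∨ |dd e u x| ≤ C) :
    ∀ x ∈ U, (ρ ^ 2 - ‖x - p‖ ^ 2) ^ 2 * dd e u x ^ 2 ≤
      ρ ^ 4 * C ^ 2 + (12 * ρ ^ 2 + L * ρ ^ 4 + 2 * n * ρ ^ 2) * M ^ 2 +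
      ((2 * (12 * ρ ^ 2 + L * ρ ^ 4 + 2 * n * ρ ^ 2) * M * Λ + 1) / (2 * n)) * ρ ^ 2 := by
  set K : ℝ := 12 * ρ ^ 2 + L * ρ ^ 4 + 2 * n * ρ ^ 2 with hK
  set B : ℝ := (2 * K * M * Λ + 1) / (2 * n) with hB
  have hn' : (0 : ℝ) < n := by exact_mod_cast hn
  have hK0 : 0 < K := by positivity
  have hB0 : 0 < B := by positivity
  have hBn : B * (2 * n) = 2 * K * M * Λ + 1 := by rw [hB]; field_simp
  set w := dd e u with hwdef
  have hws : ContDiff ℝ ∞ w := hu.dd e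
  set χ : Eu n → ℝ := fun x => ρ ^ 2 - ‖x - p‖ ^ 2 with hχ
  have hχs : ContDiff ℝ ∞ χ := contDiff_const.sub (contDiff_normSq_sub p)
  have hχd : ∀ v x, dd v χ x = -(2 * ⟪v, x - p⟫) := by
    intro v x
    rw [hχ, dd_sub contDiff_const (contDiff_normSq_sub p), dd_const, dd_normSq_sub]; simp
  have hχl : ∀ x, lap χ x = -(2 * n) := by
    intro x
    rw [hχ, lap_sub contDiff_const (contDiff_normSq_sub p), lap_const, lap_normSq_sub]; simp
  set y : Eu n → ℝ := fun x => χ x * w x with hy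
  have hys : ContDiff ℝ ∞ y := hχs.mul hws
  set R : ℝ := ρ ^ 4 * C ^ 2 + K * M ^ 2 + B * ρ ^ 2 with hR
  set v : Eu n → ℝ := fun x => R - (y x * y x + (K * (u x * u x) + B * ‖x - p‖ ^ 2)) with hv
  have hs1 : ContDiff ℝ ∞ fun x => K * (u x * u x) := contDiff_const.mul (hu.mul hu)
  have hs2 : ContDiff ℝ ∞ fun x : Eu n => B * ‖x - p‖ ^ 2 :=
    contDiff_const.mul (contDiff_normSq_sub p)
  have hvs : ContDiff ℝ ∞ v := contDiff_const.sub ((hys.mul hys).add (hs1.add hs2))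
  have hball : ∀ x ∈ closure U, ‖x - p‖ ≤ ρ := fun x hx => by
    simpa [dist_eq_norm] using closure_minimal hUρ Metric.isClosed_closedBall hx
  have huMc : ∀ x ∈ closure U, |u x| ≤ M := fun x hx => by
    have : IsClosed {x | |u x| ≤ M} := isClosed_le hu.continuous.abs continuous_const
    exact closure_minimal huM this hx
  have hres : ∀ x ∈ U, 0 ≤ v x := by
    refine nonneg_of_lap_neg hvs hU (Metric.isBounded_closedBall.subset hUρ) ?_ ?_
    · intro x hx
      have e1 : lap v x = -(2 * (y x * lap y x) + 2 * ∑ i, dd (bv i) y x * dd (bv i) y x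
          + (K * (2 * (u x * lap u x) + 2 * ∑ i, dd (bv i) u x * dd (bv i) u x)
          + B * (2 * n))) := by
        rw [hv, lap_sub contDiff_const ((hys.mul hys).add (hs1.add hs2)), lap_const,
          lap_add (hys.mul hys) (hs1.add hs2), lap_add hs1 hs2, lap_mul hys hys,
          lap_const_mul _ (hu.mul hu), lap_const_mul _ (contDiff_normSq_sub p), lap_mul hu hu,
          lap_normSq_sub]
        ring
      have e2 : lap y x = -(2 * n) * w x + χ x * lap w x
          + 2 * ∑ i, dd (bv i) χ x * dd (bv i) w x := by
        rw [hy, lap_mul hχs hws, hχl]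
      have e3 : ∀ i : Fin n, dd (bv i) y x = dd (bv i) χ x * w x + χ x * dd (bv i) w x := by
        intro i; rw [hy, dd_mul hχs hws]
      have e4 : ∑ i, dd (bv i) χ x * dd (bv i) χ x = 4 * ‖x - p‖ ^ 2 := by
        rw [← sum_inner_bv_sq (x - p), Finset.mul_sum]
        refine Finset.sum_congr rfl fun i _ => ?_
        rw [hχd, real_inner_comm]; ring
      have e5 : w x ^ 2 ≤ ∑ i, dd (bv i) u x * dd (bv i) u x := by
        have h1 := abs_dd_le (g := u) (v := e) (x := x)
        rw [he, mul_one] at h1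
        have h2 : w x ^ 2 ≤ ‖gradient u x‖ ^ 2 := sq_le_sq' (by
          have := neg_abs_le (dd e u x); simp only [hwdef]; linarith) ((le_abs_self _).trans h1)
        rw [norm_gradient_sq] at h2
        simpa [pow_two] using h2
      have e6 : 0 ≤ 2 * ∑ i, dd (bv i) y x * dd (bv i) y x
          + 4 * (χ x * w x) * (∑ i, dd (bv i) χ x * dd (bv i) w x)
          + 6 * w x ^ 2 * ∑ i, dd (bv i) χ x * dd (bv i) χ x := by
        rw [Finset.mul_sum, Finset.mul_sum, Finset.mul_sum, ← Finset.sum_add_distrib,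
          ← Finset.sum_add_distrib]
        refine Finset.sum_nonneg fun i _ => ?_
        rw [e3]
        nlinarith [sq_nonneg (χ x * dd (bv i) w x + 2 * (dd (bv i) χ x * w x))]
      have hxρ := hball x (subset_closure hx)
      have hx0 := norm_nonneg (x - p)
      have hχ0 : 0 ≤ χ x := by simp only [hχ]; nlinarith
      have hχ1 : χ x ≤ ρ ^ 2 := by simp only [hχ]; nlinarith
      have e7 : -(L * w x ^ 2) ≤ w x * lap w x := by
        have h1 := hw x hx
        have h2 : |w x * lap w x| ≤ L * w x ^ 2 := by
          rw [abs_mul, ← sq_abs]; nlinarith [abs_nonneg (w x)]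
        exact (neg_le_neg h2).trans (neg_abs_le _)
      have e8 : -(M * Λ) ≤ u x * lap u x := by
        have h2 : |u x * lap u x| ≤ M * Λ := by
          rw [abs_mul]; exact mul_le_mul (huM x hx) (hlap x hx) (abs_nonneg _) hM
        exact (neg_le_neg h2).trans (neg_abs_le _)
      have hw2 := sq_nonneg (w x)
      have e9 : -(L * ρ ^ 4 * w x ^ 2) ≤ χ x ^ 2 * (w x * lap w x) := by
        have h1 : χ x ^ 2 ≤ ρ ^ 4 :=
          (pow_le_pow_left₀ hχ0 hχ1 2).trans_eq (by ring)
        have h2 : χ x ^ 2 * (L * w x ^ 2) ≤ ρ ^ 4 * (L * w x ^ 2) :=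
          mul_le_mul_of_nonneg_right h1 (by positivity)
        have h3 := mul_le_mul_of_nonneg_left e7 (sq_nonneg (χ x))
        linarith
      have e10 : χ x * n * w x ^ 2 ≤ ρ ^ 2 * n * w x ^ 2 := by gcongr
      have e11 : w x ^ 2 * (4 * ‖x - p‖ ^ 2) ≤ w x ^ 2 * (4 * ρ ^ 2) := by gcongr
      have e12 : K * w x ^ 2 ≤ K * ∑ i, dd (bv i) u x * dd (bv i) u x := by gcongr
      have e13 := mul_le_mul_of_nonneg_left e8 hK0.le
      have e14 : y x * lap y x = -(2 * (χ x * n * w x ^ 2)) + χ x ^ 2 * (w x * lap w x)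
          + 2 * (χ x * w x) * ∑ i, dd (bv i) χ x * dd (bv i) w x := by
        rw [e2, hy]; ring
      rw [e4] at e6
      have e15 : K * w x ^ 2 = 12 * ρ ^ 2 * w x ^ 2 + L * ρ ^ 4 * w x ^ 2
          + 2 * (ρ ^ 2 * n * w x ^ 2) := by rw [hK]; ring
      rw [e1, e14, hBn]
      linarith
    · intro x hx
      have hxc := frontier_subset_closure hx
      have hxρ := hball x hxc
      have hx0 := norm_nonneg (x - p)
      have h1 : y x * y x ≤ ρ ^ 4 * C ^ 2 := by
        rcases hfr x hx with h | h
        · have : y x = 0 := by simp [hy, hχ, h]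
          rw [this]; simp; positivity
        · have hC : w x ^ 2 ≤ C ^ 2 := by
            rw [← sq_abs]; exact pow_le_pow_left₀ (abs_nonneg _) h 2
          have hχ0 : 0 ≤ χ x := by simp only [hχ]; nlinarith
          have hχ1 : χ x ≤ ρ ^ 2 := by simp only [hχ]; nlinarith
          have h1 : χ x ^ 2 ≤ ρ ^ 4 :=
          (pow_le_pow_left₀ hχ0 hχ1 2).trans_eq (by ring)
          calc y x * y x = χ x ^ 2 * w x ^ 2 := by simp only [hy]; ring
            _ ≤ _ := mul_le_mul h1 hC (sq_nonneg _) (by positivity)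
      have h2 : u x * u x ≤ M ^ 2 := by
        rw [← pow_two, ← sq_abs]; exact pow_le_pow_left₀ (abs_nonneg _) (huMc x hxc) 2
      have h3 : ‖x - p‖ ^ 2 ≤ ρ ^ 2 := by gcongr
      have h4 := mul_le_mul_of_nonneg_left h2 hK0.le
      have h5 := mul_le_mul_of_nonneg_left h3 hB0.le
      simp only [hv, hR]; linarith
  intro x hx
  have h1 := hres x hx
  have h2 : 0 ≤ K * (u x * u x) := mul_nonneg hK0.le (mul_self_nonneg _)
  have h3 : 0 ≤ B * ‖x - p‖ ^ 2 := by positivity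
  have h4 : y x * y x = (ρ ^ 2 - ‖x - p‖ ^ 2) ^ 2 * w x ^ 2 := by simp only [hy, hχ]; ring
  simp only [hv] at h1
  linarith

end MaximumPrinciple

/-- The standing assumptions on a monotone family of solutions of `-Δu = λ f(u)`. -/
structure SolFamily (n : ℕ) (Ω : Set (Eu n)) (f : ℝ → ℝ) (ls : ℝ) (u : ℝ → Eu n → ℝ)
    (us : Eu n → ℝ) : Prop where
  dim : 5 ≤ n
  isOpen : IsOpen Ω
  bdd : IsBounded Ω
  convex : Convex ℝ Ω
  f_smooth : ContDiff ℝ 1 f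
  f_pos : ∀ t, 0 ≤ t → 0 < f t
  f_mono : StrictMonoOn f (Set.Ici 0)
  ls_pos : 0 < ls
  smooth : ∀ l ∈ Set.Ioo 0 ls, ContDiff ℝ ∞ (u l)
  pos : ∀ l ∈ Set.Ioo 0 ls, ∀ x ∈ Ω, 0 < u l x
  eq : ∀ l ∈ Set.Ioo 0 ls, ∀ x ∈ Ω, -lap (u l) x = l * f (u l x)
  bc : ∀ l ∈ Set.Ioo 0 ls, ∀ x ∈ frontier Ω, u l x = 0
  mono : ∀ l ∈ Set.Ioo 0 ls, ∀ m ∈ Set.Ioo 0 ls, l ≤ m → ∀ x ∈ Ω, u l x ≤ u m x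
  lim : ∀ x ∈ Ω, Tendsto (fun l => u l x) (𝓝[<] ls) (𝓝 (us x))
  integrable : IntegrableOn us Ω

namespace SolFamily

variable {n : ℕ} {Ω : Set (Eu n)} {f : ℝ → ℝ} {ls : ℝ} {u : ℝ → Eu n → ℝ} {us : Eu n → ℝ}

theorem dim_pos (F : SolFamily n Ω f ls u us) : 0 < n := lt_of_lt_of_le (by norm_num) F.dim

theorem mem_of_closure (F : SolFamily n Ω f ls u us) {x : Eu n} (hx : x ∈ closure Ω) :
    x ∈ Ω ∨ x ∈ frontier Ω := by
  by_cases h : x ∈ Ω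
  · exact Or.inl h
  · exact Or.inr ⟨hx, by rwa [F.isOpen.interior_eq]⟩

theorem not_mem_of_frontier (F : SolFamily n Ω f ls u us) {x : Eu n} (hx : x ∈ frontier Ω) :
    x ∉ Ω := by
  have := hx.2
  rwa [F.isOpen.interior_eq] at this

theorem nonneg (F : SolFamily n Ω f ls u us) {l : ℝ} (hl : l ∈ Set.Ioo 0 ls) {x : Eu n}
    (hx : x ∈ closure Ω) : 0 ≤ u l x := by
  rcases F.mem_of_closure hx with h | h
  · exact (F.pos l hl x h).le
  · exact (F.bc l hl x h).ge

theorem mono_closure (F : SolFamily n Ω f ls u us) {l m : ℝ} (hl : l ∈ Set.Ioo 0 ls)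
    (hm : m ∈ Set.Ioo 0 ls) (hlm : l ≤ m) {x : Eu n} (hx : x ∈ closure Ω) : u l x ≤ u m x := by
  rcases F.mem_of_closure hx with h | h
  · exact F.mono l hl m hm hlm x h
  · rw [F.bc l hl x h, F.bc m hm x h]

theorem le_star (F : SolFamily n Ω f ls u us) {l : ℝ} (hl : l ∈ Set.Ioo 0 ls) {x : Eu n}
    (hx : x ∈ Ω) : u l x ≤ us x := by
  refine ge_of_tendsto (F.lim x hx) ?_
  filter_upwards [Ioo_mem_nhdsLT hl.2] with m hm
  exact F.mono l hl m ⟨hl.1.trans hm.1, hm.2⟩ hm.1.le x hx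

theorem deriv_nonneg (F : SolFamily n Ω f ls u us) {t : ℝ} (ht : 0 < t) : 0 ≤ deriv f t := by
  have h1 : 0 ≤ derivWithin f (Set.Ici 0) t := F.f_mono.monotoneOn.derivWithin_nonneg
  rwa [derivWithin_of_mem_nhds (Ici_mem_nhds ht)] at h1

theorem lap_eq_closure (F : SolFamily n Ω f ls u us) {l : ℝ} (hl : l ∈ Set.Ioo 0 ls) {x : Eu n}
    (hx : x ∈ closure Ω) : lap (u l) x = -(l * f (u l x)) := by
  have hc : IsClosed {x | lap (u l) x = -(l * f (u l x))} :=
    isClosed_eq (F.smooth l hl).lap.continuous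
      (continuous_const.mul (F.f_smooth.continuous.comp (F.smooth l hl).continuous)).neg
  refine closure_minimal (fun y hy => ?_) hc hx
  have := F.eq l hl y hy
  simp only [Set.mem_ofPred_eq]; linarith

theorem lap_frontier_neg (F : SolFamily n Ω f ls u us) {l : ℝ} (hl : l ∈ Set.Ioo 0 ls) {x : Eu n}
    (hx : x ∈ frontier Ω) : lap (u l) x < 0 := by
  rw [F.lap_eq_closure hl (frontier_subset_closure hx), F.bc l hl x hx]
  have := mul_pos hl.1 (F.f_pos 0 le_rfl)
  linarith

theorem abs_lap_le (F : SolFamily n Ω f ls u us) {l : ℝ} (hl : l ∈ Set.Ioo 0 ls) {x : Eu n}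
    (hx : x ∈ closure Ω) {M : ℝ} (hM : u l x ≤ M) : |lap (u l) x| ≤ ls * f M := by
  have h0 := F.nonneg hl hx
  have h1 := F.f_pos _ h0
  have h2 : f (u l x) ≤ f M := F.f_mono.monotoneOn h0 (h0.trans hM) hM
  rw [F.lap_eq_closure hl hx, abs_neg, abs_of_pos (mul_pos hl.1 h1)]
  exact mul_le_mul hl.2.le h2 h1.le F.ls_pos.le

theorem lap_dd_eq (F : SolFamily n Ω f ls u us) {l : ℝ} (hl : l ∈ Set.Ioo 0 ls) {x : Eu n}
    (hx : x ∈ Ω) (e : Eu n) :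
    lap (dd e (u l)) x = -(l * deriv f (u l x) * dd e (u l) x) := by
  rw [lap_dd (F.smooth l hl)]
  have h1 : lap (u l) =ᶠ[𝓝 x] fun y => -(l * f (u l y)) := by
    filter_upwards [F.isOpen.mem_nhds hx] with y hy
    exact F.lap_eq_closure hl (subset_closure hy)
  have h2 : HasFDerivAt (fun y => f (u l y)) (deriv f (u l x) • fderiv ℝ (u l) x) x :=
    ((F.f_smooth.differentiable (by simp)) _).hasDerivAt.comp_hasFDerivAt x
      ((F.smooth l hl).diffAt x).hasFDerivAt
  have h3 := (h2.const_mul l).fun_neg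
  simp only [dd]
  rw [h1.fderiv_eq, h3.fderiv]
  simp [mul_assoc]

theorem exists_deriv_bound (F : SolFamily n Ω f ls u us) (M : ℝ) :
    ∃ L, 0 ≤ L ∧ ∀ l ∈ Set.Ioo 0 ls, ∀ t ∈ Set.Icc 0 M, |l * deriv f t| ≤ L := by
  obtain ⟨C, hC⟩ := (isCompact_Icc (a := (0 : ℝ)) (b := M)).exists_bound_of_continuousOn
    (F.f_smooth.continuous_deriv (by simp)).continuousOn
  refine ⟨ls * max C 0, mul_nonneg F.ls_pos.le (le_max_right _ _), fun l hl t ht => ?_⟩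
  rw [abs_mul, abs_of_pos hl.1]
  exact mul_le_mul hl.2.le ((hC t ht).trans (le_max_left _ _)) (abs_nonneg _) F.ls_pos.le

/-- Supporting hyperplanes of the domain. -/
theorem exists_normal (F : SolFamily n Ω f ls u us) {z : Eu n} (hz : z ∈ frontier Ω) :
    ∃ ν : Eu n, ‖ν‖ = 1 ∧ ∀ x ∈ closure Ω, 0 ≤ ⟪ν, z - x⟫ := by
  obtain ⟨φ, hφ⟩ := geometric_hahn_banach_open_point F.convex F.isOpen (F.not_mem_of_frontier hz)
  obtain ⟨x₀, hx₀⟩ : Ω.Nonempty := by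
    by_contra h
    rw [Set.not_nonempty_iff_eq_empty] at h
    simp [h] at hz
  set a := (InnerProductSpace.toDual ℝ (Eu n)).symm φ with ha
  have hin : ∀ x, ⟪a, x⟫ = φ x := fun x => by simp [ha]
  have ha0 : a ≠ 0 := by
    intro h
    have h1 := hφ x₀ hx₀
    rw [← hin, ← hin, h] at h1
    simp at h1
  refine ⟨‖a‖⁻¹ • a, by simp [norm_smul, ha0], ?_⟩
  have hc : IsClosed {x : Eu n | 0 ≤ ⟪‖a‖⁻¹ • a, z - x⟫} :=
    isClosed_le continuous_const (continuous_const.inner (continuous_const.sub continuous_id))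
  refine fun x hx => closure_minimal (fun y hy => ?_) hc hx
  have := hφ y hy
  rw [← hin, ← hin] at this
  simp only [Set.mem_ofPred_eq, real_inner_smul_left, inner_sub_right]
  rw [← mul_sub]
  exact mul_nonneg (inv_nonneg.2 (norm_nonneg _)) (by linarith)

end SolFamily

section Boundary

variable {n : ℕ} {Ω : Set (Eu n)} {f : ℝ → ℝ} {ls : ℝ} {u : ℝ → Eu n → ℝ} {us : Eu n → ℝ}

theorem dd_nonneg_of_ray {g : Eu n → ℝ} (hg : ContDiff ℝ ∞ g) {z y : Eu n} (h0 : g z = 0) {ε : ℝ}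
    (hε : 0 < ε) (h : ∀ s ∈ Set.Ioo 0 ε, 0 ≤ g (z + s • y)) : 0 ≤ dd y g z := by
  have h1 := hasDerivAt_line hg z y 0
  rw [hasDerivAt_iff_tendsto_slope_zero] at h1
  have h2 := h1.mono_left (nhdsWithin_mono 0 (s := Set.Ioi (0 : ℝ)) fun x hx => ne_of_gt hx)
  simp only [zero_smul, add_zero, zero_add, h0, sub_zero] at h2
  refine ge_of_tendsto h2 ?_
  filter_upwards [Ioo_mem_nhdsGT hε] with s hs
  exact mul_nonneg (inv_nonneg.2 hs.1.le) (h s hs)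

theorem frontier_inter_ball_subset (Ω : Set (Eu n)) (z : Eu n) {r : ℝ} (hr : 0 < r) {x : Eu n}
    (hx : x ∈ frontier (Ω ∩ Metric.ball z r)) :
    (x ∈ frontier Ω ∧ ‖x - z‖ ≤ r) ∨ (x ∈ closure Ω ∧ ‖x - z‖ = r) := by
  rcases frontier_inter_subset _ _ hx with ⟨h1, h2⟩ | ⟨h1, h2⟩
  · rw [closure_ball z hr.ne'] at h2
    exact Or.inl ⟨h1, by simpa [dist_eq_norm] using h2⟩
  · rw [frontier_ball z hr.ne'] at h2
    exact Or.inr ⟨h1, by simpa [dist_eq_norm] using h2⟩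

/-- Barrier estimate at a boundary point of a convex domain. -/
theorem SolFamily.boundary_barrier (F : SolFamily n Ω f ls u us) {l : ℝ} (hl : l ∈ Set.Ioo 0 ls)
    {z ν : Eu n} (hν : ‖ν‖ = 1) (hνΩ : ∀ x ∈ closure Ω, 0 ≤ ⟪ν, z - x⟫)
    {r M : ℝ} (hr : 0 < r) (hM : ∀ x ∈ Ω ∩ Metric.ball z r, u l x ≤ M) (hM0 : 0 ≤ M) :
    ∀ x ∈ Ω ∩ Metric.ball z r, u l x ≤ M / r ^ 2 * ‖x - z‖ ^ 2 +
      (n * (M / r ^ 2) + ls * f M + 1) * r * ⟪ν, z - x⟫ := by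
  set κ := M / r ^ 2 with hκ
  set B := n * κ + ls * f M + 1 with hB
  have hκ0 : 0 ≤ κ := by positivity
  have hΛ0 : 0 ≤ ls * f M := mul_nonneg F.ls_pos.le (F.f_pos M hM0).le
  have hB0 : 0 < B := by positivity
  have hus := F.smooth l hl
  set U := Ω ∩ Metric.ball z r with hU
  have hUo : IsOpen U := F.isOpen.inter Metric.isOpen_ball
  have hs1 : ContDiff ℝ ∞ fun x : Eu n => κ * ‖x - z‖ ^ 2 :=
    contDiff_const.mul (contDiff_normSq_sub z)
  have hs2 : ContDiff ℝ ∞ fun x : Eu n => B * r * ⟪ν, x - z⟫ :=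
    contDiff_const.mul (contDiff_inner_sub ν z)
  have hs3 : ContDiff ℝ ∞ fun x : Eu n => B * ⟪ν, x - z⟫ ^ 2 :=
    contDiff_const.mul ((contDiff_inner_sub ν z).pow 2)
  set v : Eu n → ℝ := fun x => κ * ‖x - z‖ ^ 2 - B * r * ⟪ν, x - z⟫ - B * ⟪ν, x - z⟫ ^ 2 - u l x
    with hv
  have hvs : ContDiff ℝ ∞ v := ((hs1.sub hs2).sub hs3).sub hus
  have hin : ∀ x : Eu n, ⟪ν, z - x⟫ = -⟪ν, x - z⟫ := fun x => by
    rw [← inner_neg_right, neg_sub]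
  have hUM : ∀ x ∈ closure U, u l x ≤ M := fun x hx =>
    closure_minimal hM (isClosed_le hus.continuous continuous_const) hx
  have hins : ∀ x ∈ closure U, 0 ≤ ⟪ν, z - x⟫ ∧ ⟪ν, z - x⟫ ≤ r := fun x hx => by
    refine ⟨hνΩ x (closure_mono Set.inter_subset_left hx), (real_inner_le_norm _ _).trans ?_⟩
    have h1 : x ∈ Metric.closedBall z r :=
      closure_minimal (Set.inter_subset_right.trans Metric.ball_subset_closedBall)
        Metric.isClosed_closedBall hx
    rw [hν, one_mul, ← dist_eq_norm, dist_comm]; exact h1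
  have hmain : ∀ x ∈ U, 0 ≤ v x := by
    refine nonneg_of_lap_neg hvs hUo (F.bdd.subset Set.inter_subset_left) ?_ ?_
    · intro x hx
      have h1 : lap v x = κ * (2 * n) - B * 2 - lap (u l) x := by
        rw [hv, lap_sub ((hs1.sub hs2).sub hs3) hus, lap_sub (hs1.sub hs2) hs3, lap_sub hs1 hs2,
          lap_const_mul _ (contDiff_normSq_sub z), lap_const_mul _ (contDiff_inner_sub ν z),
          lap_const_mul _ ((contDiff_inner_sub ν z).pow 2), lap_normSq_sub, lap_inner_sub,
          lap_inner_sub_sq, hν]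
        ring
      have h2 := F.abs_lap_le hl (subset_closure hx.1) (hM x hx)
      have h3 := neg_abs_le (lap (u l) x)
      rw [h1, hB]; linarith
    · intro x hx
      have hxc := frontier_subset_closure hx
      obtain ⟨h1, h2⟩ := hins x hxc
      rw [hin] at h1 h2
      have h4 : 0 ≤ B * (-⟪ν, x - z⟫ * (r + ⟪ν, x - z⟫)) :=
        mul_nonneg hB0.le (mul_nonneg h1 (by linarith))
      simp only [hv]
      rcases frontier_inter_ball_subset Ω z hr hx with ⟨h5, h6⟩ | ⟨h5, h6⟩
      · rw [F.bc l hl x h5]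
        have : 0 ≤ κ * ‖x - z‖ ^ 2 := by positivity
        linarith
      · have h7 : κ * ‖x - z‖ ^ 2 = M := by rw [h6, hκ]; field_simp
        have := hUM x hxc
        linarith
  intro x hx
  have h1 := hmain x hx
  have h2 : 0 ≤ B * ⟪ν, x - z⟫ ^ 2 := by positivity
  simp only [hv] at h1
  rw [hin]; linarith

/-- Upper bound for inward derivatives at a boundary point. -/
theorem SolFamily.dd_boundary_le (F : SolFamily n Ω f ls u us) {l : ℝ} (hl : l ∈ Set.Ioo 0 ls)
    {z y : Eu n} (hz : z ∈ frontier Ω) {r M : ℝ} (hr : 0 < r)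
    (hM : ∀ x ∈ Ω ∩ Metric.ball z r, u l x ≤ M) (hM0 : 0 ≤ M) (hy : ‖y‖ = 1) {ε : ℝ} (hε : 0 < ε)
    (hin : ∀ s ∈ Set.Ioo 0 ε, z + s • y ∈ Ω) :
    dd y (u l) z ≤ (n * (M / r ^ 2) + ls * f M + 1) * r := by
  obtain ⟨ν, hν, hνΩ⟩ := F.exists_normal hz
  have hbar := F.boundary_barrier hl hν hνΩ hr hM hM0
  set A := (n * (M / r ^ 2) + ls * f M + 1) * r with hA
  have hA0 : 0 ≤ A := by
    have hΛ0 : 0 ≤ ls * f M := mul_nonneg F.ls_pos.le (F.f_pos M hM0).le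
    positivity
  set κ := M / r ^ 2
  have hs1 : ContDiff ℝ ∞ fun x : Eu n => κ * ‖x - z‖ ^ 2 :=
    contDiff_const.mul (contDiff_normSq_sub z)
  have hs2 : ContDiff ℝ ∞ fun x : Eu n => A * ⟪ν, x - z⟫ :=
    contDiff_const.mul (contDiff_inner_sub ν z)
  have hray := dd_nonneg_of_ray (y := y) ((hs1.sub hs2).sub (F.smooth l hl)) (z := z)
    (by simp [F.bc l hl z hz]) (lt_min hε hr) (fun s hs => by
      have h1 := hbar (z + s • y) ⟨hin s ⟨hs.1, hs.2.trans_le (min_le_left _ _)⟩, by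
        simpa [norm_smul, hy, abs_of_pos hs.1] using hs.2.trans_le (min_le_right _ _)⟩
      have h2 : ⟪ν, z - (z + s • y)⟫ = -⟪ν, z + s • y - z⟫ := by
        rw [← inner_neg_right, neg_sub]
      rw [h2] at h1
      linarith)
  rw [dd_sub (hs1.sub hs2) (F.smooth l hl), dd_sub hs1 hs2,
    dd_const_mul _ (contDiff_normSq_sub z), dd_const_mul _ (contDiff_inner_sub ν z),
    dd_normSq_sub, dd_inner_sub] at hray
  simp at hray
  have h3 : -⟪ν, y⟫ ≤ 1 := by
    have := neg_le_abs ⟪ν, y⟫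
    have h4 := abs_real_inner_le_norm ν y
    rw [hν, hy] at h4; linarith
  nlinarith

/-- A point near which the family is uniformly bounded. -/
def GoodPt (Ω : Set (Eu n)) (ls : ℝ) (u : ℝ → Eu n → ℝ) (p : Eu n) : Prop :=
  ∃ r > 0, ∃ M, ∀ l ∈ Set.Ioo 0 ls, ∀ x ∈ Ω ∩ Metric.ball p r, u l x ≤ M

/-- The unit vector `y` points strictly into `Ω` at `q`. -/
def InCone (Ω : Set (Eu n)) (q y : Eu n) : Prop := ∃ s : ℝ, 0 < s ∧ q + s • y ∈ Ω

/-- Near `p`, the solutions with parameter at least `l₀` increase in all directions close to `y`. -/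
def MonoNear (Ω : Set (Eu n)) (ls l₀ : ℝ) (u : ℝ → Eu n → ℝ) (y p : Eu n) : Prop :=
  ∃ r > 0, ∃ δ > 0, ∀ y' : Eu n, ‖y'‖ = 1 → ‖y' - y‖ < δ → ∀ l ∈ Set.Ico l₀ ls,
    ∀ x ∈ Ω ∩ Metric.ball p r, 0 ≤ dd y' (u l) x

theorem Convex.add_smul_mem_of_isOpen {Ω : Set (Eu n)} (hc : Convex ℝ Ω) (ho : IsOpen Ω)
    {z y : Eu n} (hz : z ∈ closure Ω) {s t : ℝ} (ht : 0 < t) (hts : t ≤ s) (h : z + s • y ∈ Ω) :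
    z + t • y ∈ Ω := by
  have hs : 0 < s := ht.trans_le hts
  have h1 := hc.add_smul_mem_interior' hz (y := s • y) (by rwa [ho.interior_eq])
    (t := t / s) ⟨by positivity, (div_le_one hs).2 hts⟩
  rw [ho.interior_eq, smul_smul, div_mul_cancel₀ _ hs.ne'] at h1
  exact h1

theorem SolFamily.segment_mem (F : SolFamily n Ω f ls u us) {z y : Eu n} (hz : z ∈ closure Ω)
    {s t : ℝ} (ht : 0 < t) (hts : t ≤ s) (h : z + s • y ∈ Ω) : z + t • y ∈ Ω :=
  F.convex.add_smul_mem_of_isOpen F.isOpen hz ht hts h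

/-- If `y` points inside at `q`, then so do nearby directions at nearby points, uniformly. -/
theorem SolFamily.inCone_nhds (F : SolFamily n Ω f ls u us) {q y : Eu n} (h : InCone Ω q y) :
    ∃ ε > 0, ∀ x ∈ closure Ω, ‖x - q‖ < ε → ∀ y' : Eu n, ‖y' - y‖ < ε → ∀ t ∈ Set.Ioc 0 ε,
      x + t • y' ∈ Ω := by
  obtain ⟨s, hs, hsΩ⟩ := h
  obtain ⟨r, hr, hrΩ⟩ := Metric.isOpen_iff.1 F.isOpen _ hsΩ
  refine ⟨min s (r / (1 + s)), by positivity, fun x hx hxq y' hy' t ht => ?_⟩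
  refine F.segment_mem hx ht.1 (ht.2.trans (min_le_left _ _)) (hrΩ ?_)
  rw [Metric.mem_ball, dist_eq_norm]
  have h1 := hxq.trans_le (min_le_right _ _)
  have h2 := hy'.trans_le (min_le_right _ _)
  calc ‖x + s • y' - (q + s • y)‖ = ‖(x - q) + s • (y' - y)‖ := by congr 1; module
    _ ≤ ‖x - q‖ + s * ‖y' - y‖ := by
      refine (norm_add_le _ _).trans_eq ?_; rw [norm_smul, Real.norm_of_nonneg hs.le]
    _ < r / (1 + s) + s * (r / (1 + s)) := by
      have := mul_lt_mul_of_pos_left h2 hs; linarith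
    _ = r := by field_simp

end Boundary

section Gradient

variable {n : ℕ} {Ω : Set (Eu n)} {f : ℝ → ℝ} {ls : ℝ} {u : ℝ → Eu n → ℝ} {us : Eu n → ℝ}

/-- Uniform Bernstein estimate for the family on sets of bounded size. -/
theorem SolFamily.bernstein (F : SolFamily n Ω f ls u us) {ρ M C : ℝ} (hρ : 0 < ρ) (hM : 0 ≤ M) :
    ∃ R, 0 ≤ R ∧ ∀ l ∈ Set.Ioo 0 ls, ∀ p e : Eu n, ∀ U : Set (Eu n), IsOpen U → U ⊆ Ω →
      U ⊆ Metric.closedBall p ρ → (∀ x ∈ U, u l x ≤ M) → ‖e‖ = 1 →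
      (∀ x ∈ frontier U, ‖x - p‖ = ρ ∨ |dd e (u l) x| ≤ C) →
      ∀ x ∈ U, (ρ ^ 2 - ‖x - p‖ ^ 2) ^ 2 * dd e (u l) x ^ 2 ≤ R := by
  obtain ⟨L, hL, hLb⟩ := F.exists_deriv_bound M
  have hΛ : 0 ≤ ls * f M := mul_nonneg F.ls_pos.le (F.f_pos M hM).le
  refine ⟨_, ?_, fun l hl p e U hU hUΩ hUρ hUM he hfr =>
    bernstein_estimate F.dim_pos (F.smooth l hl) hU hρ hUρ hM hΛ hL he ?_ ?_ ?_ hfr⟩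
  · positivity
  · intro x hx
    rw [abs_of_nonneg (F.nonneg hl (subset_closure (hUΩ hx)))]
    exact hUM x hx
  · exact fun x hx => F.abs_lap_le hl (subset_closure (hUΩ hx)) (hUM x hx)
  · intro x hx
    rw [F.lap_dd_eq hl (hUΩ hx), abs_neg, abs_mul]
    exact mul_le_mul_of_nonneg_right
      (hLb l hl _ ⟨F.nonneg hl (subset_closure (hUΩ hx)), hUM x hx⟩) (abs_nonneg _)

/-- Interior gradient bound. -/
theorem SolFamily.grad_bound (F : SolFamily n Ω f ls u us) {ρ M : ℝ} (hρ : 0 < ρ) :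
    ∃ C, 0 ≤ C ∧ ∀ l ∈ Set.Ioo 0 ls, ∀ p, Metric.ball p ρ ⊆ Ω →
      (∀ x ∈ Metric.ball p ρ, u l x ≤ M) → ‖gradient (u l) p‖ ≤ C := by
  obtain ⟨R, hR0, hR⟩ := F.bernstein (C := 0) hρ (le_max_right M 0)
  refine ⟨√R / ρ ^ 2, by positivity, fun l hl p hp hpM => ?_⟩
  rcases eq_or_ne (gradient (u l) p) 0 with h0 | h0
  · rw [h0, norm_zero]; positivity
  set e := ‖gradient (u l) p‖⁻¹ • gradient (u l) p with he
  have he1 : ‖e‖ = 1 := by simp [he, norm_smul, h0]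
  have hde : dd e (u l) p = ‖gradient (u l) p‖ := by
    rw [← inner_gradient, he, real_inner_smul_right, real_inner_self_eq_norm_sq]
    have := norm_ne_zero_iff.2 h0
    field_simp
  have h1 := hR l hl p e _ Metric.isOpen_ball hp Metric.ball_subset_closedBall
    (fun x hx => (hpM x hx).trans (le_max_left _ _)) he1 (fun x hx => by
      rw [frontier_ball p hρ.ne'] at hx
      exact Or.inl (by simpa [dist_eq_norm] using hx)) p (Metric.mem_ball_self hρ)
  rw [hde] at h1
  simp only [sub_self, norm_zero] at h1
  rw [le_div_iff₀ (by positivity)]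
  refine Real.le_sqrt_of_sq_le ?_
  nlinarith

set_option maxHeartbeats 1000000 in
theorem SolFamily.monoNear (F : SolFamily n Ω f ls u us) {l₀ : ℝ} (hl₀ : l₀ ∈ Set.Ioo 0 ls)
    {p : Eu n} (hp : p ∈ frontier Ω) (hgood : GoodPt Ω ls u p) {y : Eu n}
    (hd : 0 < dd y (u l₀) p) (hc : InCone Ω p y) : MonoNear Ω ls l₀ u y p := by
  obtain ⟨r, hr, M₀, hM₀⟩ := hgood
  set M := max M₀ 0 with hMdef
  have hM0 : 0 ≤ M := le_max_right _ _
  have hM : ∀ l ∈ Set.Ioo 0 ls, ∀ x ∈ Ω ∩ Metric.ball p r, u l x ≤ M :=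
    fun l hl x hx => (hM₀ l hl x hx).trans (le_max_left _ _)
  obtain ⟨ε, hε, hεΩ⟩ := F.inCone_nhds hc
  set c := dd y (u l₀) p / 2 with hcdef
  have hc0 : 0 < c := by positivity
  obtain ⟨r₁, hr₁, hr₁c⟩ : ∃ r₁ > 0, ∀ z y' : Eu n, ‖z - p‖ < r₁ → ‖y' - y‖ < r₁ →
      c ≤ dd y' (u l₀) z := by
    have hcont : Continuous fun q : Eu n × Eu n => dd q.2 (u l₀) q.1 :=
      (((F.smooth l₀ hl₀).continuous_fderiv (by simp)).comp continuous_fst).clm_apply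
        continuous_snd
    have hmem : {q : Eu n × Eu n | c < dd q.2 (u l₀) q.1} ∈ 𝓝 (p, y) :=
      (isOpen_lt continuous_const hcont).mem_nhds (by
        change c < dd y (u l₀) p
        rw [hcdef]; linarith)
    obtain ⟨r₁, hr₁, hsub⟩ := Metric.mem_nhds_iff.1 hmem
    refine ⟨r₁, hr₁, fun z y' hz hy' => le_of_lt (hsub (?_ : (z, y') ∈ _))⟩
    rw [Metric.mem_ball, Prod.dist_eq, dist_eq_norm, dist_eq_norm]
    exact max_lt hz hy'
  set ρ := min (r / 2) (min ε r₁) with hρdef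
  have hρ : 0 < ρ := by positivity
  have hρr : ρ ≤ r / 2 := min_le_left _ _
  have hρε : ρ ≤ ε := (min_le_right _ _).trans (min_le_left _ _)
  have hρr₁ : ρ ≤ r₁ := (min_le_right _ _).trans (min_le_right _ _)
  set A := (n * (M / (r / 2) ^ 2) + ls * f M + 1) * (r / 2) with hA
  have hbd : ∀ z ∈ frontier Ω, ‖z - p‖ < ρ → ∀ y' : Eu n, ‖y'‖ = 1 → ‖y' - y‖ < ρ →
      ∀ l ∈ Set.Ico l₀ ls, c ≤ dd y' (u l) z ∧ dd y' (u l) z ≤ A := by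
    intro z hz hzp y' hy'1 hy' l hl
    have hl' : l ∈ Set.Ioo 0 ls := ⟨hl₀.1.trans_le hl.1, hl.2⟩
    have hray : ∀ s ∈ Set.Ioo 0 ε, z + s • y' ∈ Ω := fun s hs =>
      hεΩ z (frontier_subset_closure hz) (hzp.trans_le hρε) y' (hy'.trans_le hρε) s
        ⟨hs.1, hs.2.le⟩
    constructor
    · have h1 := dd_nonneg_of_ray (y := y') ((F.smooth l hl').sub (F.smooth l₀ hl₀)) (z := z)
        (by rw [F.bc l hl' z hz, F.bc l₀ hl₀ z hz, sub_zero]) hε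
        (fun s hs => sub_nonneg.2 (F.mono l₀ hl₀ l hl' hl.1 _ (hray s hs)))
      rw [dd_sub (F.smooth l hl') (F.smooth l₀ hl₀)] at h1
      have h2 := hr₁c z y' (hzp.trans_le hρr₁) (hy'.trans_le hρr₁)
      linarith
    · refine F.dd_boundary_le hl' hz (r := r / 2) (by positivity) ?_ hM0 hy'1 hε hray
      rintro x ⟨hx, hxz⟩
      refine hM l hl' x ⟨hx, ?_⟩
      rw [Metric.mem_ball] at hxz ⊢
      rw [← dist_eq_norm] at hzp
      linarith [dist_triangle x z p]
  obtain ⟨R, hR0, hR⟩ := F.bernstein (C := A) hρ hM0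
  set σ := ρ / 2 with hσdef
  have hσ : 0 < σ := by positivity
  set C := √R / (3 / 4 * ρ ^ 2) with hCdef
  have hC0 : 0 ≤ C := by positivity
  obtain ⟨L, hL, hLb⟩ := F.exists_deriv_bound M
  obtain ⟨ν, hν, hνΩ⟩ := F.exists_normal hp
  set κ := (c + C) / σ ^ 2 with hκ
  have hκ0 : 0 < κ := by positivity
  set B := L * C + n * κ + 1 with hB
  have hB0 : 0 < B := by positivity
  set η := min σ (min 1 (c / (B * σ + κ + 1))) with hη
  have hη0 : 0 < η := by positivity
  refine ⟨η, hη0, ρ, hρ, fun y' hy'1 hy' l hl x hx => ?_⟩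
  have hl' : l ∈ Set.Ioo 0 ls := ⟨hl₀.1.trans_le hl.1, hl.2⟩
  set w := dd y' (u l) with hw
  have hws : ContDiff ℝ ∞ w := (F.smooth l hl').dd y'
  have hgrad : ∀ x ∈ Ω ∩ Metric.ball p σ, |w x| ≤ C := by
    rintro x ⟨hx, hxp⟩
    rw [Metric.mem_ball, dist_eq_norm] at hxp
    have h1 := hR l hl' p y' (Ω ∩ Metric.ball p ρ) (F.isOpen.inter Metric.isOpen_ball)
      Set.inter_subset_left (Set.inter_subset_right.trans Metric.ball_subset_closedBall)
      (fun z hz => hM l hl' z ⟨hz.1, Metric.ball_subset_ball (by linarith) hz.2⟩) hy'1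
      (fun z hz => by
        rcases frontier_inter_ball_subset Ω p hρ hz with ⟨h5, h6⟩ | ⟨h5, h6⟩
        · rcases h6.lt_or_eq with h7 | h7
          · obtain ⟨h8, h9⟩ := hbd z h5 h7 y' hy'1 hy' l hl
            exact Or.inr (abs_le.2 ⟨by linarith, h9⟩)
          · exact Or.inl h7
        · exact Or.inl h6) x ⟨hx, by
          rw [Metric.mem_ball, dist_eq_norm]; linarith⟩
    rw [hCdef, le_div_iff₀ (by positivity)]
    refine Real.le_sqrt_of_sq_le (le_trans ?_ h1)
    have h2 : ‖x - p‖ ^ 2 ≤ (ρ / 2) ^ 2 := pow_le_pow_left₀ (norm_nonneg _) hxp.le 2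
    have h3 : 3 / 4 * ρ ^ 2 ≤ ρ ^ 2 - ‖x - p‖ ^ 2 := by linarith
    have h4 : (3 / 4 * ρ ^ 2) ^ 2 ≤ (ρ ^ 2 - ‖x - p‖ ^ 2) ^ 2 :=
      pow_le_pow_left₀ (by positivity) h3 2
    calc (|w x| * (3 / 4 * ρ ^ 2)) ^ 2 = (3 / 4 * ρ ^ 2) ^ 2 * w x ^ 2 := by
          rw [mul_pow, sq_abs]; ring
      _ ≤ _ := mul_le_mul_of_nonneg_right h4 (sq_nonneg _)
  have hs1 : ContDiff ℝ ∞ fun x : Eu n => κ * ‖x - p‖ ^ 2 :=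
    contDiff_const.mul (contDiff_normSq_sub p)
  have hs2 : ContDiff ℝ ∞ fun x : Eu n => B * σ * ⟪ν, x - p⟫ :=
    contDiff_const.mul (contDiff_inner_sub ν p)
  have hs3 : ContDiff ℝ ∞ fun x : Eu n => B * ⟪ν, x - p⟫ ^ 2 :=
    contDiff_const.mul ((contDiff_inner_sub ν p).pow 2)
  set v : Eu n → ℝ := fun x => w x - c - B * σ * ⟪ν, x - p⟫ - B * ⟪ν, x - p⟫ ^ 2
    + κ * ‖x - p‖ ^ 2 with hv
  have hwc : ContDiff ℝ ∞ fun x => w x - c := hws.sub contDiff_const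
  have hvs : ContDiff ℝ ∞ v := ((hwc.sub hs2).sub hs3).add hs1
  have hin : ∀ x : Eu n, ⟪ν, p - x⟫ = -⟪ν, x - p⟫ := fun x => by
    rw [← inner_neg_right, neg_sub]
  set U := Ω ∩ Metric.ball p σ with hU
  have hUo : IsOpen U := F.isOpen.inter Metric.isOpen_ball
  have hins : ∀ x ∈ closure U, 0 ≤ ⟪ν, p - x⟫ ∧ ⟪ν, p - x⟫ ≤ σ := fun x hx => by
    refine ⟨hνΩ x (closure_mono Set.inter_subset_left hx), (real_inner_le_norm _ _).trans ?_⟩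
    have h1 : x ∈ Metric.closedBall p σ :=
      closure_minimal (Set.inter_subset_right.trans Metric.ball_subset_closedBall)
        Metric.isClosed_closedBall hx
    rw [hν, one_mul, ← dist_eq_norm, dist_comm]; exact h1
  have hmain : ∀ x ∈ U, 0 ≤ v x := by
    refine nonneg_of_lap_neg hvs hUo (F.bdd.subset Set.inter_subset_left) ?_ ?_
    · intro x hx
      have h1 : lap v x = lap w x - B * 2 + κ * (2 * n) := by
        rw [hv, lap_add ((hwc.sub hs2).sub hs3) hs1, lap_sub (hwc.sub hs2) hs3, lap_sub hwc hs2,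
          lap_sub hws contDiff_const, lap_const,
          lap_const_mul _ (contDiff_normSq_sub p), lap_const_mul _ (contDiff_inner_sub ν p),
          lap_const_mul _ ((contDiff_inner_sub ν p).pow 2), lap_normSq_sub, lap_inner_sub,
          lap_inner_sub_sq, hν]
        ring
      have h2 : lap w x ≤ L * C := by
        rw [hw, F.lap_dd_eq hl' hx.1]
        refine (neg_le_abs _).trans ?_
        rw [abs_mul]
        refine mul_le_mul (hLb l hl' _ ⟨F.nonneg hl' (subset_closure hx.1), hM l hl' x ⟨hx.1, ?_⟩⟩)
          (hgrad x hx) (abs_nonneg _) hL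
        exact Metric.ball_subset_ball (by linarith) hx.2
      have h3 : 0 ≤ L * C := mul_nonneg hL hC0
      rw [h1, hB]; linarith
    · intro x hx
      have hxc := frontier_subset_closure hx
      obtain ⟨h1, h2⟩ := hins x hxc
      rw [hin] at h1 h2
      have h4 : 0 ≤ B * (-⟪ν, x - p⟫ * (σ + ⟪ν, x - p⟫)) :=
        mul_nonneg hB0.le (mul_nonneg h1 (by linarith))
      simp only [hv]
      rcases frontier_inter_ball_subset Ω p hσ hx with ⟨h5, h6⟩ | ⟨h5, h6⟩
      · have h7 := (hbd x h5 (by linarith) y' hy'1 hy' l hl).1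
        have : 0 ≤ κ * ‖x - p‖ ^ 2 := by positivity
        linarith
      · have h7 : κ * ‖x - p‖ ^ 2 = c + C := by rw [h6, hκ]; field_simp
        have h8 : |w x| ≤ C :=
          closure_minimal hgrad (isClosed_le hws.continuous.abs continuous_const) hxc
        have := neg_abs_le (w x)
        linarith
  have hxη : ‖x - p‖ < η := by simpa [dist_eq_norm] using hx.2
  have hxU : x ∈ U := ⟨hx.1, Metric.ball_subset_ball (min_le_left _ _) hx.2⟩
  have h1 := hmain x hxU
  have h2 := (hins x (subset_closure hxU)).1
  have h3 : ⟪ν, p - x⟫ ≤ η := by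
    refine (real_inner_le_norm _ _).trans ?_
    rw [hν, one_mul, norm_sub_rev]; exact hxη.le
  rw [hin] at h3
  have hη1 : η ≤ 1 := (min_le_right _ _).trans (min_le_left _ _)
  have hη2 : η ≤ c / (B * σ + κ + 1) := (min_le_right _ _).trans (min_le_right _ _)
  rw [le_div_iff₀ (by positivity)] at hη2
  have h4 : κ * ‖x - p‖ ^ 2 ≤ κ * η := by
    refine mul_le_mul_of_nonneg_left ?_ hκ0.le
    nlinarith [norm_nonneg (x - p)]
  have h5 : B * σ * -⟪ν, x - p⟫ ≤ B * σ * η := mul_le_mul_of_nonneg_left h3 (by positivity)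
  have h6 : 0 ≤ B * ⟪ν, x - p⟫ ^ 2 := by positivity
  simp only [hv] at h1
  linarith

end Gradient

section Sweep

variable {n : ℕ} {Ω : Set (Eu n)} {f : ℝ → ℝ} {ls : ℝ} {u : ℝ → Eu n → ℝ} {us : Eu n → ℝ}

/-- The moving plane argument, comparing two solutions with different parameters. -/
theorem SolFamily.sweep (F : SolFamily n Ω f ls u us) {l' l : ℝ} (hl' : l' ∈ Set.Ioo 0 ls)
    (hl : l ∈ Set.Ioo 0 ls) (hlt : l' < l) {e : Eu n} (he : ‖e‖ = 1) {W : Set (Eu n)}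
    (hW : IsOpen W) {c₀ c₁ : ℝ} (hempty : ∀ x ∈ closure Ω ∩ closure W, ⟪e, x⟫ < c₁)
    (href : ∀ c ∈ Set.Icc c₀ c₁, ∀ x ∈ closure Ω ∩ closure W, c < ⟪e, x⟫ → hrefl e c x ∈ Ω)
    (hfr : ∀ c ∈ Set.Icc c₀ c₁, ∀ x ∈ closure Ω ∩ frontier W, c < ⟪e, x⟫ →
      u l' x ≤ u l (hrefl e c x)) :
    ∀ c ∈ Set.Icc c₀ c₁, ∀ x ∈ closure Ω ∩ closure W, c ≤ ⟪e, x⟫ → u l' x ≤ u l (hrefl e c x) := by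
  have hs := F.smooth l hl
  have hs' := F.smooth l' hl'
  have hTc : Continuous fun q : ℝ × Eu n => hrefl e q.1 q.2 := by unfold hrefl; fun_prop
  set G : ℝ × Eu n → ℝ := fun q => u l (hrefl e q.1 q.2) - u l' q.2 with hG
  have hGc : Continuous G := (hs.continuous.comp hTc).sub (hs'.continuous.comp continuous_snd)
  have hX : IsCompact (closure Ω ∩ closure W) :=
    F.bdd.isCompact_closure.inter_right isClosed_closure
  set Z : Set (ℝ × Eu n) := {q | q ∈ Set.Icc c₀ c₁ ×ˢ (closure Ω ∩ closure W) ∧ q.1 ≤ ⟪e, q.2⟫ ∧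
    G q ≤ 0 ∧ l * f (u l (hrefl e q.1 q.2)) ≤ l' * f (u l' q.2)} with hZ
  have hZc : IsCompact Z := by
    refine (isCompact_Icc.prod hX).inter_right (t := {q : ℝ × Eu n | q.1 ≤ ⟪e, q.2⟫ ∧
      G q ≤ 0 ∧ l * f (u l (hrefl e q.1 q.2)) ≤ l' * f (u l' q.2)}) ?_
    have h1 : IsClosed {q : ℝ × Eu n | l * f (u l (hrefl e q.1 q.2)) ≤ l' * f (u l' q.2)} :=
      isClosed_le
        (continuous_const.mul (F.f_smooth.continuous.comp (hs.continuous.comp hTc)))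
        (continuous_const.mul (F.f_smooth.continuous.comp (hs'.continuous.comp continuous_snd)))
    exact (isClosed_le continuous_fst (continuous_const.inner continuous_snd)).inter
      ((isClosed_le hGc continuous_const).inter h1)
  have hpos : ∀ c x, x ∈ closure Ω → c = ⟪e, x⟫ → 0 ≤ G (c, x) := by
    intro c x hx hc
    have : hrefl e c x = x := by simp [hrefl, hc]
    simp only [hG, this, sub_nonneg]
    exact F.mono_closure hl' hl hlt.le hx
  have hcrit : ∀ c ∈ Set.Icc c₀ c₁, ∀ x ∈ closure Ω ∩ closure W, c ≤ ⟪e, x⟫ → G (c, x) < 0 →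
      ∃ y, (c, y) ∈ Z := by
    intro c hc x hx hcx hneg
    have hD : IsCompact ((closure Ω ∩ closure W) ∩ {x | c ≤ ⟪e, x⟫}) :=
      hX.inter_right (isClosed_le continuous_const (continuous_const.inner continuous_id))
    have hGcc : Continuous fun x => G (c, x) := hGc.comp (by fun_prop)
    obtain ⟨y, ⟨hyX, hyc⟩, hmin⟩ := hD.exists_isMinOn ⟨x, hx, hcx⟩ hGcc.continuousOn
    have hyneg : G (c, y) < 0 := (hmin (show x ∈ _ from ⟨hx, hcx⟩)).trans_lt hneg
    have hyc' : c < ⟪e, y⟫ :=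
      lt_of_le_of_ne hyc fun h => absurd (hpos c y hyX.1 h) (not_le.2 hyneg)
    have hTy := href c hc y hyX hyc'
    have hyΩ : y ∈ Ω := by
      rcases F.mem_of_closure hyX.1 with h | h
      · exact h
      · refine absurd ?_ (not_le.2 hyneg)
        simp only [hG, F.bc l' hl' y h, sub_zero]
        exact F.nonneg hl (subset_closure hTy)
    have hyW : y ∈ W := by
      by_contra h
      refine absurd ?_ (not_le.2 hyneg)
      exact sub_nonneg.2 (hfr c hc y ⟨hyX.1, hyX.2, by rwa [hW.interior_eq]⟩ hyc')
    have hnhds : (closure Ω ∩ closure W) ∩ {x | c ≤ ⟪e, x⟫} ∈ 𝓝 y := by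
      have h1 : {x | c < ⟪e, x⟫} ∈ 𝓝 y :=
        (isOpen_lt continuous_const (continuous_const.inner continuous_id)).mem_nhds hyc'
      filter_upwards [F.isOpen.mem_nhds hyΩ, hW.mem_nhds hyW, h1] with z h1 h2 h3
      exact ⟨⟨subset_closure h1, subset_closure h2⟩, le_of_lt h3⟩
    have hlm : IsLocalMin (fun x => G (c, x)) y := hmin.isLocalMin hnhds
    have hcomp : ContDiff ℝ ∞ fun x => u l (hrefl e c x) := hs.comp (contDiff_hrefl e c)
    have hlap := lap_nonneg_of_isLocalMin (hcomp.sub hs') hlm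
    have h2 : lap (fun x => u l (hrefl e c x) - u l' x) y =
        lap (u l) (hrefl e c y) - lap (u l') y := by
      rw [lap_sub hcomp hs', lap_comp_hrefl hs he]
    change 0 ≤ lap (fun x => u l (hrefl e c x) - u l' x) y at hlap
    rw [h2, F.lap_eq_closure hl (subset_closure hTy), F.lap_eq_closure hl' hyX.1] at hlap
    exact ⟨y, ⟨hc, hyX⟩, hyc, hyneg.le, by simp only; linarith⟩
  by_contra! hcon
  obtain ⟨c, hc, x, hx, hcx, hlt'⟩ := hcon
  obtain ⟨y, hy⟩ := hcrit c hc x hx hcx (by simp only [hG]; linarith)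
  obtain ⟨⟨cs, xs⟩, hsZ, hmax⟩ := hZc.exists_isMaxOn ⟨_, hy⟩ continuous_fst.continuousOn
  obtain ⟨⟨hcs, hxs⟩, hcxs, hGs, hfs⟩ := hsZ
  simp only at hcs hxs hcxs hfs
  rcases hGs.lt_or_eq with h | h
  · have hcx' : cs < ⟪e, xs⟫ :=
      lt_of_le_of_ne hcxs fun h' => absurd (hpos cs xs hxs.1 h') (not_le.2 h)
    have hcont : ContinuousAt (fun c => G (c, xs)) cs := (hGc.comp (by fun_prop)).continuousAt
    have hev : ∀ᶠ c in 𝓝 cs, G (c, xs) < 0 ∧ c < ⟪e, xs⟫ :=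
      (hcont.eventually_lt continuousAt_const h).and (eventually_lt_nhds hcx')
    obtain ⟨c', ⟨h1, h2⟩, h3⟩ := ((hev.filter_mono nhdsWithin_le_nhds).and
      (self_mem_nhdsWithin : Set.Ioi cs ∈ 𝓝[>] cs)).exists
    obtain ⟨y', hy'⟩ := hcrit c' ⟨hcs.1.trans (le_of_lt h3), (h2.trans (hempty xs hxs)).le⟩ xs hxs
      h2.le h1
    exact absurd (hmax hy') (not_le.2 h3)
  · have h1 : u l (hrefl e cs xs) = u l' xs := by simp only [hG] at h; linarith
    rw [h1] at hfs
    have h2 := F.f_pos _ (F.nonneg hl' hxs.1)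
    nlinarith

theorem exists_uniform_of_isCompact {X : Type*} [PseudoMetricSpace X] {K : Set X}
    (hK : IsCompact K) {R : ℝ → X → Prop} (hanti : ∀ a b x, a ≤ b → R b x → R a x)
    (h : ∀ q ∈ K, ∃ ε > 0, ∀ x, dist x q < ε → R ε x) :
    ∃ ε > 0, ∀ q ∈ K, ∀ x, dist x q < ε → R ε x := by
  refine hK.induction_on (p := fun S => ∃ ε > 0, ∀ q ∈ S, ∀ x, dist x q < ε → R ε x) ?_ ?_ ?_ ?_
  · exact ⟨1, one_pos, by simp⟩
  · rintro s t hst ⟨ε, hε, h1⟩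
    exact ⟨ε, hε, fun q hq => h1 q (hst hq)⟩
  · rintro s t ⟨ε, hε, h1⟩ ⟨ε', hε', h2⟩
    refine ⟨min ε ε', lt_min hε hε', fun q hq x hx => ?_⟩
    rcases hq with hq | hq
    · exact hanti _ _ _ (min_le_left _ _) (h1 q hq x (hx.trans_le (min_le_left _ _)))
    · exact hanti _ _ _ (min_le_right _ _) (h2 q hq x (hx.trans_le (min_le_right _ _)))
  · intro q hq
    obtain ⟨ε, hε, h1⟩ := h q hq
    refine ⟨Metric.ball q (ε / 2), mem_nhdsWithin_of_mem_nhds (Metric.ball_mem_nhds q (by positivity)),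
      ε / 2, by positivity, fun q' hq' x hx => hanti _ _ _ (half_le_self hε.le) (h1 x ?_)⟩
    rw [Metric.mem_ball] at hq'
    linarith [dist_triangle x q' q]

theorem exists_slice_near {X : Type*} [PseudoMetricSpace X] {K : Set X}
    (hK : IsCompact K) {g : X → ℝ} (hg : Continuous g) {m : ℝ} (hm : ∀ x ∈ K, g x ≤ m) {ε : ℝ}
    (hε : 0 < ε) : ∃ τ > 0, ∀ x ∈ K, m - τ ≤ g x → ∃ q ∈ K, g q = m ∧ dist x q < ε := by
  set S := Metric.thickening ε {q ∈ K | g q = m} with hS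
  have hcomp : IsCompact (K \ S) := hK.diff Metric.isOpen_thickening
  have hcon : ∀ x ∈ K, x ∈ S → ∃ q ∈ K, g q = m ∧ dist x q < ε := by
    intro x _ hx
    obtain ⟨q, ⟨hq, hqm⟩, hd⟩ := Metric.mem_thickening_iff.1 hx
    exact ⟨q, hq, hqm, hd⟩
  rcases (K \ S).eq_empty_or_nonempty with h | h
  · exact ⟨1, one_pos, fun x hx _ => hcon x hx (by
      by_contra hxS
      exact absurd (show x ∈ K \ S from ⟨hx, hxS⟩) (by simp [h]))⟩
  · obtain ⟨y, hy, hmax⟩ := hcomp.exists_isMaxOn h hg.continuousOn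
    have hylt : g y < m := by
      refine lt_of_le_of_ne (hm y hy.1) fun hym => hy.2 ?_
      exact Metric.self_subset_thickening hε _ ⟨hy.1, hym⟩
    refine ⟨(m - g y) / 2, by linarith, fun x hx hxm => hcon x hx ?_⟩
    by_contra hxS
    have h1 : g x ≤ g y := hmax (show x ∈ K \ S from ⟨hx, hxS⟩)
    linarith

set_option maxHeartbeats 1000000 in
/-- A boundary point through which a suitable supporting hyperplane passes is a good point. -/
theorem SolFamily.goodPt_of_support (F : SolFamily n Ω f ls u us) {l₀ : ℝ}
    (hl₀ : l₀ ∈ Set.Ioo 0 ls) {e p : Eu n} (he : ‖e‖ = 1)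
    (hsup : ∀ x ∈ closure Ω, ⟪e, x⟫ ≤ ⟪e, p⟫) {W : Set (Eu n)} (hW : IsOpen W) (hpW : p ∈ W)
    (hT : ∀ q ∈ closure Ω ∩ closure W, ⟪e, q⟫ = ⟪e, p⟫ → InCone Ω q (-e))
    (hZ : ∀ z ∈ closure Ω ∩ frontier W, ⟪e, z⟫ = ⟪e, p⟫ → MonoNear Ω ls l₀ u (-e) z) :
    GoodPt Ω ls u p := by
  set m := ⟪e, p⟫ with hm
  have hge : Continuous fun x : Eu n => ⟪e, x⟫ := continuous_const.inner continuous_id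
  have hcl : IsCompact (closure Ω) := F.bdd.isCompact_closure
  have hX : IsCompact (closure Ω ∩ closure W) := hcl.inter_right isClosed_closure
  have hX' : IsCompact (closure Ω ∩ frontier W) := hcl.inter_right isClosed_frontier
  have hslice : IsClosed {x : Eu n | ⟪e, x⟫ = m} := isClosed_eq hge continuous_const
  obtain ⟨εT, hεT, hTu⟩ := exists_uniform_of_isCompact (hX.inter_right hslice)
    (R := fun ε x => x ∈ closure Ω → ∀ y' : Eu n, ‖y' - (-e)‖ < ε → ∀ t ∈ Set.Ioc 0 ε,
      x + t • y' ∈ Ω)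
    (fun a b x hab h hx y' hy' t ht => h hx y' (hy'.trans_le hab) t ⟨ht.1, ht.2.trans hab⟩)
    (fun q hq => by
      obtain ⟨ε, hε, h⟩ := F.inCone_nhds (hT q hq.1 hq.2)
      exact ⟨ε, hε, fun x hx hxc => h x hxc (by rwa [← dist_eq_norm])⟩)
  obtain ⟨εZ, hεZ, hZu⟩ := exists_uniform_of_isCompact (hX'.inter_right hslice)
    (R := fun ε x => x ∈ Ω → ∀ y' : Eu n, ‖y'‖ = 1 → ‖y' - (-e)‖ < ε → ∀ l ∈ Set.Ico l₀ ls,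
      0 ≤ dd y' (u l) x)
    (fun a b x hab h hx y' hy1 hy' => h hx y' hy1 (hy'.trans_le hab))
    (fun q hq => by
      obtain ⟨r, hr, δ, hδ, h⟩ := hZ q hq.1 hq.2
      refine ⟨min r δ, lt_min hr hδ, fun x hx hxΩ y' hy1 hy' l hl => ?_⟩
      exact h y' hy1 (hy'.trans_le (min_le_right _ _)) l hl x
        ⟨hxΩ, hx.trans_le (min_le_left _ _)⟩)
  set ε := min εT εZ / 2 with hεdef
  have hε : 0 < ε := by positivity
  have hεT' : 2 * ε ≤ εT := by rw [hεdef]; linarith [min_le_left εT εZ]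
  have hεZ' : 2 * ε ≤ εZ := by rw [hεdef]; linarith [min_le_right εT εZ]
  obtain ⟨τ₁, hτ₁, hs₁⟩ := exists_slice_near hX hge (fun x hx => hsup x hx.1) hε
  obtain ⟨τ₂, hτ₂, hs₂⟩ := exists_slice_near hX' hge (fun x hx => hsup x hx.1) hε
  set τ := min (min τ₁ τ₂) (ε / 2) with hτdef
  have hτ : 0 < τ := by positivity
  have hτ1 : τ ≤ τ₁ := (min_le_left _ _).trans (min_le_left _ _)
  have hτ2 : τ ≤ τ₂ := (min_le_left _ _).trans (min_le_right _ _)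
  have hτε : τ ≤ ε / 2 := min_le_right _ _
  obtain ⟨R₀, hR₀, hR₀b⟩ := hcl.isBounded.exists_pos_norm_le
  set δ := min ε (τ / (8 * R₀)) with hδdef
  have hδ : 0 < δ := by positivity
  have hδR : δ * R₀ ≤ τ / 8 := by
    calc δ * R₀ ≤ τ / (8 * R₀) * R₀ := by gcongr; exact min_le_right _ _
      _ = τ / 8 := by field_simp
  have hδε : δ ≤ ε := min_le_left _ _
  have hclose : ∀ e' : Eu n, ‖e' - e‖ < δ → ∀ x ∈ closure Ω, |⟪e', x⟫ - ⟪e, x⟫| ≤ τ / 8 := by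
    intro e' he' x hx
    rw [← inner_sub_left]
    refine (abs_real_inner_le_norm _ _).trans (le_trans ?_ hδR)
    exact mul_le_mul he'.le (hR₀b x hx) (norm_nonneg _) hδ.le
  have hcomp : ∀ e' : Eu n, ‖e'‖ = 1 → ‖e' - e‖ < δ → ∀ l' ∈ Set.Ioo 0 ls,
      ∀ c ∈ Set.Icc (m - τ / 2) (m + τ / 4), ∀ x ∈ closure Ω ∩ closure W, c < ⟪e', x⟫ →
      hrefl e' c x ∈ Ω ∧ u l' x ≤ us (hrefl e' c x) := by
    intro e' he'1 he' l' hl'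
    have hneg : ‖-e' - (-e)‖ < δ := by rwa [← neg_sub', norm_neg]
    set l := max l₀ ((l' + ls) / 2) with hldef
    have hl'ls := hl'.2
    have hl'0 := hl'.1
    have hl : l ∈ Set.Ioo 0 ls :=
      ⟨hl₀.1.trans_le (le_max_left _ _), max_lt hl₀.2 (by linarith)⟩
    have hlt : l' < l := lt_of_lt_of_le (by linarith) (le_max_right _ _)
    have ht : ∀ c ∈ Set.Icc (m - τ / 2) (m + τ / 4), ∀ x ∈ closure Ω, c < ⟪e', x⟫ →
        0 < 2 * (⟪e', x⟫ - c) ∧ 2 * (⟪e', x⟫ - c) ≤ ε ∧ m - τ ≤ ⟪e, x⟫ := by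
      intro c hc x hx hcx
      have h1 := abs_le.1 (hclose e' he' x hx)
      have h2 := hsup x hx
      have h3 := hc.1
      refine ⟨by linarith, ?_, ?_⟩ <;> linarith [h1.1, h1.2]
    have heq : ∀ c x, hrefl e' c x = x + (2 * (⟪e', x⟫ - c)) • (-e') := by
      intro c x; simp [hrefl, sub_eq_add_neg]
    have href : ∀ c ∈ Set.Icc (m - τ / 2) (m + τ / 4), ∀ x ∈ closure Ω ∩ closure W, c < ⟪e', x⟫ →
        hrefl e' c x ∈ Ω := by
      intro c hc x hx hcx
      obtain ⟨h1, h2, h3⟩ := ht c hc x hx.1 hcx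
      obtain ⟨q, hq, hqm, hd⟩ := hs₁ x hx (by linarith)
      rw [heq]
      exact hTu q ⟨hq, hqm⟩ x (by linarith) hx.1 _ (by linarith) _ ⟨h1, by linarith⟩
    have hsw := F.sweep hl' hl hlt he'1 hW (c₀ := m - τ / 2) (c₁ := m + τ / 4) ?_ href ?_
    · intro c hc x hx hcx
      exact ⟨href c hc x hx hcx, (hsw c hc x hx hcx.le).trans (F.le_star hl (href c hc x hx hcx))⟩
    · intro x hx
      have h1 := abs_le.1 (hclose e' he' x hx.1)
      have h2 := hsup x hx.1
      linarith [h1.2]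
    · intro c hc x hx hcx
      obtain ⟨h1, h2, h3⟩ := ht c hc x hx.1 hcx
      obtain ⟨q, hq, hqm, hd⟩ := hs₂ x hx (by linarith)
      refine (F.mono_closure hl' hl hlt.le hx.1).trans ?_
      rw [heq]
      set t := 2 * (⟪e', x⟫ - c) with htdef
      have hmono : MonotoneOn (fun s : ℝ => u l (x + s • (-e'))) (Set.Icc 0 t) := by
        refine monotoneOn_of_deriv_nonneg (convex_Icc 0 t)
          (fun s _ => (hasDerivAt_line (F.smooth l hl) x (-e') s).continuousAt.continuousWithinAt)
          (fun s _ => (hasDerivAt_line (F.smooth l hl) x (-e') s).differentiableAt.differentiableWithinAt)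
          fun s hs => ?_
        rw [interior_Icc] at hs
        rw [(hasDerivAt_line (F.smooth l hl) x (-e') s).deriv]
        have h4 : dist (x + s • (-e')) x < ε := by
          rw [dist_eq_norm, add_sub_cancel_left, norm_smul, norm_neg, he'1, mul_one,
            Real.norm_of_nonneg hs.1.le]
          exact hs.2.trans_le h2
        refine hZu q ⟨hq, hqm⟩ _ (by linarith [dist_triangle (x + s • (-e')) x q]) ?_ _
          (by rwa [norm_neg]) (by linarith) l ⟨le_max_left _ _, hl.2⟩
        exact hTu q ⟨⟨hq.1, frontier_subset_closure hq.2⟩, hqm⟩ x (by linarith) hx.1 _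
          (by linarith) s ⟨hs.1, by linarith [hs.2]⟩
      have := hmono (Set.left_mem_Icc.2 h1.le) (Set.right_mem_Icc.2 h1.le) h1.le
      simpa using this
  obtain ⟨r₁, hr₁, hr₁W⟩ := Metric.isOpen_iff.1 hW p hpW
  set r := min r₁ (τ / 16) with hrdef
  have hr : 0 < r := by positivity
  set r₂ := min (τ / 16) (δ * τ / 32) with hr₂def
  have hr₂ : 0 < r₂ := by positivity
  have hr₂τ : r₂ ≤ τ / 16 := min_le_left _ _
  have hr₂δ : r₂ ≤ δ * τ / 32 := min_le_right _ _
  have hkey : ∀ l' ∈ Set.Ioo 0 ls, ∀ x ∈ Ω ∩ Metric.ball p r,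
      ∀ y ∈ Metric.ball (x - (τ / 4) • e) r₂, y ∈ Ω ∧ u l' x ≤ us y := by
    rintro l' hl' x ⟨hx, hxp⟩ y hy
    have hxc := subset_closure hx
    rw [Metric.mem_ball, dist_eq_norm] at hy hxp
    set s := ‖x - y‖ with hs
    have hsub : |s - τ / 4| < r₂ := by
      have h1 := abs_norm_sub_norm_le (x - y) ((τ / 4) • e)
      have h2 : x - y - (τ / 4) • e = -(y - (x - (τ / 4) • e)) := by abel
      rw [h2, norm_neg, norm_smul, he, mul_one, Real.norm_of_nonneg (by positivity)] at h1
      linarith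
    have hsl : τ / 8 ≤ s := by linarith [(abs_lt.1 hsub).1]
    have hs0 : 0 < s := by linarith
    set e' := s⁻¹ • (x - y) with he'def
    have he'1 : ‖e'‖ = 1 := by
      rw [he'def, norm_smul, norm_inv, norm_norm]; exact inv_mul_cancel₀ hs0.ne'
    have hse' : s • e' = x - y := by rw [he'def, smul_inv_smul₀ hs0.ne']
    have he'e : ‖e' - e‖ < δ := by
      have h1 : s * ‖e' - e‖ < 2 * r₂ := by
        calc s * ‖e' - e‖ = ‖s • (e' - e)‖ := by rw [norm_smul, Real.norm_of_nonneg hs0.le]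
          _ = ‖-(y - (x - (τ / 4) • e)) + (τ / 4 - s) • e‖ := by
            rw [smul_sub, hse']; congr 1; module
          _ ≤ ‖y - (x - (τ / 4) • e)‖ + |τ / 4 - s| := by
            refine (norm_add_le _ _).trans_eq ?_
            rw [norm_neg, norm_smul, he, mul_one, Real.norm_eq_abs]
          _ < 2 * r₂ := by rw [abs_sub_comm]; linarith
      have h2 : τ / 8 * ‖e' - e‖ ≤ s * ‖e' - e‖ :=
        mul_le_mul_of_nonneg_right hsl (norm_nonneg _)
      have h3 : τ * ‖e' - e‖ < τ * δ := by nlinarith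
      exact lt_of_mul_lt_mul_left h3 hτ.le
    have h1 := abs_le.1 (hclose e' he'e x hxc)
    have h2 : |⟪e, x⟫ - m| ≤ τ / 16 := by
      rw [hm, ← inner_sub_right]
      refine (abs_real_inner_le_norm _ _).trans ?_
      rw [he, one_mul]
      exact hxp.le.trans (min_le_right _ _)
    have h2' := abs_le.1 h2
    have h3 := hsup x hxc
    have h4 := abs_lt.1 hsub
    have h5 := hcomp e' he'1 he'e l' hl' (⟪e', x⟫ - s / 2)
      ⟨by linarith [h1.1, h2'.1, h4.2], by linarith [h1.2]⟩ x
      ⟨hxc, subset_closure (hr₁W (Metric.ball_subset_ball (min_le_left _ _)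
        (by rwa [Metric.mem_ball, dist_eq_norm])))⟩ (by linarith)
    have h6 : hrefl e' (⟪e', x⟫ - s / 2) x = y := by
      have : 2 * (⟪e', x⟫ - (⟪e', x⟫ - s / 2)) = s := by ring
      rw [hrefl, this, hse']; abel
    rwa [h6] at h5
  have husnn : ∀ x ∈ Ω, 0 ≤ us x := fun x hx =>
    (F.nonneg hl₀ (subset_closure hx)).trans (F.le_star hl₀ hx)
  set V : ℝ := (volume (Metric.ball (0 : Eu n) r₂)).toReal with hV
  have hV0 : 0 < V := ENNReal.toReal_pos (Metric.measure_ball_pos _ _ hr₂).ne'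
    measure_ball_lt_top.ne
  refine ⟨r, hr, (∫ x in Ω, us x) / V, fun l' hl' x hx => ?_⟩
  rw [le_div_iff₀ hV0]
  have hball : Metric.ball (x - (τ / 4) • e) r₂ ⊆ Ω := fun y hy => (hkey l' hl' x hx y hy).1
  calc u l' x * V = ∫ _y in Metric.ball (x - (τ / 4) • e) r₂, u l' x := by
        rw [setIntegral_const, Measure.real, hV, smul_eq_mul, mul_comm]
        congr 2
        rw [Measure.addHaar_ball_center volume (x - (τ / 4) • e)]
    _ ≤ ∫ y in Metric.ball (x - (τ / 4) • e) r₂, us y := by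
        refine setIntegral_mono_on (integrableOn_const measure_ball_lt_top.ne)
          (F.integrable.mono_set hball) measurableSet_ball fun y hy => (hkey l' hl' x hx y hy).2
    _ ≤ ∫ y in Ω, us y := by
        refine setIntegral_mono_set F.integrable ?_ hball.eventuallyLE
        exact (ae_restrict_iff' F.isOpen.measurableSet).2 (ae_of_all _ husnn)

end Sweep

/-- `ν` is an outward normal (possibly zero) of `Ω` at `q`. -/
def IsNormal {n : ℕ} (Ω : Set (Eu n)) (q ν : Eu n) : Prop := ∀ x ∈ Ω, ⟪ν, x⟫ ≤ ⟪ν, q⟫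

section ConvexCone

variable {n : ℕ} {Ω : Set (Eu n)} {q y z ν : Eu n}

theorem IsNormal.le_closure (h : IsNormal Ω q ν) {x : Eu n} (hx : x ∈ closure Ω) :
    ⟪ν, x⟫ ≤ ⟪ν, q⟫ := by
  have hc : IsClosed {x : Eu n | ⟪ν, x⟫ ≤ ⟪ν, q⟫} :=
    isClosed_le (continuous_const.inner continuous_id) continuous_const
  exact closure_minimal (fun y hy => h y hy) hc hx

theorem IsNormal.of_inner_eq (h : IsNormal Ω q ν) (hz : ⟪ν, z⟫ = ⟪ν, q⟫) : IsNormal Ω z ν :=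
  fun x hx => (h x hx).trans hz.ge

theorem isOpen_inCone (hΩ : IsOpen Ω) (q : Eu n) : IsOpen {y | InCone Ω q y} := by
  have : {y | InCone Ω q y} = ⋃ s : ℝ, ⋃ _ : 0 < s, (fun y : Eu n => q + s • y) ⁻¹' Ω := by
    ext y; simp [InCone]
  rw [this]
  exact isOpen_iUnion fun s => isOpen_iUnion fun _ => hΩ.preimage (by fun_prop)

theorem InCone.smul (h : InCone Ω q y) {c : ℝ} (hc : 0 < c) : InCone Ω q (c • y) := by
  obtain ⟨s, hs, h⟩ := h
  refine ⟨s / c, by positivity, ?_⟩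
  rwa [smul_smul, div_mul_cancel₀ _ hc.ne']

theorem inCone_sub (h : z ∈ Ω) : InCone Ω q (z - q) := ⟨1, one_pos, by simpa using h⟩

theorem convex_inCone (hΩ : IsOpen Ω) (hc : Convex ℝ Ω) (hq : q ∈ closure Ω) :
    Convex ℝ {y | InCone Ω q y} := by
  rintro y ⟨s, hs, hy⟩ z ⟨t, ht, hz⟩ a b ha hb hab
  have hm : 0 < min s t := lt_min hs ht
  refine ⟨min s t, hm, ?_⟩
  have := hc (hc.add_smul_mem_of_isOpen hΩ hq hm (min_le_left _ _) hy)
    (hc.add_smul_mem_of_isOpen hΩ hq hm (min_le_right _ _) hz) ha hb hab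
  convert this using 1
  have hb' : b = 1 - a := by linarith
  subst hb'
  module

theorem not_inCone_zero (hq : q ∉ Ω) : ¬ InCone Ω q 0 := by
  rintro ⟨s, -, h⟩
  simp at h; exact hq h

theorem IsNormal.inner_neg (hΩ : IsOpen Ω) (h : IsNormal Ω q ν) (hν : ν ≠ 0)
    (hy : InCone Ω q y) : ⟪ν, y⟫ < 0 := by
  have ho := isOpen_inCone hΩ q
  have hcont : ContinuousAt (fun ε : ℝ => y + ε • ν) 0 := by fun_prop
  have h1 : ∀ᶠ ε in 𝓝 (0 : ℝ), InCone Ω q (y + ε • ν) :=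
    hcont.eventually (ho.mem_nhds (by simpa using hy))
  obtain ⟨ε, hε, hεp⟩ := ((h1.filter_mono nhdsWithin_le_nhds).and
    (self_mem_nhdsWithin (s := Set.Ioi (0 : ℝ)))).exists
  obtain ⟨s, hs, hx⟩ := hε
  have h2 := h _ hx
  rw [inner_add_right, inner_smul_right, inner_add_right, inner_smul_right,
    real_inner_self_eq_norm_sq] at h2
  have hp : 0 < ε * ‖ν‖ ^ 2 := mul_pos hεp (by positivity)
  have h3 : s * (⟪ν, y⟫ + ε * ‖ν‖ ^ 2) ≤ 0 := by linarith
  have := nonpos_of_mul_nonpos_right h3 hs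
  linarith

theorem exists_isNormal_of_not_inCone (hΩ : IsOpen Ω) (hc : Convex ℝ Ω) (hq : q ∈ closure Ω)
    (hy : ¬ InCone Ω q y) : ∃ ν, ν ≠ 0 ∧ IsNormal Ω q ν ∧ 0 ≤ ⟪ν, y⟫ := by
  obtain ⟨f, hf⟩ := geometric_hahn_banach_open_point (convex_inCone hΩ hc hq)
    (isOpen_inCone hΩ q) hy
  have hfν : ∀ z, ⟪(InnerProductSpace.toDual ℝ (Eu n)).symm f, z⟫ = f z := fun z =>
    InnerProductSpace.toDual_symm_apply
  obtain ⟨x₀, hx₀⟩ : Ω.Nonempty := closure_nonempty_iff.1 ⟨q, hq⟩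
  have hneg : ∀ a, InCone Ω q a → f a ≤ 0 := by
    intro a ha
    by_contra! hpos
    have := hf _ (ha.smul (c := (|f y| + 1) / f a) (by positivity))
    rw [map_smul, smul_eq_mul, div_mul_cancel₀ _ hpos.ne'] at this
    linarith [le_abs_self (f y)]
  have hfy : 0 ≤ f y := by
    by_contra! hlt
    have ha := inCone_sub (q := q) hx₀
    have h0 := hneg _ ha
    have := hf _ (ha.smul (c := -f y / (1 + |f (x₀ - q)|)) (div_pos (by linarith) (by positivity)))
    rw [map_smul, smul_eq_mul, div_mul_eq_mul_div, div_lt_iff₀ (by positivity),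
      abs_of_nonpos h0] at this
    nlinarith
  refine ⟨(InnerProductSpace.toDual ℝ (Eu n)).symm f, ?_, ?_, ?_⟩
  · intro h0
    have h1 := hf _ (inCone_sub (q := q) hx₀)
    rw [← hfν, ← hfν, h0] at h1
    simp at h1
  · intro x hx
    have := hneg _ (inCone_sub (q := q) hx)
    rw [map_sub] at this
    rw [hfν, hfν]; linarith
  · rwa [hfν]

theorem exists_mem_frontier_segment {U : Set (Eu n)} {a b : Eu n} (ha : a ∈ U) (hb : b ∉ U) :
    ∃ t ∈ Set.Icc (0 : ℝ) 1, a + t • (b - a) ∈ frontier U := by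
  by_contra! h
  have hpre : IsPreconnected ((fun t : ℝ => a + t • (b - a)) '' Set.Icc 0 1) :=
    isPreconnected_Icc.image _ (by fun_prop)
  have hint : a ∈ interior U := by
    by_contra hi
    refine h 0 (by simp) ?_
    rw [zero_smul, add_zero]
    exact ⟨subset_closure ha, hi⟩
  have hcov : (fun t : ℝ => a + t • (b - a)) '' Set.Icc 0 1 ⊆ interior U ∪ (closure U)ᶜ := by
    rintro _ ⟨t, ht, rfl⟩
    by_cases hcl : a + t • (b - a) ∈ closure U
    · left
      by_contra hi
      exact h t ht ⟨hcl, hi⟩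
    · exact Or.inr hcl
  have hsub := IsPreconnected.subset_left_of_subset_union isOpen_interior
    isClosed_closure.isOpen_compl (Set.disjoint_compl_right_iff_subset.2 interior_subset_closure)
    hcov ⟨a, ⟨0, by simp, by simp⟩, hint⟩ hpre
  exact hb (interior_subset (hsub ⟨1, by simp, by simp⟩))

theorem exists_frontier_direction_near {x : Eu n} (hΩ : IsOpen Ω) (hc : Convex ℝ Ω)
    (hq : q ∈ closure Ω) (hx : x ∈ closure {y | InCone Ω q y}) (hx' : ¬ InCone Ω q x) {ε : ℝ}
    (hε : 0 < ε) : ∃ s X, 0 < s ∧ s < ε ∧ ‖X - x‖ < ε ∧ q + s • X ∈ frontier Ω := by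
  obtain ⟨x', ⟨s₀, hs₀, hx0⟩, hd⟩ := Metric.mem_closure_iff.1 hx ε hε
  set s := min s₀ (ε / 2) with hs
  have hsp : 0 < s := lt_min hs₀ (by linarith)
  have hin : q + s • x' ∈ Ω := hc.add_smul_mem_of_isOpen hΩ hq hsp (min_le_left _ _) hx0
  obtain ⟨t, ht, hfr⟩ := exists_mem_frontier_segment hin (b := q + s • x) fun h => hx' ⟨s, hsp, h⟩
  refine ⟨s, x' + t • (x - x'), hsp, (min_le_right _ _).trans_lt (by linarith), ?_, ?_⟩
  · have : x' + t • (x - x') - x = (1 - t) • (x' - x) := by module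
    rw [this, norm_smul, Real.norm_eq_abs, abs_of_nonneg (by linarith [ht.2])]
    rw [dist_eq_norm, norm_sub_rev] at hd
    nlinarith [norm_nonneg (x' - x), ht.1]
  · convert hfr using 1
    module

end ConvexCone

section SecondOrder

variable {n : ℕ} {g : Eu n → ℝ} {q x y w : Eu n}

theorem dd_dd_eq (hg : ContDiff ℝ ∞ g) (x y q : Eu n) :
    dd x (dd y g) q = fderiv ℝ (fderiv ℝ g) q x y := by
  have hd : DifferentiableAt ℝ (fderiv ℝ g) q :=
    (hg.fderiv_right (m := ∞) (by simp)).differentiable (by simp) q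
  have h1 : dd y g = fun z => fderiv ℝ g z y := rfl
  rw [dd, h1, fderiv_clm_apply hd (differentiableAt_const y)]
  simp

theorem dd_dd_add_smul (hg : ContDiff ℝ ∞ g) (t : ℝ) :
    dd (x + t • w) (dd (x + t • w) g) q
      = dd x (dd x g) q + 2 * t * dd x (dd w g) q + t ^ 2 * dd w (dd w g) q := by
  have hc := dd_comm hg w x q
  simp only [dd_dd_eq hg] at hc ⊢
  simp only [map_add, map_smul, add_apply, smul_apply, smul_eq_mul, hc]
  ring

theorem dd_dd_nonneg_of_ray (hg : ContDiff ℝ ∞ g) (h0 : g q = 0) (h1 : dd y g q = 0) {ε : ℝ}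
    (hε : 0 < ε) (h : ∀ s ∈ Set.Ioo 0 ε, 0 ≤ g (q + s • y)) : 0 ≤ dd y (dd y g) q := by
  have hd1 := hasDerivAt_line hg q y
  have hd2 := hasDerivAt_line (hg.dd y) q y
  have hcont : Continuous fun t : ℝ => dd y (dd y g) (q + t • y) :=
    ((hg.dd y).dd y).continuous.comp (by fun_prop)
  by_contra! hneg
  have hev : ∀ᶠ t in 𝓝 (0 : ℝ), dd y (dd y g) (q + t • y) < 0 :=
    hcont.continuousAt.eventually_lt continuousAt_const (by simpa using hneg)
  obtain ⟨δ, hδ, hball⟩ := Metric.eventually_nhds_iff.1 hev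
  set t := min (ε / 2) (δ / 2) with ht
  have htp : 0 < t := by positivity
  have htε : t < ε := (min_le_left _ _).trans_lt (by linarith)
  have htδ : t < δ := (min_le_right _ _).trans_lt (by linarith)
  obtain ⟨τ, hτ, he⟩ := exists_hasDerivAt_eq_slope _ _ htp
    (fun s _ => (hd1 s).continuousAt.continuousWithinAt) (fun s _ => hd1 s)
  obtain ⟨σ, hσ, he'⟩ := exists_hasDerivAt_eq_slope _ _ hτ.1
    (fun s _ => (hd2 s).continuousAt.continuousWithinAt) (fun s _ => hd2 s)
  simp only [zero_smul, add_zero, sub_zero, h0, h1] at he he'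
  have h2 : 0 ≤ dd y g (q + τ • y) := by
    rw [he]; exact div_nonneg (h t ⟨htp, htε⟩) htp.le
  have h3 : 0 ≤ dd y (dd y g) (q + σ • y) := by
    rw [he']; exact div_nonneg h2 hτ.1.le
  have h4 : dd y (dd y g) (q + σ • y) < 0 := hball (by
    rw [Real.dist_0_eq_abs, abs_of_pos hσ.1]; linarith [hσ.2, hτ.2])
  linarith

theorem dd_dd_nonneg_of_halfSpace {e : Eu n} (hg : ContDiff ℝ ∞ g) (he : e ≠ 0)
    (h : ∀ y, 0 < ⟪e, y⟫ → 0 ≤ dd y (dd y g) q) (y : Eu n) : 0 ≤ dd y (dd y g) q := by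
  have hneg : ∀ y, ⟪e, y⟫ < 0 → 0 ≤ dd y (dd y g) q := by
    intro y hy
    have := h (-y) (by rw [inner_neg_right]; linarith)
    simp only [dd_dd_eq hg, map_neg, neg_apply, neg_neg] at this ⊢
    exact this
  rcases lt_trichotomy ⟪e, y⟫ 0 with hy | hy | hy
  · exact hneg y hy
  · have key : ∀ t : ℝ, 0 < t → 0 ≤ dd y (dd y g) q + t ^ 2 * dd e (dd e g) q := by
      intro t ht
      have hp : 0 < t * ‖e‖ ^ 2 := by positivity
      have h1 := h (y + t • e) (by
        rw [inner_add_right, hy, inner_smul_right, real_inner_self_eq_norm_sq]; linarith)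
      have h2 := hneg (y + (-t) • e) (by
        rw [inner_add_right, hy, inner_smul_right, real_inner_self_eq_norm_sq]; linarith)
      rw [dd_dd_add_smul hg] at h1 h2
      nlinarith
    have hc : Continuous fun t : ℝ => dd y (dd y g) q + t ^ 2 * dd e (dd e g) q := by fun_prop
    have ht := (hc.tendsto 0).mono_left (nhdsWithin_le_nhds (s := Set.Ioi 0))
    simp only [ne_eq, OfNat.ofNat_ne_zero, not_false_eq_true, zero_pow, zero_mul, add_zero] at ht
    exact ge_of_tendsto ht (by filter_upwards [self_mem_nhdsWithin] with t ht using key t ht)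
  · exact h y hy

theorem lap_nonneg_of_dd_dd (hg : ContDiff ℝ ∞ g) (h : ∀ y, 0 ≤ dd y (dd y g) q) :
    0 ≤ lap g q := by
  rw [lap_eq hg]
  exact Finset.sum_nonneg fun i _ => h _

end SecondOrder

/-- A smooth function, positive in the open convex set `Ω`, vanishing on its boundary and with
negative Laplacian there. -/
structure BdryFun {n : ℕ} (Ω : Set (Eu n)) (v : Eu n → ℝ) : Prop where
  isOpen : IsOpen Ω
  convex : Convex ℝ Ω
  smooth : ContDiff ℝ ∞ v
  pos : ∀ x ∈ Ω, 0 < v x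
  bc : ∀ x ∈ frontier Ω, v x = 0
  lap_neg : ∀ x ∈ frontier Ω, lap v x < 0

namespace BdryFun

variable {n : ℕ} {Ω : Set (Eu n)} {v : Eu n → ℝ} {q x y e : Eu n}

theorem ray (B : BdryFun Ω v) (hq : q ∈ frontier Ω) (hy : InCone Ω q y) :
    ∃ ε > 0, ∀ s ∈ Set.Ioo (0 : ℝ) ε, 0 ≤ v (q + s • y) := by
  obtain ⟨s, hs, h⟩ := hy
  exact ⟨s, hs, fun t ht => (B.pos _ (B.convex.add_smul_mem_of_isOpen B.isOpen
    (frontier_subset_closure hq) ht.1 ht.2.le h)).le⟩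

theorem dd_nonneg (B : BdryFun Ω v) (hq : q ∈ frontier Ω) (hy : InCone Ω q y) :
    0 ≤ dd y v q := by
  obtain ⟨ε, hε, h⟩ := B.ray hq hy
  exact dd_nonneg_of_ray B.smooth (B.bc q hq) hε h

theorem dd_dd_nonneg (B : BdryFun Ω v) (hq : q ∈ frontier Ω) (hs : fderiv ℝ v q = 0)
    (hy : InCone Ω q y) : 0 ≤ dd y (dd y v) q := by
  obtain ⟨ε, hε, h⟩ := B.ray hq hy
  exact dd_dd_nonneg_of_ray B.smooth (B.bc q hq) (by simp [dd, hs]) hε h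

theorem not_mem (B : BdryFun Ω v) (hq : q ∈ frontier Ω) : q ∉ Ω := by
  have := hq.2
  rwa [B.isOpen.interior_eq] at this

theorem zero_of_near_zeros {G : Eu n → ℝ → ℝ} (hG : Continuous fun z : Eu n × ℝ => G z.1 z.2)
    (h : ∀ ε > 0, ∃ X t, ‖X - x‖ < ε ∧ 0 < t ∧ t < ε ∧ G X t = 0) : G x 0 = 0 := by
  have hc : IsClosed {z : Eu n × ℝ | G z.1 z.2 = 0} := isClosed_eq hG continuous_const
  have hm : (x, (0 : ℝ)) ∈ closure {z : Eu n × ℝ | G z.1 z.2 = 0} := by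
    rw [Metric.mem_closure_iff]
    intro ε hε
    obtain ⟨X, t, hX, ht, htε, h0⟩ := h ε hε
    refine ⟨(X, t), h0, ?_⟩
    rw [Prod.dist_eq, max_lt_iff, dist_eq_norm, norm_sub_rev, Real.dist_eq]
    exact ⟨hX, by simpa [abs_of_pos ht] using htε⟩
  exact hc.closure_subset hm

theorem dd_eq_zero (B : BdryFun Ω v) (hq : q ∈ frontier Ω)
    (hx : x ∈ closure {y | InCone Ω q y}) (hx' : ¬ InCone Ω q x) : dd x v q = 0 := by
  have hcont : Continuous fun z : Eu n × ℝ => dd z.1 v (q + z.2 • z.1) := by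
    have := B.smooth.continuous_fderiv (by simp)
    unfold dd
    fun_prop
  have := zero_of_near_zeros (x := x) (G := fun X t => dd X v (q + t • X)) hcont ?_
  · simpa using this
  intro ε hε
  obtain ⟨s, X, hs, hsε, hX, hfr⟩ := exists_frontier_direction_near B.isOpen B.convex
    (frontier_subset_closure hq) hx hx' hε
  have hd := hasDerivAt_line B.smooth q X
  obtain ⟨t, ht, h0⟩ := exists_hasDerivAt_eq_zero hs
    (fun s _ => (hd s).continuousAt.continuousWithinAt)
    (by simp [B.bc _ hq, B.bc _ hfr]) (fun s _ => hd s)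
  exact ⟨X, t, hX, ht.1, ht.2.trans hsε, h0⟩

theorem dd_dd_eq_zero (B : BdryFun Ω v) (hq : q ∈ frontier Ω) (hsing : fderiv ℝ v q = 0)
    (hx : x ∈ closure {y | InCone Ω q y}) (hx' : ¬ InCone Ω q x) : dd x (dd x v) q = 0 := by
  have hcont : Continuous fun z : Eu n × ℝ => dd z.1 (dd z.1 v) (q + z.2 • z.1) := by
    have := (B.smooth.fderiv_right (m := ∞) (by simp)).continuous_fderiv (by simp)
    simp only [dd_dd_eq B.smooth]
    fun_prop
  have := zero_of_near_zeros (x := x) (G := fun X t => dd X (dd X v) (q + t • X)) hcont ?_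
  · simpa using this
  intro ε hε
  obtain ⟨s, X, hs, hsε, hX, hfr⟩ := exists_frontier_direction_near B.isOpen B.convex
    (frontier_subset_closure hq) hx hx' hε
  have hd := hasDerivAt_line B.smooth q X
  have hd2 := hasDerivAt_line (B.smooth.dd X) q X
  obtain ⟨t, ht, h0⟩ := exists_hasDerivAt_eq_zero hs
    (fun s _ => (hd s).continuousAt.continuousWithinAt)
    (by simp [B.bc _ hq, B.bc _ hfr]) (fun s _ => hd s)
  obtain ⟨t', ht', h0'⟩ := exists_hasDerivAt_eq_zero ht.1
    (fun s _ => (hd2 s).continuousAt.continuousWithinAt)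
    (by simp only [h0, zero_smul, add_zero]; simp [dd, hsing]) (fun s _ => hd2 s)
  exact ⟨X, t', hX, ht'.1, ht'.2.trans (ht.2.trans hsε), h0'⟩

theorem isNormal_neg_gradient (B : BdryFun Ω v) (hq : q ∈ frontier Ω) :
    IsNormal Ω q (-gradient v q) := by
  intro x hx
  have := B.dd_nonneg hq (inCone_sub (q := q) hx)
  rw [← inner_gradient, inner_sub_right] at this
  rw [inner_neg_left, inner_neg_left]; linarith

theorem inner_pos (B : BdryFun Ω v) (hq : q ∈ frontier Ω) (hg : gradient v q ≠ 0)
    (hy : InCone Ω q y) : 0 < ⟪gradient v q, y⟫ := by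
  have := (B.isNormal_neg_gradient hq).inner_neg B.isOpen (neg_ne_zero.2 hg) hy
  rw [inner_neg_left] at this; linarith

theorem _root_.exists_inCone (hq : q ∈ frontier Ω) : ∃ y, InCone Ω q y := by
  obtain ⟨x₀, hx₀⟩ : Ω.Nonempty := closure_nonempty_iff.1 ⟨q, frontier_subset_closure hq⟩
  exact ⟨_, inCone_sub hx₀⟩

theorem inCone_of_inner_pos (B : BdryFun Ω v) (hq : q ∈ frontier Ω)
    (hy : 0 < ⟪gradient v q, y⟫) : InCone Ω q y := by
  by_contra hn
  have hg : gradient v q ≠ 0 := by rintro h; simp [h] at hy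
  obtain ⟨y₀, hy₀⟩ := exists_inCone hq
  obtain ⟨t, ht, hfr⟩ := exists_mem_frontier_segment (U := {y | InCone Ω q y}) hy₀ hn
  have h1 : ¬ InCone Ω q (y₀ + t • (y - y₀)) := by
    have := hfr.2
    rwa [(isOpen_inCone B.isOpen q).interior_eq] at this
  have h2 := B.dd_eq_zero hq hfr.1 h1
  have h0 := B.inner_pos hq hg hy₀
  rw [← inner_gradient, inner_add_right, inner_smul_right, inner_sub_right] at h2
  rcases ht.1.eq_or_lt with rfl | htp
  · rw [zero_mul, add_zero] at h2; linarith
  · nlinarith [ht.2, mul_pos htp hy]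

theorem inCone_neg_of_isNormal (B : BdryFun Ω v) (hq : q ∈ frontier Ω) (hg : gradient v q ≠ 0)
    (he : e ≠ 0) (hn : IsNormal Ω q e) : InCone Ω q (-e) := by
  apply B.inCone_of_inner_pos hq
  by_contra! hle
  rw [inner_neg_right] at hle
  have hgp : 0 < ‖gradient v q‖ ^ 2 := by positivity
  have hc : InCone Ω q (e + gradient v q) := by
    apply B.inCone_of_inner_pos hq
    rw [inner_add_right, real_inner_self_eq_norm_sq]
    linarith
  have h1 := hn.inner_neg B.isOpen he hc
  rw [inner_add_right, real_inner_self_eq_norm_sq, real_inner_comm] at h1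
  have hep : 0 < ‖e‖ ^ 2 := by positivity
  linarith

end BdryFun

section Normals

variable {n : ℕ} {Ω : Set (Eu n)} {q y z e ν μ : Eu n}

theorem IsNormal.add (h : IsNormal Ω q ν) (h' : IsNormal Ω q μ) : IsNormal Ω q (ν + μ) := by
  intro x hx
  rw [inner_add_left, inner_add_left]
  linarith [h x hx, h' x hx]

theorem IsNormal.smul (h : IsNormal Ω q ν) {c : ℝ} (hc : 0 ≤ c) : IsNormal Ω q (c • ν) := by
  intro x hx
  rw [real_inner_smul_left, real_inner_smul_left]
  exact mul_le_mul_of_nonneg_left (h x hx) hc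

theorem isNormal_zero : IsNormal Ω q 0 := fun x _ => by simp

theorem isNormal_sum {ι : Type*} (s : Finset ι) (w : ι → Eu n) (h : ∀ i ∈ s, IsNormal Ω q (w i)) :
    IsNormal Ω q (∑ i ∈ s, w i) := by
  intro x hx
  rw [sum_inner, sum_inner]
  exact Finset.sum_le_sum fun i hi => h i hi x hx

theorem IsNormal.not_mem (hΩ : IsOpen Ω) (h : IsNormal Ω q ν) (hν : ν ≠ 0) : q ∉ Ω := by
  intro hq
  have := h.inner_neg hΩ hν (y := 0) ⟨1, one_pos, by simpa using hq⟩
  simp at this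

theorem exists_isNormal_neg_inCone (hΩ : IsOpen Ω) (hc : Convex ℝ Ω) (hq : q ∈ closure Ω) :
    ∃ ν, IsNormal Ω q ν ∧ InCone Ω q (-ν) := by
  by_contra! hcon
  have hconvN : Convex ℝ {ν | IsNormal Ω q ν} := fun ν hν μ hμ a b ha hb _ =>
    IsNormal.add (IsNormal.smul hν ha) (IsNormal.smul hμ hb)
  have hconvC : Convex ℝ {y | InCone Ω q (-y)} := by
    have := (convex_inCone hΩ hc hq).neg
    exact this
  have hopen : IsOpen {y | InCone Ω q (-y)} := (isOpen_inCone hΩ q).preimage continuous_neg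
  have hdisj : Disjoint {y | InCone Ω q (-y)} {ν | IsNormal Ω q ν} :=
    Set.disjoint_left.2 fun ν h1 h2 => hcon ν h2 h1
  obtain ⟨f, u, hf1, hf2⟩ := geometric_hahn_banach_open hconvC hopen hconvN hdisj
  have hu : u ≤ 0 := by simpa using hf2 0 isNormal_zero
  set w := (InnerProductSpace.toDual ℝ (Eu n)).symm f with hw
  have hfw : ∀ z, f z = ⟪w, z⟫ := fun z => InnerProductSpace.toDual_symm_apply.symm
  have hneg : ∀ y, InCone Ω q y → 0 < ⟪w, y⟫ := by
    intro y hy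
    have := hf1 (-y) (by simpa using hy)
    rw [map_neg, hfw] at this
    linarith
  have hN : IsNormal Ω q (-w) := by
    intro x hx
    have := hneg _ (inCone_sub (q := q) hx)
    rw [inner_sub_right] at this
    rw [inner_neg_left, inner_neg_left]; linarith
  obtain ⟨x₀, hx₀⟩ : Ω.Nonempty := closure_nonempty_iff.1 ⟨q, hq⟩
  have hw0 : w ≠ 0 := by
    intro h0
    have := hneg _ (inCone_sub (q := q) hx₀)
    simp [h0] at this
  have hwp : 0 < ‖w‖ ^ 2 := by positivity
  have := hf2 (((|u| + 1) / ‖w‖ ^ 2) • -w) (hN.smul (by positivity))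
  rw [hfw, inner_smul_right, inner_neg_right, real_inner_self_eq_norm_sq, mul_neg,
    div_mul_cancel₀ _ hwp.ne'] at this
  linarith [neg_abs_le u]

theorem exists_isNormal_face (hΩ : IsOpen Ω) (hc : Convex ℝ Ω) (hq : q ∈ frontier Ω) :
    ∃ e, ‖e‖ = 1 ∧ IsNormal Ω q e ∧ InCone Ω q (-e) ∧
      ∀ z ∈ closure Ω, ⟪e, z⟫ = ⟪e, q⟫ → ∀ ν, IsNormal Ω q ν → IsNormal Ω z ν := by
  have hqc := frontier_subset_closure hq
  obtain ⟨e₁, he₁, hC₁⟩ := exists_isNormal_neg_inCone hΩ hc hqc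
  obtain ⟨b, hbN, hspan, hli⟩ := exists_linearIndependent ℝ {ν | IsNormal Ω q ν}
  have hfin : b.Finite := hli.setFinite
  set e₀ := ∑ ν ∈ hfin.toFinset, ν with he₀
  have hN₀ : IsNormal Ω q e₀ := isNormal_sum _ _ fun ν hν => hbN (by simpa using hν)
  have hcont : ContinuousAt (fun t : ℝ => -(e₁ + t • e₀)) 0 := by fun_prop
  have h1 : ∀ᶠ t in 𝓝 (0 : ℝ), InCone Ω q (-(e₁ + t • e₀)) :=
    hcont.eventually ((isOpen_inCone hΩ q).mem_nhds (by simpa using hC₁))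
  obtain ⟨t, ht, htp⟩ := ((h1.filter_mono nhdsWithin_le_nhds).and
    (self_mem_nhdsWithin (s := Set.Ioi (0 : ℝ)))).exists
  replace htp : 0 < t := htp
  set e' := e₁ + t • e₀ with he'
  have hqΩ : q ∉ Ω := by
    have := hq.2
    rwa [hΩ.interior_eq] at this
  have he'0 : e' ≠ 0 := by
    intro h0
    rw [h0, neg_zero] at ht
    exact not_inCone_zero hqΩ ht
  have hnp : 0 < ‖e'‖ := norm_pos_iff.2 he'0
  refine ⟨‖e'‖⁻¹ • e', by rw [norm_smul, norm_inv, norm_norm, inv_mul_cancel₀ hnp.ne'],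
    (he₁.add (hN₀.smul htp.le)).smul (by positivity), ?_, ?_⟩
  · rw [← smul_neg]
    exact ht.smul (by positivity)
  intro z hz hez ν hν
  rw [real_inner_smul_left, real_inner_smul_left] at hez
  replace hez := mul_left_cancel₀ (inv_ne_zero hnp.ne') hez
  have hle : ∀ μ, IsNormal Ω q μ → ⟪μ, z - q⟫ ≤ 0 := by
    intro μ hμ
    rw [inner_sub_right]
    linarith [hμ.le_closure hz]
  have hsum : ⟪e₁, z - q⟫ + t * ⟪e₀, z - q⟫ = 0 := by
    rw [← real_inner_smul_left, ← inner_add_left, ← he', inner_sub_right, hez, sub_self]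
  have h0 : ∑ ν ∈ hfin.toFinset, ⟪ν, z - q⟫ = 0 := by
    rw [← sum_inner]
    have h2 := hle _ he₁
    have h3 := hle _ hN₀
    nlinarith
  have hb : ∀ μ ∈ b, ⟪μ, z - q⟫ = 0 := by
    intro μ hμ
    exact (Finset.sum_eq_zero_iff_of_nonpos fun ν hν => hle ν (hbN (by simpa using hν))).1 h0 μ
      (by simpa using hμ)
  have hν' : ν ∈ Submodule.span ℝ b := by
    rw [hspan]; exact Submodule.subset_span hν
  have hνz : ⟪ν, z - q⟫ = 0 := by
    refine Submodule.span_induction (p := fun μ _ => ⟪μ, z - q⟫ = 0) hb (by simp) ?_ ?_ hν'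
    · intro x y _ _ hx hy; rw [inner_add_left, hx, hy, add_zero]
    · intro a x _ hx; rw [real_inner_smul_left, hx, mul_zero]
  refine hν.of_inner_eq ?_
  rw [inner_sub_right] at hνz; linarith

end Normals

namespace BdryFun

variable {n : ℕ} {Ω : Set (Eu n)} {v : Eu n → ℝ} {q x y z e : Eu n}

theorem inCone_subset_of_normals (B : BdryFun Ω v) (hq : q ∈ frontier Ω)
    (hN : ∀ ν, IsNormal Ω q ν → IsNormal Ω z ν) (hy : InCone Ω z y) : InCone Ω q y := by
  by_contra hn
  obtain ⟨ν, hν0, hν, h⟩ :=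
    exists_isNormal_of_not_inCone B.isOpen B.convex (frontier_subset_closure hq) hn
  linarith [(hN ν hν).inner_neg B.isOpen hν0 hy]

theorem fderiv_eq_zero_of_normals (B : BdryFun Ω v) (hq : q ∈ frontier Ω)
    (hs : fderiv ℝ v q = 0) (hz : z ∈ frontier Ω)
    (hN : ∀ ν, IsNormal Ω q ν → IsNormal Ω z ν) : fderiv ℝ v z = 0 := by
  by_contra hne
  have hg : gradient v z ≠ 0 := by
    rw [← norm_ne_zero_iff, norm_gradient, norm_ne_zero_iff]; exact hne
  have h1 : ∀ y, 0 < ⟪gradient v z, y⟫ → 0 ≤ dd y (dd y v) q := fun y hy =>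
    B.dd_dd_nonneg hq hs (B.inCone_subset_of_normals hq hN (B.inCone_of_inner_pos hz hy))
  have := lap_nonneg_of_dd_dd B.smooth (dd_dd_nonneg_of_halfSpace B.smooth hg h1)
  linarith [B.lap_neg q hq]

theorem inCone_neg_of_face (B : BdryFun Ω v) (hq : q ∈ frontier Ω) (hs : fderiv ℝ v q = 0)
    (he : e ≠ 0) (hn : IsNormal Ω q e) (hC : InCone Ω q (-e)) (hz : z ∈ closure Ω)
    (hN : ∀ ν, IsNormal Ω q ν → IsNormal Ω z ν) : InCone Ω z (-e) := by
  have hzf : z ∈ frontier Ω := ⟨hz, by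
    rw [B.isOpen.interior_eq]; exact (hN e hn).not_mem B.isOpen he⟩
  have hqc := frontier_subset_closure hq
  have hNz : ∀ ν, IsNormal Ω q ν → ⟪ν, z⟫ = ⟪ν, q⟫ := fun ν hν =>
    le_antisymm (hν.le_closure hz) ((hN ν hν).le_closure hqc)
  have hsz := B.fderiv_eq_zero_of_normals hq hs hzf hN
  -- the Hessian at `z` is nonnegative on the cone at `q`
  have hQ : ∀ y, InCone Ω q y → 0 ≤ dd y (dd y v) z := by
    intro y hy
    have hcont : Continuous fun t : ℝ => dd y (dd y v) (q + t • (z - q)) :=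
      ((B.smooth.dd y).dd y).continuous.comp (by fun_prop)
    have ht := (hcont.tendsto 1).mono_left (nhdsWithin_le_nhds (s := Set.Iio 1))
    rw [one_smul, add_sub_cancel] at ht
    refine ge_of_tendsto ht ?_
    filter_upwards [Ioo_mem_nhdsLT (zero_lt_one' ℝ)] with t ht
    have hNt : ∀ ν, IsNormal Ω q ν → IsNormal Ω (q + t • (z - q)) ν := fun ν hν =>
      hν.of_inner_eq (by
        rw [inner_add_right, inner_smul_right, inner_sub_right, hNz ν hν]; ring)
    have hcl : q + t • (z - q) ∈ closure Ω := by
      have := B.convex.closure hqc hz (a := 1 - t) (b := t) (by linarith [ht.2]) ht.1.le (by ring)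
      convert this using 1
      module
    have hfr : q + t • (z - q) ∈ frontier Ω := ⟨hcl, by
      rw [B.isOpen.interior_eq]; exact (hNt e hn).not_mem B.isOpen he⟩
    refine B.dd_dd_nonneg hfr (B.fderiv_eq_zero_of_normals hq hs hfr hNt) ?_
    obtain ⟨s, hsp, hsy⟩ := hy
    refine ⟨(1 - t) * s, mul_pos (by linarith [ht.2]) hsp, ?_⟩
    have := B.convex.combo_interior_closure_mem_interior (a := 1 - t) (b := t)
      (by rwa [B.isOpen.interior_eq]) hz (by linarith [ht.2]) ht.1.le (by ring)
    rw [B.isOpen.interior_eq] at this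
    convert this using 1
    module
  by_contra hcon
  obtain ⟨y₀, hy₀⟩ := exists_inCone hzf
  obtain ⟨t, ht, hfr⟩ := exists_mem_frontier_segment (U := {y | InCone Ω z y}) hy₀ hcon
  set x := y₀ + t • (-e - y₀) with hx
  have hxz : ¬ InCone Ω z x := by
    have := hfr.2
    rwa [(isOpen_inCone B.isOpen z).interior_eq] at this
  have hxq : InCone Ω q x := by
    have := convex_inCone B.isOpen B.convex hqc (B.inCone_subset_of_normals hq hN hy₀) hC
      (a := 1 - t) (b := t) (by linarith [ht.2]) ht.1 (by ring)
    have h2 : (1 - t) • y₀ + t • (-e) = x := by rw [hx]; module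
    rwa [h2] at this
  have h0 := B.dd_dd_eq_zero hzf hsz hfr.1 hxz
  have hall : ∀ w, 0 ≤ dd w (dd w v) z := by
    intro w
    have ho := (isOpen_inCone B.isOpen q).mem_nhds hxq
    have hc1 : ContinuousAt (fun t : ℝ => x + t • w) 0 := by fun_prop
    have hc2 : ContinuousAt (fun t : ℝ => x + (-t) • w) 0 := by fun_prop
    have h1 : ∀ᶠ t in 𝓝 (0 : ℝ), InCone Ω q (x + t • w) := hc1.eventually (by
      simp only [zero_smul, add_zero]; exact ho)
    have h2 : ∀ᶠ t in 𝓝 (0 : ℝ), InCone Ω q (x + (-t) • w) := hc2.eventually (by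
      simp only [neg_zero, zero_smul, add_zero]; exact ho)
    obtain ⟨r, ⟨hr1, hr2⟩, hr⟩ := (((h1.and h2).filter_mono nhdsWithin_le_nhds).and
      (self_mem_nhdsWithin (s := Set.Ioi (0 : ℝ)))).exists
    replace hr : 0 < r := hr
    have h3 := hQ _ hr1
    have h4 := hQ _ hr2
    rw [dd_dd_add_smul B.smooth, h0] at h3 h4
    have h5 : 0 ≤ r ^ 2 * dd w (dd w v) z := by nlinarith
    exact nonneg_of_mul_nonneg_right h5 (by positivity)
  linarith [lap_nonneg_of_dd_dd B.smooth hall, B.lap_neg z hzf]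

end BdryFun

section GoodPoints

variable {n : ℕ} {Ω : Set (Eu n)} {f : ℝ → ℝ} {ls : ℝ} {u : ℝ → Eu n → ℝ} {us : Eu n → ℝ}

theorem SolFamily.bdryFun (F : SolFamily n Ω f ls u us) {l : ℝ} (hl : l ∈ Set.Ioo 0 ls) :
    BdryFun Ω (u l) :=
  ⟨F.isOpen, F.convex, F.smooth l hl, F.pos l hl, F.bc l hl, fun _ hx => F.lap_frontier_neg hl hx⟩

theorem isOpen_goodPt (Ω : Set (Eu n)) (ls : ℝ) (u : ℝ → Eu n → ℝ) :
    IsOpen {p | GoodPt Ω ls u p} := by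
  rw [Metric.isOpen_iff]
  rintro p ⟨r, hr, M, h⟩
  refine ⟨r / 2, by positivity, fun q hq => ⟨r / 2, by positivity, M, fun l hl x hx => ?_⟩⟩
  refine h l hl x ⟨hx.1, Metric.mem_ball.2 ?_⟩
  have h1 := Metric.mem_ball.1 hx.2
  have h2 := Metric.mem_ball.1 hq
  linarith [dist_triangle x q p]

theorem SolFamily.goodPt_of_singular (F : SolFamily n Ω f ls u us) {l₀ : ℝ}
    (hl₀ : l₀ ∈ Set.Ioo 0 ls) {q : Eu n} (hq : q ∈ frontier Ω) (hs : fderiv ℝ (u l₀) q = 0) :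
    GoodPt Ω ls u q := by
  have B := F.bdryFun hl₀
  obtain ⟨e, he, hn, hC, hface⟩ := exists_isNormal_face F.isOpen F.convex hq
  have he0 : e ≠ 0 := by rintro rfl; simp at he
  refine F.goodPt_of_support hl₀ he (fun x hx => hn.le_closure hx) isOpen_univ (Set.mem_univ q)
    ?_ (by simp)
  intro z hz hez
  exact B.inCone_neg_of_face hq hs he0 hn hC hz.1 (hface z hz.1 hez)

theorem SolFamily.goodPt_frontier (F : SolFamily n Ω f ls u us) {p : Eu n}
    (hp : p ∈ frontier Ω) : GoodPt Ω ls u p := by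
  have hl₀ : ls / 2 ∈ Set.Ioo 0 ls := ⟨by linarith [F.ls_pos], by linarith [F.ls_pos]⟩
  have B := F.bdryFun hl₀
  set v := u (ls / 2) with hv
  have hgrad : ∀ q, ¬ fderiv ℝ v q = 0 → gradient v q ≠ 0 := fun q h => by
    rw [← norm_ne_zero_iff, norm_gradient, norm_ne_zero_iff]; exact h
  by_contra hbad
  have hreg : ∀ q ∈ frontier Ω, ¬ GoodPt Ω ls u q → ¬ fderiv ℝ v q = 0 := fun q hq hb hs =>
    hb (F.goodPt_of_singular hl₀ hq hs)
  have hgp := hgrad p (hreg p hp hbad)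
  have hgn : 0 < ‖gradient v p‖ := norm_pos_iff.2 hgp
  set e := ‖gradient v p‖⁻¹ • -gradient v p with he
  have he1 : ‖e‖ = 1 := by rw [he, norm_smul, norm_inv, norm_norm, norm_neg, inv_mul_cancel₀ hgn.ne']
  have he0 : e ≠ 0 := by intro h; rw [h] at he1; simp at he1
  have hn : IsNormal Ω p e := (B.isNormal_neg_gradient hp).smul (by positivity)
  have hface : ∀ z ∈ closure Ω, ⟪e, z⟫ = ⟪e, p⟫ → IsNormal Ω z e ∧ z ∈ frontier Ω := by
    intro z hz hez
    have h1 := hn.of_inner_eq hez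
    exact ⟨h1, hz, by rw [F.isOpen.interior_eq]; exact h1.not_mem F.isOpen he0⟩
  set K := (closure Ω ∩ {z | ⟪e, z⟫ = ⟪e, p⟫}) ∩ {z | GoodPt Ω ls u z}ᶜ with hK
  have hKc : IsCompact K := by
    have hc : IsClosed {z : Eu n | ⟪e, z⟫ = ⟪e, p⟫} :=
      isClosed_eq (continuous_const.inner continuous_id) continuous_const
    exact (F.bdd.isCompact_closure.inter_right hc).inter_right
      (isOpen_goodPt Ω ls u).isClosed_compl
  have hUo : IsOpen {z | ¬ fderiv ℝ v z = 0} := by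
    have h1 : IsClosed {z | fderiv ℝ v z = 0} :=
      isClosed_eq (B.smooth.continuous_fderiv (by simp)) continuous_const
    exact h1.isOpen_compl
  have hKU : K ⊆ {z | ¬ fderiv ℝ v z = 0} := fun z hz =>
    hreg z (hface z hz.1.1 hz.1.2).2 hz.2
  obtain ⟨ε, hε, hthick⟩ := hKc.exists_cthickening_subset_open hUo hKU
  have hpK : p ∈ K := ⟨⟨frontier_subset_closure hp, rfl⟩, hbad⟩
  have hKW : K ⊆ Metric.thickening ε K := Metric.self_subset_thickening hε K
  have hclW : closure (Metric.thickening ε K) ⊆ {z | ¬ fderiv ℝ v z = 0} :=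
    (Metric.closure_thickening_subset_cthickening ε K).trans hthick
  have hcone : ∀ z ∈ closure Ω ∩ closure (Metric.thickening ε K), ⟪e, z⟫ = ⟪e, p⟫ →
      InCone Ω z (-e) := by
    intro z hz hez
    obtain ⟨h1, h2⟩ := hface z hz.1 hez
    exact B.inCone_neg_of_isNormal h2 (hgrad z (hclW hz.2)) he0 h1
  refine hbad (F.goodPt_of_support hl₀ he1 (fun x hx => hn.le_closure hx) Metric.isOpen_thickening
    (hKW hpK) hcone ?_)
  intro z hz hez
  obtain ⟨h1, h2⟩ := hface z hz.1 hez
  have hc := hcone z ⟨hz.1, frontier_subset_closure hz.2⟩ hez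
  have hgood : GoodPt Ω ls u z := by
    by_contra hb
    have := hz.2.2
    rw [Metric.isOpen_thickening.interior_eq] at this
    exact this (hKW ⟨⟨hz.1, hez⟩, hb⟩)
  refine F.monoNear hl₀ h2 hgood ?_ hc
  rw [← inner_gradient]
  exact B.inner_pos h2 (hgrad z (hclW (frontier_subset_closure hz.2))) hc

theorem SolFamily.nonempty_frontier (F : SolFamily n Ω f ls u us) (hne : Ω.Nonempty) :
    (frontier Ω).Nonempty := by
  obtain ⟨x, hx⟩ := hne
  have hb : ∃ b, b ∉ Ω := by
    by_contra! h
    have : NeZero n := ⟨F.dim_pos.ne'⟩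
    exact NormedSpace.unbounded_univ ℝ (Eu n) (by rw [← Set.eq_univ_of_forall h]; exact F.bdd)
  obtain ⟨b, hb⟩ := hb
  obtain ⟨t, -, ht⟩ := exists_mem_frontier_segment hx hb
  exact ⟨_, ht⟩

theorem SolFamily.bounded_near_frontier (F : SolFamily n Ω f ls u us) :
    ∃ δ > 0, ∃ M, ∀ l ∈ Set.Ioo 0 ls, ∀ x ∈ Ω, Metric.infDist x (frontier Ω) < δ → u l x ≤ M := by
  have hK : IsCompact (frontier Ω) :=
    F.bdd.isCompact_closure.of_isClosed_subset isClosed_frontier frontier_subset_closure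
  obtain ⟨ε, hε, h⟩ := exists_uniform_of_isCompact hK
    (R := fun ε x => x ∈ Ω → ∀ l ∈ Set.Ioo 0 ls, u l x * ε ≤ 1)
    (fun a b x hab hx hxΩ l hl =>
      (mul_le_mul_of_nonneg_left hab (F.pos l hl x hxΩ).le).trans (hx hxΩ l hl))
    (fun q hq => by
      obtain ⟨r, hr, M, hM⟩ := F.goodPt_frontier hq
      refine ⟨min r (1 + |M|)⁻¹, by positivity, fun x hx hxΩ l hl => ?_⟩
      have h1 := hM l hl x ⟨hxΩ, Metric.mem_ball.2 (hx.trans_le (min_le_left _ _))⟩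
      have h2 := F.pos l hl x hxΩ
      calc u l x * min r (1 + |M|)⁻¹ ≤ (1 + |M|) * (1 + |M|)⁻¹ := by
            gcongr
            · linarith [le_abs_self M]
            · exact min_le_right _ _
        _ = 1 := mul_inv_cancel₀ (by positivity))
  refine ⟨ε, hε, 1 / ε, fun l hl x hx hd => ?_⟩
  obtain ⟨q, hq, hxq⟩ := (Metric.infDist_lt_iff (F.nonempty_frontier ⟨x, hx⟩)).1 hd
  rw [le_div_iff₀ hε]
  exact h q hq x hxq hx l hl

end GoodPoints

section LinearAlgebra

variable {n : ℕ} {H : Fin n → Fin n → ℝ} {ν g : Fin n → ℝ}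

theorem sum_sq_sum_mul_le (Y : Fin n → Fin n → ℝ) (hν : ∑ i, ν i ^ 2 ≤ 1) :
    ∑ j, (∑ i, ν i * Y i j) ^ 2 ≤ ∑ j, ∑ i, Y i j ^ 2 := by
  refine Finset.sum_le_sum fun j _ => ?_
  have h1 := Finset.sum_mul_sq_le_sq_mul_sq Finset.univ ν fun i => Y i j
  have h2 : 0 ≤ ∑ i, Y i j ^ 2 := Finset.sum_nonneg fun i _ => sq_nonneg _
  nlinarith

theorem trace_sub_sq_le (hν : ∑ i, ν i ^ 2 ≤ 1) (hg : ∀ j, g j = ∑ i, ν i * H i j) :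
    (∑ i, H i i - ∑ i, ν i * g i) ^ 2 ≤ n * (∑ j, ∑ i, H i j ^ 2 - ∑ j, g j ^ 2) := by
  set τ := ∑ i, H i i - ∑ i, ν i * g i with hτ
  have key : ∀ t : ℝ, 0 ≤ t ^ 2 * n - 2 * t * τ + (∑ j, ∑ i, H i j ^ 2 - ∑ j, g j ^ 2) := by
    intro t
    have h := sum_sq_sum_mul_le (fun i j => t * (if i = j then 1 else 0) - H i j) hν
    have h1 : ∀ j, ∑ i, ν i * (t * (if i = j then 1 else 0) - H i j) = t * ν j - g j := by
      intro j
      simp only [mul_sub, Finset.sum_sub_distrib, hg, mul_ite, mul_one, mul_zero,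
        Finset.sum_ite_eq', Finset.mem_univ, if_true]
      ring
    have h2 : ∀ j, ∑ i, (t * (if i = j then 1 else 0) - H i j) ^ 2
        = t ^ 2 - 2 * t * H j j + ∑ i, H i j ^ 2 := by
      intro j
      have : ∀ i, (t * (if i = j then 1 else 0) - H i j) ^ 2
          = (if i = j then t ^ 2 - 2 * t * H i j else 0) + H i j ^ 2 := by
        intro i; split_ifs <;> ring
      simp only [this, Finset.sum_add_distrib, Finset.sum_ite_eq', Finset.mem_univ, if_true]
    have h3 : ∀ j, (t * ν j - g j) ^ 2 = t ^ 2 * ν j ^ 2 - 2 * t * (ν j * g j) + g j ^ 2 :=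
      fun j => by ring
    simp only [h1, h2, h3, Finset.sum_add_distrib, Finset.sum_sub_distrib, ← Finset.mul_sum,
      Finset.sum_const, Finset.card_univ, Fintype.card_fin, nsmul_eq_mul] at h
    have h4 : 0 ≤ ∑ i, ν i ^ 2 := Finset.sum_nonneg fun i _ => sq_nonneg _
    have h5 : 0 ≤ t ^ 2 * ∑ i, ν i ^ 2 := by positivity
    rw [hτ]; linarith
  rcases Nat.eq_zero_or_pos n with rfl | hn
  · simp [hτ]
  have hn' : (0 : ℝ) < n := by exact_mod_cast hn
  have h := key (τ / n)
  have h2 : (τ / n) ^ 2 * n - 2 * (τ / n) * τ = -(τ ^ 2 / n) := by field_simp; ring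
  rw [h2] at h
  have h3 : τ ^ 2 / n ≤ ∑ j, ∑ i, H i j ^ 2 - ∑ j, g j ^ 2 := by linarith
  rwa [div_le_iff₀ hn', mul_comm] at h3

theorem sum_sq_le_add_sq (hs : ∀ i j, H i j = H j i) (hν : ∑ i, ν i ^ 2 ≤ 1)
    (hg : ∀ j, g j = ∑ i, ν i * H i j) :
    ∑ j, g j ^ 2 ≤ (∑ j, ∑ i, H i j ^ 2 - ∑ j, g j ^ 2) + (∑ i, ν i * g i) ^ 2 := by
  set b := ∑ i, ν i * g i with hb
  have h := sum_sq_sum_mul_le (fun i j => H i j - ν j * g i) hν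
  have h1 : ∀ j, ∑ i, ν i * (H i j - ν j * g i) = g j - ν j * b := by
    intro j
    simp only [mul_sub, Finset.sum_sub_distrib, ← hg, hb, Finset.mul_sum]
    congr 1
    exact Finset.sum_congr rfl fun i _ => by ring
  have h2 : ∀ i j, (H i j - ν j * g i) ^ 2
      = H i j ^ 2 - 2 * (g i * (ν j * H j i)) + ν j ^ 2 * g i ^ 2 := by
    intro i j; rw [hs i j]; ring
  have h3 : ∑ j, ∑ i, g i * (ν j * H j i) = ∑ j, g j ^ 2 := by
    rw [Finset.sum_comm]
    exact Finset.sum_congr rfl fun i _ => by rw [← Finset.mul_sum, ← hg]; ring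
  have h4 : ∀ j, (g j - ν j * b) ^ 2 = g j ^ 2 - 2 * b * (ν j * g j) + b ^ 2 * ν j ^ 2 :=
    fun j => by ring
  simp only [h1, h2, h4, Finset.sum_add_distrib, Finset.sum_sub_distrib, ← Finset.mul_sum,
    h3, ← Finset.sum_mul, ← hb] at h
  have hcs : b ^ 2 ≤ (∑ i, ν i ^ 2) * ∑ i, g i ^ 2 := Finset.sum_mul_sq_le_sq_mul_sq _ _ _
  have h5 : 0 ≤ ∑ i, g i ^ 2 := Finset.sum_nonneg fun i _ => sq_nonneg _
  have h6 : 0 ≤ ∑ i, ν i ^ 2 := Finset.sum_nonneg fun i _ => sq_nonneg _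
  have h7 : b ^ 2 ≤ ∑ i, g i ^ 2 := hcs.trans (mul_le_of_le_one_left h5 hν)
  have h8 := mul_nonneg (sub_nonneg.2 hν) (sub_nonneg.2 h7)
  linarith

theorem sqrt_sum_sq_le (hs : ∀ i j, H i j = H j i) (hν : ∑ i, ν i ^ 2 ≤ 1)
    (hg : ∀ j, g j = ∑ i, ν i * H i j) {h : ℝ} (hh : 0 ≤ h) (htr : ∑ i, H i i = -h) :
    √(∑ j, g j ^ 2) ≤ h + (1 + √n) * √(∑ j, ∑ i, H i j ^ 2 - ∑ j, g j ^ 2) := by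
  set A2 := ∑ j, ∑ i, H i j ^ 2 - ∑ j, g j ^ 2 with hA2
  have hA : 0 ≤ A2 := by
    have := sum_sq_sum_mul_le H hν
    simp only [← hg] at this
    linarith
  have h1 := trace_sub_sq_le hν hg
  have h2 := sum_sq_le_add_sq hs hν hg
  rw [← hA2] at h1 h2
  set b := ∑ i, ν i * g i with hb
  have h3 : |∑ i, H i i - b| ≤ √n * √A2 := by
    rw [← Real.sqrt_mul (by positivity)]
    exact Real.abs_le_sqrt h1
  rw [htr] at h3
  have h4 : |b| ≤ h + √n * √A2 := by
    rw [abs_le] at h3 ⊢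
    constructor <;> linarith [h3.1, h3.2]
  calc √(∑ j, g j ^ 2) ≤ √(A2 + b ^ 2) := Real.sqrt_le_sqrt h2
    _ ≤ √A2 + |b| := by
      refine Real.sqrt_le_iff.2 ⟨by positivity, ?_⟩
      have := mul_nonneg (Real.sqrt_nonneg A2) (abs_nonneg b)
      rw [add_sq, Real.sq_sqrt hA, sq_abs]
      linarith
    _ ≤ _ := by linarith

end LinearAlgebra

section IntegrationByParts

variable {n : ℕ} {φ ψ g : Eu n → ℝ}

theorem HasCompactSupport.dd (hφ : HasCompactSupport φ) (v : Eu n) :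
    HasCompactSupport (dd v φ) := hφ.fderiv_apply (𝕜 := ℝ) v

theorem integral_dd_eq_zero (hs : ContDiff ℝ ∞ φ) (hφ : HasCompactSupport φ) (v : Eu n) :
    ∫ x, dd v φ x = 0 := by
  have h := integral_mul_fderiv_eq_neg_fderiv_mul_of_integrable (μ := (volume : Measure (Eu n)))
    (f := fun _ => (1 : ℝ)) (g := φ) (v := v)
    (by simp) (by
      simp only [one_mul]
      exact (hs.dd v).continuous.integrable_of_hasCompactSupport (hφ.dd v))
    (by simpa using hs.continuous.integrable_of_hasCompactSupport hφ)
    (fun _ _ => differentiableAt_const _) (fun x _ => hs.diffAt x)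
  simpa [dd] using h

/-- Green's formula for a compactly supported test function. -/
theorem integral_sum_dd_mul_dd (hψ : ContDiff ℝ ∞ ψ) (hc : HasCompactSupport ψ)
    (hg : ContDiff ℝ ∞ g) :
    ∫ x, ∑ i, dd (bv i) ψ x * dd (bv i) g x = - ∫ x, ψ x * lap g x := by
  have hI : ∀ i : Fin n, ∫ x, dd (bv i) (fun y => ψ y * dd (bv i) g y) x = 0 := fun i =>
    integral_dd_eq_zero (hψ.mul (hg.dd _)) (hc.mul_right) _
  have hint : ∀ i : Fin n, Integrable (fun x => dd (bv i) (fun y => ψ y * dd (bv i) g y) x) :=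
    fun i => ((hψ.mul (hg.dd _)).dd _).continuous.integrable_of_hasCompactSupport
      ((hc.mul_right).dd _)
  have h0 : ∫ x, ∑ i : Fin n, dd (bv i) (fun y => ψ y * dd (bv i) g y) x = 0 := by
    rw [integral_finsetSum _ fun i _ => hint i]
    exact Finset.sum_eq_zero fun i _ => hI i
  have hcont : Continuous fun x => ∑ i, dd (bv i) ψ x * dd (bv i) g x :=
    continuous_finsetSum _ fun i _ => (hψ.dd _).continuous.mul (hg.dd _).continuous
  have i1 : Integrable fun x => ∑ i, dd (bv i) ψ x * dd (bv i) g x :=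
    integrable_finsetSum _ fun i _ => ((hψ.dd _).continuous.mul
      (hg.dd _).continuous).integrable_of_hasCompactSupport ((hc.dd _).mul_right)
  have i2 : Integrable fun x => ψ x * lap g x :=
    (hψ.continuous.mul hg.lap.continuous).integrable_of_hasCompactSupport hc.mul_right
  have heq : (fun x => ∑ i : Fin n, dd (bv i) (fun y => ψ y * dd (bv i) g y) x)
      = fun x => (∑ i, dd (bv i) ψ x * dd (bv i) g x) + ψ x * lap g x := by
    ext x
    simp only [dd_mul hψ (hg.dd _), lap_eq hg, Finset.sum_add_distrib, Finset.mul_sum]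
  rw [heq, integral_add i1 i2] at h0
  linarith

end IntegrationByParts

/-- The squared regularised length `1 + |∇u|²`. -/
noncomputable def gw {n : ℕ} (u : Eu n → ℝ) (x : Eu n) : ℝ := 1 + ∑ i, dd (bv i) u x ^ 2

/-- The regularised length `√(1 + |∇u|²)` of the gradient. -/
noncomputable def cw {n : ℕ} (u : Eu n → ℝ) (x : Eu n) : ℝ := √(gw u x)

/-- The quantity `|D²u|² - |∇√(1 + |∇u|²)|²`. -/
noncomputable def A2w {n : ℕ} (u : Eu n → ℝ) (x : Eu n) : ℝ :=
  ∑ j, ∑ i, dd (bv i) (dd (bv j) u) x ^ 2 - ∑ j, dd (bv j) (cw u) x ^ 2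

section GradientWeight

variable {n : ℕ} {u : Eu n → ℝ} {x v : Eu n}

theorem one_le_gw (u : Eu n → ℝ) (x : Eu n) : 1 ≤ gw u x :=
  le_add_of_nonneg_right (Finset.sum_nonneg fun _ _ => sq_nonneg _)

theorem one_le_cw (u : Eu n → ℝ) (x : Eu n) : 1 ≤ cw u x := by
  rw [cw, Real.one_le_sqrt]; exact one_le_gw u x

theorem cw_pos (u : Eu n → ℝ) (x : Eu n) : 0 < cw u x := zero_lt_one.trans_le (one_le_cw u x)

theorem cw_sq (u : Eu n → ℝ) (x : Eu n) : cw u x ^ 2 = 1 + ∑ i, dd (bv i) u x ^ 2 :=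
  Real.sq_sqrt (zero_le_one.trans (one_le_gw u x))

theorem norm_gradient_le_cw : ‖gradient u x‖ ≤ cw u x := by
  refine Real.le_sqrt_of_sq_le ?_
  rw [norm_gradient_sq, gw]; linarith

theorem cw_le : cw u x ≤ 1 + ‖gradient u x‖ := by
  refine Real.sqrt_le_iff.2 ⟨by positivity, ?_⟩
  rw [gw, ← norm_gradient_sq]; nlinarith [norm_nonneg (gradient u x)]

theorem contDiff_gw (hu : ContDiff ℝ ∞ u) : ContDiff ℝ ∞ (gw u) :=
  contDiff_const.add (ContDiff.sum fun _ _ => (hu.dd _).pow 2)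

theorem contDiff_cw (hu : ContDiff ℝ ∞ u) : ContDiff ℝ ∞ (cw u) :=
  (contDiff_gw hu).sqrt fun x => (zero_lt_one.trans_le (one_le_gw u x)).ne'

theorem dd_sq {g : Eu n → ℝ} (hg : ContDiff ℝ ∞ g) :
    dd v (fun x => g x ^ 2) = fun x => 2 * (g x * dd v g x) := by
  simp_rw [pow_two]
  rw [dd_mul hg hg]
  ext x; ring

theorem dd_gw (hu : ContDiff ℝ ∞ u) :
    dd v (gw u) = fun x => 2 * ∑ i, dd (bv i) u x * dd v (dd (bv i) u) x := by
  unfold gw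
  rw [dd_add contDiff_const (ContDiff.sum fun i _ => (hu.dd _).pow 2), dd_const,
    dd_sum _ _ fun i _ => (hu.dd _).pow 2]
  ext x
  simp only [dd_sq (hu.dd _), zero_add, ← Finset.mul_sum]

theorem cw_mul_dd_cw (hu : ContDiff ℝ ∞ u) (v x : Eu n) :
    2 * (cw u x * dd v (cw u) x) = dd v (gw u) x := by
  have h : gw u = fun x => cw u x ^ 2 := by ext x; rw [cw_sq, gw]
  rw [h, dd_sq (contDiff_cw hu)]

theorem dd_cw (hu : ContDiff ℝ ∞ u) (j : Fin n) (x : Eu n) :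
    dd (bv j) (cw u) x = ∑ i, dd (bv i) u x / cw u x * dd (bv i) (dd (bv j) u) x := by
  have h := cw_mul_dd_cw hu (bv j) x
  rw [dd_gw hu] at h
  have hc := (cw_pos u x).ne'
  simp_rw [div_mul_eq_mul_div, ← Finset.sum_div]
  rw [eq_div_iff hc, mul_comm, mul_left_cancel₀ two_ne_zero h]
  exact Finset.sum_congr rfl fun i _ => by rw [dd_comm hu]

theorem sum_div_cw_sq_le (u : Eu n → ℝ) (x : Eu n) : ∑ i, (dd (bv i) u x / cw u x) ^ 2 ≤ 1 := by
  have h := cw_sq u x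
  have hc := cw_pos u x
  simp_rw [div_pow, ← Finset.sum_div]
  rw [div_le_one (by positivity)]; linarith

theorem lap_sq {g : Eu n → ℝ} (hg : ContDiff ℝ ∞ g) :
    lap (fun x => g x ^ 2) x = 2 * (g x * lap g x + ∑ i, dd (bv i) g x ^ 2) := by
  simp_rw [pow_two]
  rw [lap_mul hg hg]; ring

theorem lap_sum {ι : Type*} (s : Finset ι) (f : ι → Eu n → ℝ) (hf : ∀ i ∈ s, ContDiff ℝ ∞ (f i)) :
    lap (fun x => ∑ i ∈ s, f i x) x = ∑ i ∈ s, lap (f i) x := by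
  rw [lap_eq (ContDiff.sum hf), Finset.sum_congr rfl fun i hi => lap_eq (hf i hi),
    Finset.sum_comm]
  refine Finset.sum_congr rfl fun i _ => ?_
  rw [dd_sum _ _ hf, dd_sum _ _ fun i hi => (hf i hi).dd _]

/-- Bochner's identity. -/
theorem lap_gw (hu : ContDiff ℝ ∞ u) : lap (gw u) x
    = 2 * (∑ j, ∑ i, dd (bv i) (dd (bv j) u) x ^ 2 + ∑ i, dd (bv i) u x * dd (bv i) (lap u) x) := by
  unfold gw
  rw [lap_add contDiff_const (ContDiff.sum fun i _ => (hu.dd _).pow 2), lap_const,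
    lap_sum _ _ fun i _ => (hu.dd _).pow 2]
  simp only [lap_sq (hu.dd _), lap_dd hu, ← Finset.mul_sum, Finset.sum_add_distrib]
  ring

theorem continuous_A2w (hu : ContDiff ℝ ∞ u) : Continuous (A2w u) :=
  (continuous_finsetSum _ fun _ _ => continuous_finsetSum _ fun _ _ =>
    ((hu.dd _).dd _).continuous.pow 2).sub
  (continuous_finsetSum _ fun _ _ => ((contDiff_cw hu).dd _).continuous.pow 2)

theorem A2w_nonneg (hu : ContDiff ℝ ∞ u) (x : Eu n) : 0 ≤ A2w u x := by
  have := sum_sq_sum_mul_le (fun i j => dd (bv i) (dd (bv j) u) x) (sum_div_cw_sq_le u x)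
  simp only [← dd_cw hu] at this
  exact sub_nonneg.2 this

theorem norm_gradient_cw_le (hu : ContDiff ℝ ∞ u) (hx : lap u x ≤ 0) :
    ‖gradient (cw u) x‖ ≤ -lap u x + (1 + √n) * √(A2w u x) := by
  have h := sqrt_sum_sq_le (H := fun i j => dd (bv i) (dd (bv j) u) x)
    (fun i j => dd_comm hu _ _ _) (sum_div_cw_sq_le u x) (fun j => dd_cw hu j x)
    (h := -lap u x) (by linarith) (by rw [neg_neg, lap_eq hu])
  rwa [← norm_gradient_sq, Real.sqrt_sq (norm_nonneg _), norm_gradient_sq] at h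

theorem abs_lap_sub_le (hu : ContDiff ℝ ∞ u) (x : Eu n) :
    |lap u x - ∑ i, dd (bv i) u x / cw u x * dd (bv i) (cw u) x| ≤ √n * √(A2w u x) := by
  have h := trace_sub_sq_le (H := fun i j => dd (bv i) (dd (bv j) u) x)
    (sum_div_cw_sq_le u x) (fun j => dd_cw hu j x)
  rw [lap_eq hu, ← Real.sqrt_mul (by positivity)]
  exact Real.abs_le_sqrt h

theorem integral_norm_gradient_cw_mul_sq (hu : ContDiff ℝ ∞ u) {η : Eu n → ℝ}
    (hη : ContDiff ℝ ∞ η) (hc : HasCompactSupport η) :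
    ∫ x, ‖gradient (fun y => cw u y * η y) x‖ ^ 2
      = ∫ x, (cw u x ^ 2 * ‖gradient η x‖ ^ 2 - A2w u x * η x ^ 2
          - (∑ i, dd (bv i) u x * dd (bv i) (lap u) x) * η x ^ 2) := by
  have hη2 : HasCompactSupport fun x => η x ^ 2 := by
    simp_rw [pow_two]; exact hc.mul_right
  have hG := integral_sum_dd_mul_dd (hη.pow 2) hη2 (contDiff_gw hu)
  have hC := contDiff_cw hu
  set φ : Eu n → ℝ := fun x => cw u x ^ 2 * (∑ i, dd (bv i) η x ^ 2)
    + (∑ i, dd (bv i) (cw u) x ^ 2) * η x ^ 2 with hφ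
  have iφ : Integrable φ := by
    refine Integrable.add ?_ ?_
    · refine Continuous.integrable_of_hasCompactSupport ((hC.continuous.pow 2).mul
        (continuous_finsetSum _ fun _ _ => (hη.dd _).continuous.pow 2)) ?_
      refine hc.mono' fun x hx => ?_
      by_contra h
      refine hx ?_
      have : ∀ i : Fin n, dd (bv i) η x = 0 := fun i => by
        by_contra h'
        exact h (tsupport_fderiv_apply_subset ℝ (bv i) (subset_tsupport _ h'))
      simp [this]
    · exact Continuous.integrable_of_hasCompactSupport ((continuous_finsetSum _ fun _ _ =>
        (hC.dd _).continuous.pow 2).mul (hη.continuous.pow 2)) hη2.mul_left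
  have iG : Integrable fun x => ∑ i, dd (bv i) (fun y => η y ^ 2) x * dd (bv i) (gw u) x :=
    integrable_finsetSum _ fun i _ => (((hη.pow 2).dd _).continuous.mul
      ((contDiff_gw hu).dd _).continuous).integrable_of_hasCompactSupport ((hη2.dd _).mul_right)
  have iL : Integrable fun x => η x ^ 2 * lap (gw u) x :=
    ((hη.pow 2).continuous.mul (contDiff_gw hu).lap.continuous).integrable_of_hasCompactSupport
      hη2.mul_right
  have e1 : ∀ x, ‖gradient (fun y => cw u y * η y) x‖ ^ 2
      = φ x + (1 / 2) * ∑ i, dd (bv i) (fun y => η y ^ 2) x * dd (bv i) (gw u) x := by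
    intro x
    simp only [norm_gradient_sq, dd_mul hC hη, hφ, dd_sq hη, ← cw_mul_dd_cw hu, Finset.mul_sum,
      Finset.sum_mul, ← Finset.sum_add_distrib]
    exact Finset.sum_congr rfl fun i _ => by ring
  have e2 : ∀ x, cw u x ^ 2 * ‖gradient η x‖ ^ 2 - A2w u x * η x ^ 2
      - (∑ i, dd (bv i) u x * dd (bv i) (lap u) x) * η x ^ 2
      = φ x - (1 / 2) * (η x ^ 2 * lap (gw u) x) := by
    intro x
    rw [norm_gradient_sq, lap_gw hu, A2w]
    simp only [hφ]; ring
  simp_rw [e1, e2]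
  rw [integral_add iφ (iG.const_mul _), integral_sub iφ (iL.const_mul _), integral_const_mul,
    integral_const_mul, hG]
  ring

end GradientWeight

section InteriorEnergy

variable {n : ℕ} {u η : Eu n → ℝ}

theorem ContDiff.continuous_gradient {g : Eu n → ℝ} (hg : ContDiff ℝ ∞ g) :
    Continuous (gradient g) :=
  (InnerProductSpace.toDual ℝ (Eu n)).symm.continuous.comp (hg.continuous_fderiv (by simp))

theorem HasCompactSupport.norm_gradient {g : Eu n → ℝ} (hg : HasCompactSupport g) :
    HasCompactSupport fun x => ‖gradient g x‖ := by
  simp_rw [_root_.norm_gradient]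
  exact (hg.fderiv ℝ).norm

theorem HasCompactSupport.sq {g : Eu n → ℝ} (hg : HasCompactSupport g) :
    HasCompactSupport fun x => g x ^ 2 := by
  simp_rw [pow_two]; exact hg.mul_right

theorem gradient_eq_zero_of_notMem_tsupport {g : Eu n → ℝ} {x : Eu n} (hx : x ∉ tsupport g) :
    gradient g x = 0 := by
  rw [← norm_eq_zero, norm_gradient, norm_eq_zero]
  exact fderiv_of_notMem_tsupport ℝ hx

theorem SemiStable.integral_A2w_le {Ω : Set (Eu n)} (ho : IsOpen Ω) {g : ℝ → ℝ}
    (hg : Continuous (deriv g)) (hs : SemiStable Ω g u) (hu : ContDiff ℝ ∞ u)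
    (hη : ContDiff ℝ ∞ η) (hc : HasCompactSupport η) (hηΩ : tsupport η ⊆ Ω)
    (hlin : ∀ x ∈ Ω, ∀ i, dd (bv i) (lap u) x = -(deriv g (u x) * dd (bv i) u x))
    (hpos : ∀ x ∈ Ω, 0 ≤ deriv g (u x)) :
    ∫ x, A2w u x * η x ^ 2 ≤ ∫ x, cw u x ^ 2 * ‖gradient η x‖ ^ 2 := by
  have hC := contDiff_cw hu
  have hzero : ∀ x, x ∉ Ω → η x = 0 := fun x hx => image_eq_zero_of_notMem_tsupport fun h =>
    hx (hηΩ h)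
  have h0 := hs (fun y => cw u y * η y) ((hC.mul hη).of_le (by exact_mod_cast le_top))
    fun x hx => by
      rw [ho.frontier_eq] at hx
      rw [hzero x hx.2, mul_zero]
  have hsub : tsupport (fun y => cw u y * η y) ⊆ tsupport η := by
    refine closure_mono fun x hx => ?_
    exact right_ne_zero_of_mul (a := cw u x) hx
  rw [setIntegral_eq_integral_of_forall_compl_eq_zero fun x hx => by
    rw [gradient_eq_zero_of_notMem_tsupport fun h => hx (hηΩ (hsub h)), hzero x hx]
    simp] at h0
  have i1 : Integrable fun x => ‖gradient (fun y => cw u y * η y) x‖ ^ 2 :=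
    Continuous.integrable_of_hasCompactSupport ((hC.mul hη).continuous_gradient.norm.pow 2)
      hc.mul_left.norm_gradient.sq
  have i2 : Integrable fun x => deriv g (u x) * (cw u x * η x) ^ 2 :=
    Continuous.integrable_of_hasCompactSupport ((hg.comp hu.continuous).mul
      ((hC.continuous.mul hη.continuous).pow 2)) (HasCompactSupport.sq hc.mul_left).mul_left
  have i3 : Integrable fun x => A2w u x * η x ^ 2 :=
    Continuous.integrable_of_hasCompactSupport ((continuous_A2w hu).mul (hη.continuous.pow 2))
      hc.sq.mul_left
  have i4 : Integrable fun x => cw u x ^ 2 * ‖gradient η x‖ ^ 2 :=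
    Continuous.integrable_of_hasCompactSupport
      ((hC.continuous.pow 2).mul (hη.continuous_gradient.norm.pow 2)) hc.norm_gradient.sq.mul_left
  have i5 : Integrable fun x => (∑ i, dd (bv i) u x * dd (bv i) (lap u) x) * η x ^ 2 :=
    Continuous.integrable_of_hasCompactSupport ((continuous_finsetSum _ fun i _ =>
      (hu.dd _).continuous.mul (hu.lap.dd _).continuous).mul (hη.continuous.pow 2)) hc.sq.mul_left
  have i6 : Integrable fun x => cw u x ^ 2 * ‖gradient η x‖ ^ 2 - A2w u x * η x ^ 2 := i4.sub i3
  rw [integral_sub i1 i2, integral_norm_gradient_cw_mul_sq hu hη hc,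
    integral_sub i6 i5, integral_sub i4 i3] at h0
  have h1 : 0 ≤ ∫ x, ((∑ i, dd (bv i) u x * dd (bv i) (lap u) x) * η x ^ 2
      + deriv g (u x) * (cw u x * η x) ^ 2) := by
    refine integral_nonneg fun x => ?_
    by_cases hx : x ∈ Ω
    · simp only [hlin x hx, mul_pow, cw_sq, Pi.zero_apply]
      have : ∑ i, dd (bv i) u x * -(deriv g (u x) * dd (bv i) u x)
          = -(deriv g (u x) * ∑ i, dd (bv i) u x ^ 2) := by
        rw [Finset.mul_sum, ← Finset.sum_neg_distrib]
        exact Finset.sum_congr rfl fun i _ => by ring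
      rw [this]
      nlinarith [mul_nonneg (hpos x hx) (sq_nonneg (η x))]
    · simp [hzero x hx]
  rw [integral_add i5 i2] at h1
  linarith

theorem contDiff_cw_rpow (hu : ContDiff ℝ ∞ u) (a : ℝ) : ContDiff ℝ ∞ fun x => cw u x ^ a :=
  (contDiff_cw hu).rpow_const_of_ne fun x => (cw_pos u x).ne'

theorem dd_cw_rpow (hu : ContDiff ℝ ∞ u) (a : ℝ) (v x : Eu n) :
    dd v (fun y => cw u y ^ a) x = a * cw u x ^ (a - 1) * dd v (cw u) x := by
  have h := ((contDiff_cw hu).diffAt x).hasFDerivAt.rpow_const (p := a) (.inl (cw_pos u x).ne')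
  simp [dd, h.fderiv]

theorem norm_gradient_mul_le {g h : Eu n → ℝ} (hg : ContDiff ℝ ∞ g) (hh : ContDiff ℝ ∞ h)
    (x : Eu n) : ‖gradient (fun y => g y * h y) x‖
      ≤ |g x| * ‖gradient h x‖ + |h x| * ‖gradient g x‖ := by
  simp only [norm_gradient]
  rw [fderiv_fun_mul (hg.diffAt x) (hh.diffAt x)]
  exact (norm_add_le _ _).trans (by simp [norm_smul])

theorem norm_gradient_cw_rpow (hu : ContDiff ℝ ∞ u) {a : ℝ} (ha : 0 ≤ a) (x : Eu n) :
    ‖gradient (fun y => cw u y ^ a) x‖ = a * cw u x ^ (a - 1) * ‖gradient (cw u) x‖ := by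
  have h := ((contDiff_cw hu).diffAt x).hasFDerivAt.rpow_const (p := a) (.inl (cw_pos u x).ne')
  rw [norm_gradient, h.fderiv, norm_smul, norm_gradient, Real.norm_of_nonneg]
  have := cw_pos u x
  positivity

theorem abs_sum_dd_mul_dd_le {g h : Eu n → ℝ} (x : Eu n) :
    |∑ i, dd (bv i) g x * dd (bv i) h x| ≤ ‖gradient g x‖ * ‖gradient h x‖ := by
  refine Real.abs_le_sqrt (Finset.sum_mul_sq_le_sq_mul_sq _ _ _) |>.trans ?_
  rw [← norm_gradient_sq, ← norm_gradient_sq, Real.sqrt_mul (sq_nonneg _),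
    Real.sqrt_sq (norm_nonneg _), Real.sqrt_sq (norm_nonneg _)]

theorem integral_norm_gradient_mul_cw_rpow_le (hu : ContDiff ℝ ∞ u)
    (hη : ContDiff ℝ ∞ η) (hc : HasCompactSupport η) (hη0 : ∀ x, 0 ≤ η x)
    (hlap : ∀ x, η x ≠ 0 → lap u x ≤ 0) {q : ℝ} (hq : 0 ≤ q) :
    ∫ x, ‖gradient (fun y => η y * cw u y ^ (q + 1)) x‖
      ≤ 2 * (∫ x, cw u x ^ (q + 1) * ‖gradient η x‖)
        + (q * √n + (q + 1) * (1 + √n)) * ∫ x, η x * cw u x ^ q * √(A2w u x) := by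
  have hW := fun a => contDiff_cw_rpow hu a
  have i1 : Integrable fun x => cw u x ^ (q + 1) * ‖gradient η x‖ :=
    Continuous.integrable_of_hasCompactSupport
      ((hW _).continuous.mul hη.continuous_gradient.norm) hc.norm_gradient.mul_left
  have i2 : Integrable fun x => η x * cw u x ^ q * -lap u x :=
    Continuous.integrable_of_hasCompactSupport
      ((hη.continuous.mul (hW _).continuous).mul hu.lap.neg.continuous)
      (HasCompactSupport.mul_right hc.mul_right)
  have i3 : Integrable fun x => η x * cw u x ^ q * √(A2w u x) :=
    Continuous.integrable_of_hasCompactSupport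
      ((hη.continuous.mul (hW _).continuous).mul (continuous_A2w hu).sqrt)
      (HasCompactSupport.mul_right hc.mul_right)
  have i4 : Integrable fun x => ‖gradient (fun y => η y * cw u y ^ (q + 1)) x‖ :=
    Continuous.integrable_of_hasCompactSupport (hη.mul (hW _)).continuous_gradient.norm
      (HasCompactSupport.norm_gradient hc.mul_right)
  have hψ : ContDiff ℝ ∞ fun y => η y * cw u y ^ q := hη.mul (hW q)
  have i5 : Integrable fun x => ∑ i, dd (bv i) (fun y => η y * cw u y ^ q) x * dd (bv i) u x :=
    Continuous.integrable_of_hasCompactSupport (continuous_finsetSum _ fun i _ =>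
      (hψ.dd _).continuous.mul (hu.dd _).continuous) (by
        have hcW : HasCompactSupport fun y => η y * cw u y ^ q := hc.mul_right
        refine hcW.mono' fun x hx => ?_
        by_contra h
        refine hx (Finset.sum_eq_zero fun i _ => ?_)
        rw [dd, fderiv_of_notMem_tsupport ℝ h]
        simp)
  have hIBP := integral_sum_dd_mul_dd hψ (HasCompactSupport.mul_right hc) hu
  have hle : ∫ x, ∑ i, dd (bv i) (fun y => η y * cw u y ^ q) x * dd (bv i) u x
      ≤ ∫ x, (cw u x ^ (q + 1) * ‖gradient η x‖ - q * (η x * cw u x ^ q * -lap u x)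
        + q * √n * (η x * cw u x ^ q * √(A2w u x))) := by
    refine integral_mono i5 ((i1.sub (i2.const_mul q)).add (i3.const_mul _)) fun x => ?_
    have hcx := cw_pos u x
    have e1 : ∑ i, dd (bv i) (fun y => η y * cw u y ^ q) x * dd (bv i) u x
        = cw u x ^ q * (∑ i, dd (bv i) η x * dd (bv i) u x)
          + q * (η x * cw u x ^ q) * ∑ i, dd (bv i) u x / cw u x * dd (bv i) (cw u) x := by
      simp only [dd_mul hη (hW q), dd_cw_rpow hu, Finset.mul_sum, ← Finset.sum_add_distrib,
        Real.rpow_sub_one hcx.ne']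
      refine Finset.sum_congr rfl fun i _ => ?_
      field_simp
    have e2 : cw u x ^ q * (∑ i, dd (bv i) η x * dd (bv i) u x)
        ≤ cw u x ^ (q + 1) * ‖gradient η x‖ := by
      rw [Real.rpow_add_one hcx.ne', mul_assoc]
      refine mul_le_mul_of_nonneg_left ?_ (by positivity)
      refine (le_abs_self _).trans ((abs_sum_dd_mul_dd_le x).trans ?_)
      rw [mul_comm]
      exact mul_le_mul_of_nonneg_right norm_gradient_le_cw (norm_nonneg _)
    have e3 : 0 ≤ q * (η x * cw u x ^ q) := by have := hη0 x; positivity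
    have e4 := mul_le_mul_of_nonneg_left (abs_le.1 (abs_lap_sub_le hu x)).1 e3
    simp only [e1]
    linarith
  have hle2 : ∫ x, ‖gradient (fun y => η y * cw u y ^ (q + 1)) x‖
      ≤ ∫ x, (cw u x ^ (q + 1) * ‖gradient η x‖ + (q + 1) * (η x * cw u x ^ q * -lap u x)
        + (q + 1) * (1 + √n) * (η x * cw u x ^ q * √(A2w u x))) := by
    refine integral_mono i4 ((i1.add (i2.const_mul _)).add (i3.const_mul _)) fun x => ?_
    have hcx := cw_pos u x
    refine (norm_gradient_mul_le hη (hW _) x).trans ?_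
    rw [norm_gradient_cw_rpow hu (by positivity), abs_of_nonneg (hη0 x),
      abs_of_pos (Real.rpow_pos_of_pos hcx _), add_sub_cancel_right]
    by_cases h0 : η x = 0
    · simp [h0]
    have e3 : 0 ≤ (q + 1) * (η x * cw u x ^ q) := by have := hη0 x; positivity
    have e4 := mul_le_mul_of_nonneg_left (norm_gradient_cw_le hu (hlap x h0)) e3
    linarith
  have i6 : Integrable fun x => cw u x ^ (q + 1) * ‖gradient η x‖
      - q * (η x * cw u x ^ q * -lap u x) := i1.sub (i2.const_mul q)
  have i7 : Integrable fun x => cw u x ^ (q + 1) * ‖gradient η x‖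
      + (q + 1) * (η x * cw u x ^ q * -lap u x) := i1.add (i2.const_mul _)
  rw [integral_add i6 (i3.const_mul _), integral_sub i1 (i2.const_mul q),
    integral_const_mul, integral_const_mul, hIBP] at hle
  rw [integral_add i7 (i3.const_mul _), integral_add i1 (i2.const_mul _),
    integral_const_mul, integral_const_mul] at hle2
  simp only [mul_neg, integral_neg] at hle hle2
  linarith

end InteriorEnergy

section Sobolev

variable {n : ℕ}

/-- The Gagliardo-Nirenberg-Sobolev inequality for smooth compactly supported functions. -/
theorem exists_sobolev (hn : 0 < n) {p p' : ℝ} (hp : 1 ≤ p) (hp' : 0 < p')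
    (h : p'⁻¹ = p⁻¹ - (n : ℝ)⁻¹) :
    ∃ S : ℝ, 0 ≤ S ∧ ∀ g : Eu n → ℝ, ContDiff ℝ ∞ g → HasCompactSupport g →
      (∫ x, |g x| ^ p') ^ p'⁻¹ ≤ S * (∫ x, ‖gradient g x‖ ^ p) ^ p⁻¹ := by
  have hp0 : 0 < p := by linarith
  lift p to NNReal using hp0.le
  lift p' to NNReal using hp'.le
  have hp0' : p ≠ 0 := by rintro rfl; simp at hp0
  have hp0'' : p' ≠ 0 := by rintro rfl; simp at hp'
  refine ⟨SNormLESNormFDerivOfEqConst ℝ (volume : Measure (Eu n)) p, NNReal.coe_nonneg _,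
    fun g hg hc => ?_⟩
  have h1 := eLpNorm_le_eLpNorm_fderiv_of_eq (volume : Measure (Eu n)) (u := g)
    (hg.of_le (by exact_mod_cast le_top)) hc (p := p) (p' := p') (by exact_mod_cast hp)
    (by simpa using hn) (by simpa using h)
  have m1 : MemLp g p' volume := hg.continuous.memLp_of_hasCompactSupport hc
  have m2 : MemLp (fderiv ℝ g) p volume :=
    (hg.continuous_fderiv (by simp)).memLp_of_hasCompactSupport (hc.fderiv ℝ)
  rw [m1.eLpNorm_eq_integral_rpow_norm (by simpa using hp0'') (by simp),
    m2.eLpNorm_eq_integral_rpow_norm (by simpa using hp0') (by simp)] at h1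
  have e2 : ∀ I : ℝ, ((SNormLESNormFDerivOfEqConst ℝ (volume : Measure (Eu n)) p : NNReal) : ENNReal)
      * ENNReal.ofReal I = ENNReal.ofReal
        (SNormLESNormFDerivOfEqConst ℝ (volume : Measure (Eu n)) p * I) := fun I => by
    rw [ENNReal.ofReal_mul (NNReal.coe_nonneg _), ENNReal.ofReal_coe_nnreal]
  rw [e2, ENNReal.ofReal_le_ofReal_iff (by positivity)] at h1
  simpa [norm_gradient] using h1

end Sobolev

section UniformEnergy

variable {n : ℕ} {η : Eu n → ℝ}

theorem integrable_indicator_tsupport (hc : HasCompactSupport η) (B : ℝ) :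
    Integrable ((tsupport η).indicator fun _ => B) :=
  (integrableOn_const hc.isCompact.measure_lt_top.ne).integrable_indicator
    (isClosed_tsupport η).measurableSet

theorem integral_indicator_tsupport (B : ℝ) :
    ∫ x, (tsupport η).indicator (fun _ => B) x = B * volume.real (tsupport η) := by
  rw [integral_indicator (isClosed_tsupport η).measurableSet, setIntegral_const, smul_eq_mul,
    mul_comm]

theorem integral_rpow_le_of_bound {F : Eu n → ℝ} (hc : HasCompactSupport η) {B : ℝ}
    (hF : Integrable F) (hB : ∀ x, F x ≤ (tsupport η).indicator (fun _ => B) x) :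
    ∫ x, F x ≤ B * volume.real (tsupport η) := by
  rw [← integral_indicator_tsupport]
  exact integral_mono hF (integrable_indicator_tsupport hc B) hB

theorem le_rpow_of_rpow_le_mul_sqrt {a X K : ℝ} (ha : 1 / 2 < a) (hX : 0 ≤ X) (hK : 0 ≤ K)
    (h : X ^ a ≤ K * √(X + 1)) : X ≤ 1 + (2 * K) ^ (a - 1 / 2)⁻¹ := by
  rcases le_total X 1 with h1 | h1
  · exact h1.trans (le_add_of_nonneg_right (by positivity))
  have hX0 : 0 < X := by linarith
  have h2 : √(X + 1) ≤ 2 * X ^ (1 / 2 : ℝ) := by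
    rw [← Real.sqrt_eq_rpow]
    refine Real.sqrt_le_iff.2 ⟨by positivity, ?_⟩
    rw [mul_pow, Real.sq_sqrt hX]; linarith
  have h3 : X ^ (a - 1 / 2) ≤ 2 * K := by
    rw [Real.rpow_sub hX0, div_le_iff₀ (by positivity)]
    calc X ^ a ≤ K * √(X + 1) := h
      _ ≤ K * (2 * X ^ (1 / 2 : ℝ)) := by gcongr
      _ = _ := by ring
  have h4 : X ≤ (2 * K) ^ (a - 1 / 2)⁻¹ := by
    have := Real.rpow_le_rpow (by positivity) h3 (inv_nonneg.2 (sub_nonneg.2 ha.le))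
    rwa [← Real.rpow_mul hX, mul_inv_cancel₀ (by linarith), Real.rpow_one] at this
  linarith

theorem mul_sqrt_le_add (a w : ℝ) {A t : ℝ} (hA : 0 ≤ A) (ht : 0 < t) :
    a * w * √A ≤ t * (A * a ^ 2) + t⁻¹ * w ^ 2 := by
  have h1 : (t * (√A * a) - w) ^ 2 = t ^ 2 * (A * a ^ 2) - 2 * t * (a * w * √A) + w ^ 2 := by
    rw [sub_sq, mul_pow, mul_pow, Real.sq_sqrt hA]; ring
  have h2 : 0 ≤ (t * (√A * a) + w) ^ 2 := sq_nonneg _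
  have h3 : (t * (√A * a) + w) ^ 2 = t ^ 2 * (A * a ^ 2) + 2 * t * (a * w * √A) + w ^ 2 := by
    rw [add_sq, mul_pow, mul_pow, Real.sq_sqrt hA]; ring
  have h4 : t * (a * w * √A) ≤ t ^ 2 * (A * a ^ 2) + w ^ 2 := by
    linarith [sq_nonneg (t * (√A * a) - w)]
  refine le_of_mul_le_mul_left (h4.trans_eq ?_) ht
  field_simp

set_option maxHeartbeats 1000000 in
theorem exists_energy_bound (hn : 3 ≤ n) (hη : ContDiff ℝ ∞ η) (hc : HasCompactSupport η)
    (hη0 : ∀ x, 0 ≤ η x) {C : ℝ} (hC : 0 ≤ C) :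
    ∃ K, ∀ u : Eu n → ℝ, ContDiff ℝ ∞ u → (∀ x, η x ≠ 0 → lap u x ≤ 0) →
      (∫ x, A2w u x * η x ^ 2 ≤ ∫ x, cw u x ^ 2 * ‖gradient η x‖ ^ 2) →
      (∀ x, (gradient η x = 0 ∧ (η x = 0 ∨ η x = 1)) ∨ cw u x ≤ C) →
      ∫ x, η x ^ ((n : ℝ) / (n - 1)) * cw u x ^ (2 * n / (n - 2) : ℝ) ≤ K := by
  have hn' : (3 : ℝ) ≤ n := by exact_mod_cast hn
  have hn1 : (0 : ℝ) < n - 1 := by linarith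
  have hn2 : (0 : ℝ) < n - 2 := by linarith
  have hn0 : (0 : ℝ) < n := by linarith
  set q : ℝ := n / (n - 2) with hq
  have hq0 : 0 ≤ q := by positivity
  set p' : ℝ := n / (n - 1) with hp'
  have hp0 : 0 < p' := by positivity
  have h2q : (2 * n / (n - 2) : ℝ) = 2 * q := by rw [hq]; ring
  have hqp : (q + 1) * p' = 2 * q := by rw [hq, hp']; field_simp; ring
  obtain ⟨S, hS0, hS⟩ := exists_sobolev (n := n) (by omega) (p := 1) (p' := p') le_rfl hp0
    (by rw [hp']; field_simp)
  obtain ⟨L, hL⟩ := hη.continuous_gradient.norm.bounded_above_of_compact_support hc.norm_gradient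
  have hL0 : 0 ≤ L := (norm_nonneg _).trans (hL 0)
  simp only [norm_norm] at hL
  set V := volume.real (tsupport η)
  have hV : 0 ≤ V := measureReal_nonneg
  set Cn : ℝ := q * √n + (q + 1) * (1 + √n) with hCn
  have hCn0 : 0 ≤ Cn := by positivity
  set B1 := C ^ 2 * L ^ 2 * V with hB1
  set B2 := C ^ (q + 1) * L * V with hB2
  set B3 := C ^ (2 * q) * V with hB3
  have hB1' : 0 ≤ B1 := by positivity
  have hB2' : 0 ≤ B2 := by positivity
  have hB3' : 0 ≤ B3 := by positivity
  set K0 := S * (2 * B2 + Cn * (B1 + 1 + B3)) with hK0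
  refine ⟨1 + (2 * K0) ^ (p'⁻¹ - 1 / 2)⁻¹, fun u hu hlap hstab htr => ?_⟩
  rw [h2q]
  have hW := fun a => contDiff_cw_rpow hu a
  have hcw := cw_pos u
  have hgrad : ∀ x, x ∉ tsupport η → gradient η x = 0 := fun x hx =>
    gradient_eq_zero_of_notMem_tsupport hx
  have hzero : ∀ x, x ∉ tsupport η → η x = 0 := fun x hx => image_eq_zero_of_notMem_tsupport hx
  have hgC : ∀ x, gradient η x ≠ 0 → cw u x ≤ C := fun x hx =>
    (htr x).resolve_left fun h => hx h.1
  -- the gradient terms are controlled on the transition region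
  have hI1 : ∫ x, cw u x ^ 2 * ‖gradient η x‖ ^ 2 ≤ B1 := by
    refine integral_rpow_le_of_bound hc (Continuous.integrable_of_hasCompactSupport
      (((contDiff_cw hu).continuous.pow 2).mul (hη.continuous_gradient.norm.pow 2))
        hc.norm_gradient.sq.mul_left) fun x => ?_
    by_cases hx : x ∈ tsupport η
    · rw [Set.indicator_of_mem hx]
      by_cases h0 : gradient η x = 0
      · rw [h0]; simp; positivity
      · have := hgC x h0; have := hL x; have := hcw x
        gcongr
    · rw [Set.indicator_of_notMem hx, hgrad x hx]; simp
  have hI2 : ∫ x, cw u x ^ (q + 1) * ‖gradient η x‖ ≤ B2 := by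
    refine integral_rpow_le_of_bound hc (Continuous.integrable_of_hasCompactSupport
      ((hW _).continuous.mul hη.continuous_gradient.norm) hc.norm_gradient.mul_left) fun x => ?_
    by_cases hx : x ∈ tsupport η
    · rw [Set.indicator_of_mem hx]
      by_cases h0 : gradient η x = 0
      · rw [h0]; simp; positivity
      · have := hgC x h0; have := hL x; have := (hcw x).le
        gcongr
    · rw [Set.indicator_of_notMem hx, hgrad x hx]; simp
  set X := ∫ x, η x ^ p' * cw u x ^ (2 * q) with hX
  have hX0 : 0 ≤ X := integral_nonneg fun x => by
    have := hη0 x; have := (hcw x).le; simp only [Pi.zero_apply]; positivity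
  have hcηp : HasCompactSupport fun x => η x ^ p' :=
    hc.comp_left (g := fun t => t ^ p') (Real.zero_rpow hp0.ne')
  have iX : Integrable fun x => η x ^ p' * cw u x ^ (2 * q) :=
    Continuous.integrable_of_hasCompactSupport ((hη.continuous.rpow_const fun x => .inr hp0.le).mul
      (hW _).continuous) hcηp.mul_right
  have iA : Integrable fun x => A2w u x * η x ^ 2 :=
    Continuous.integrable_of_hasCompactSupport ((continuous_A2w hu).mul (hη.continuous.pow 2))
      hc.sq.mul_left
  have i3 : Integrable fun x => η x * cw u x ^ q * √(A2w u x) :=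
    Continuous.integrable_of_hasCompactSupport
      ((hη.continuous.mul (hW _).continuous).mul (continuous_A2w hu).sqrt)
      (HasCompactSupport.mul_right hc.mul_right)
  set t := √(X + 1) with ht
  have ht0 : 0 < t := Real.sqrt_pos.2 (by linarith)
  have ht2 : t ^ 2 = X + 1 := Real.sq_sqrt (by linarith)
  have ht1 : 1 ≤ t := by rw [ht, Real.one_le_sqrt]; linarith
  have hI3 : ∫ x, η x * cw u x ^ q * √(A2w u x) ≤ t * (B1 + 1 + B3) := by
    have hle : ∫ x, η x * cw u x ^ q * √(A2w u x) ≤ ∫ x, (t * (A2w u x * η x ^ 2)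
        + t⁻¹ * (η x ^ p' * cw u x ^ (2 * q)
          + (tsupport η).indicator (fun _ => C ^ (2 * q)) x)) := by
      refine integral_mono i3 ((iA.const_mul t).add
        ((iX.add (integrable_indicator_tsupport hc _)).const_mul _)) fun x => ?_
      have hA := A2w_nonneg hu x
      have hc0 := (hcw x).le
      have hηx := hη0 x
      have hind : 0 ≤ (tsupport η).indicator (fun _ => C ^ (2 * q)) x :=
        Set.indicator_nonneg (fun _ _ => by positivity) x
      have hsq : (cw u x ^ q) ^ 2 = cw u x ^ (2 * q) := by
        rw [← Real.rpow_natCast, ← Real.rpow_mul hc0, mul_comm]; norm_num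
      have key := mul_sqrt_le_add (η x) (cw u x ^ q) hA ht0
      rw [hsq] at key
      rcases htr x with ⟨-, h | h⟩ | h
      · simp only [h, zero_mul]; positivity
      · refine key.trans ?_
        simp only [h, Real.one_rpow, one_mul]
        gcongr
        linarith
      · by_cases hx : x ∈ tsupport η
        · refine key.trans ?_
          simp only [Set.indicator_of_mem hx]
          gcongr
          have : cw u x ^ (2 * q) ≤ C ^ (2 * q) := by gcongr
          have : 0 ≤ η x ^ p' * cw u x ^ (2 * q) := by positivity
          linarith
        · simp only [hzero x hx, zero_mul]; positivity
    have iXi : Integrable fun x => η x ^ p' * cw u x ^ (2 * q)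
          + (tsupport η).indicator (fun _ => C ^ (2 * q)) x :=
      iX.add (integrable_indicator_tsupport hc _)
    rw [integral_add (iA.const_mul t) (iXi.const_mul _), integral_const_mul, integral_const_mul,
      integral_add iX (integrable_indicator_tsupport hc _), integral_indicator_tsupport] at hle
    have h1 : t * ∫ x, A2w u x * η x ^ 2 ≤ t * B1 := by gcongr; exact hstab.trans hI1
    have h2 : t⁻¹ * (X + B3) ≤ t * (1 + B3) := by
      rw [inv_mul_le_iff₀ ht0, ← mul_assoc, ← pow_two, ht2]
      linarith [mul_nonneg hX0 hB3']
    linarith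
  have hsob := hS (fun y => η y * cw u y ^ (q + 1)) (hη.mul (hW _)) hc.mul_right
  simp only [Real.rpow_one, inv_one] at hsob
  have e1 : ∀ x, |η x * cw u x ^ (q + 1)| ^ p' = η x ^ p' * cw u x ^ (2 * q) := by
    intro x
    have hc0 := (hcw x).le
    have hηx := hη0 x
    rw [abs_of_nonneg (by positivity), Real.mul_rpow hηx (by positivity), ← Real.rpow_mul hc0, hqp]
  simp only [e1] at hsob
  have hint := integral_norm_gradient_mul_cw_rpow_le hu hη hc hη0 hlap hq0
  refine le_rpow_of_rpow_le_mul_sqrt ?_ hX0 (by positivity) (hsob.trans ?_)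
  · rw [hp', inv_div, div_lt_div_iff₀ two_pos hn0]; linarith
  · rw [hK0, mul_assoc]
    refine mul_le_mul_of_nonneg_left (hint.trans ?_) hS0
    have h1 : Cn * ∫ x, η x * cw u x ^ q * √(A2w u x) ≤ Cn * (t * (B1 + 1 + B3)) := by gcongr
    have h2 : 2 * B2 ≤ t * (2 * B2) := le_mul_of_one_le_left (by positivity) ht1
    linarith

end UniformEnergy

section Final

variable {n : ℕ} {η : Eu n → ℝ}

theorem exists_cutoff {K U : Set (Eu n)} (hK : IsClosed K) (hU : IsOpen U) (hKU : K ⊆ U) :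
    ∃ η : Eu n → ℝ, ContDiff ℝ ∞ η ∧ (∀ᶠ x in 𝓝ˢ K, η x = 1) ∧ (∀ x ∉ U, η x = 0) ∧
      ∀ x, η x ∈ Set.Icc 0 1 := by
  obtain ⟨η, h1, h2, h3⟩ := exists_contMDiffMap_one_nhds_of_subset_interior
    (n := ⊤) (modelWithCornersSelf ℝ (Eu n)) hK (by rwa [hU.interior_eq])
  exact ⟨η, η.contMDiff.contDiff, h1, h2, h3⟩

theorem gradient_eq_zero_of_eventually_eq_one {x : Eu n} (h : ∀ᶠ y in 𝓝 x, η y = 1) :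
    gradient η x = 0 := by
  have : η =ᶠ[𝓝 x] fun _ => 1 := h
  rw [← norm_eq_zero, norm_gradient, this.fderiv_eq]
  simp

theorem ball_subset_of_le_infDist_frontier {U : Set (Eu n)} {x : Eu n} (hx : x ∈ U) {r : ℝ}
    (hr : r ≤ Metric.infDist x (frontier U)) : Metric.ball x r ⊆ U := by
  intro y hy
  by_contra hyU
  obtain ⟨t, ht, hz⟩ := exists_mem_frontier_segment hx hyU
  have h1 := hr.trans (Metric.infDist_le_dist_of_mem hz)
  rw [dist_eq_norm, sub_add_cancel_left, norm_neg, norm_smul, Real.norm_of_nonneg ht.1] at h1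
  rw [Metric.mem_ball, dist_eq_norm] at hy
  have h2 : t * ‖y - x‖ ≤ ‖y - x‖ := mul_le_of_le_one_left (norm_nonneg _) ht.2
  linarith

theorem exists_interior_bound (hn : 5 ≤ n) (hη : ContDiff ℝ ∞ η) (hc : HasCompactSupport η)
    (hη01 : ∀ x, η x ∈ Set.Icc 0 1) {C M : ℝ} (hC : 0 ≤ C) (hM : 0 ≤ M) :
    ∃ K, ∀ u : Eu n → ℝ, ContDiff ℝ ∞ u → (∀ x, η x ≠ 0 → lap u x ≤ 0) →
      (∫ x, A2w u x * η x ^ 2 ≤ ∫ x, cw u x ^ 2 * ‖gradient η x‖ ^ 2) →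
      (∀ x, (gradient η x = 0 ∧ (η x = 0 ∨ η x = 1)) ∨ (cw u x ≤ C ∧ |u x| ≤ M)) →
      ∫ x, |η x * u x| ^ (2 * n / (n - 4) : ℝ) ≤ K := by
  have hn' : (5 : ℝ) ≤ n := by exact_mod_cast hn
  have hn1 : (0 : ℝ) < n - 1 := by linarith
  have hn2 : (0 : ℝ) < n - 2 := by linarith
  have hn4 : (0 : ℝ) < n - 4 := by linarith
  have hn0 : (0 : ℝ) < n := by linarith
  obtain ⟨K, hK⟩ := exists_energy_bound (by omega) hη hc (fun x => (hη01 x).1) hC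
  set p : ℝ := 2 * n / (n - 2) with hp
  set p' : ℝ := 2 * n / (n - 4) with hp'
  set a : ℝ := n / (n - 1) with ha
  have hp0 : 0 < p := by positivity
  have hp0' : 0 < p' := by positivity
  have ha0 : 0 < a := by positivity
  obtain ⟨S, hS0, hS⟩ := exists_sobolev (n := n) (by omega) (p := p) (p' := p')
    (by rw [hp, le_div_iff₀ hn2]; linarith) hp0' (by rw [hp, hp']; field_simp; ring)
  obtain ⟨L, hL⟩ := hη.continuous_gradient.norm.bounded_above_of_compact_support hc.norm_gradient
  have hL0 : 0 ≤ L := (norm_nonneg _).trans (hL 0)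
  simp only [norm_norm] at hL
  set D : ℝ := (C + M * L) ^ p with hD
  have hD0 : 0 ≤ D := by positivity
  refine ⟨(S * (K + D * volume.real (tsupport η)) ^ p⁻¹) ^ p', fun u hu hlap hstab htr => ?_⟩
  have hE := hK u hu hlap hstab fun x => (htr x).imp_right And.left
  have hsob := hS (fun y => η y * u y) (hη.mul hu) hc.mul_right
  have hcw := fun x => (cw_pos u x).le
  have hcηp : HasCompactSupport fun x => η x ^ a :=
    hc.comp_left (g := fun t => t ^ a) (Real.zero_rpow ha0.ne')
  have iX : Integrable fun x => η x ^ a * cw u x ^ p :=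
    Continuous.integrable_of_hasCompactSupport ((hη.continuous.rpow_const fun x => .inr ha0.le).mul
      (contDiff_cw_rpow hu _).continuous) hcηp.mul_right
  have hcηu : HasCompactSupport fun x => η x * u x := hc.mul_right
  have iG : Integrable fun x => ‖gradient (fun y => η y * u y) x‖ ^ p :=
    Continuous.integrable_of_hasCompactSupport
      ((hη.mul hu).continuous_gradient.norm.rpow_const fun x => .inr hp0.le)
      (hcηu.norm_gradient.comp_left (g := fun t => t ^ p) (Real.zero_rpow hp0.ne'))
  have hle : ∫ x, ‖gradient (fun y => η y * u y) x‖ ^ p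
      ≤ ∫ x, (η x ^ a * cw u x ^ p + (tsupport η).indicator (fun _ => D) x) := by
    refine integral_mono iG (iX.add (integrable_indicator_tsupport hc _)) fun x => ?_
    have hη0 := (hη01 x).1
    have hc0 := hcw x
    have hind : 0 ≤ (tsupport η).indicator (fun _ => D) x :=
      Set.indicator_nonneg (fun _ _ => hD0) x
    have hg := norm_gradient_mul_le hη hu x
    rw [abs_of_nonneg hη0] at hg
    have hgc := norm_gradient_le_cw (u := u) (x := x)
    rcases htr x with ⟨h0, h | h⟩ | ⟨h1, h2⟩
    · rw [h, h0, norm_zero, zero_mul, mul_zero, add_zero] at hg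
      simp only [le_antisymm hg (norm_nonneg _), Real.zero_rpow hp0.ne']
      positivity
    · rw [h0, h, norm_zero, mul_zero, add_zero, one_mul] at hg
      have : ‖gradient (fun y => η y * u y) x‖ ^ p ≤ cw u x ^ p := by
        gcongr; exact hg.trans hgc
      simp only [h, Real.one_rpow, one_mul]
      linarith
    · by_cases hx : x ∈ tsupport η
      · have h3 : ‖gradient (fun y => η y * u y) x‖ ≤ C + M * L := by
          refine hg.trans (add_le_add ?_ ?_)
          · exact (mul_le_of_le_one_left (norm_nonneg _) (hη01 x).2).trans (hgc.trans h1)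
          · exact mul_le_mul h2 (hL x) (norm_nonneg _) hM
        have h4 : ‖gradient (fun y => η y * u y) x‖ ^ p ≤ D := by rw [hD]; gcongr
        have h5 : 0 ≤ η x ^ a * cw u x ^ p := by positivity
        simp only [Set.indicator_of_mem hx]
        linarith
      · rw [image_eq_zero_of_notMem_tsupport hx, gradient_eq_zero_of_notMem_tsupport hx,
          norm_zero, zero_mul, mul_zero, add_zero] at hg
        simp only [le_antisymm hg (norm_nonneg _), Real.zero_rpow hp0.ne']
        positivity
  rw [integral_add iX (integrable_indicator_tsupport hc _), integral_indicator_tsupport] at hle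
  have hG0 : 0 ≤ ∫ x, ‖gradient (fun y => η y * u y) x‖ ^ p :=
    integral_nonneg fun x => by simp only [Pi.zero_apply]; positivity
  have h1 : (∫ x, |η x * u x| ^ p') ^ p'⁻¹ ≤ S * (K + D * volume.real (tsupport η)) ^ p⁻¹ := by
    refine hsob.trans (mul_le_mul_of_nonneg_left ?_ hS0)
    exact Real.rpow_le_rpow hG0 (by linarith) (by positivity)
  have h0 : 0 ≤ ∫ x, |η x * u x| ^ p' :=
    integral_nonneg fun x => by simp only [Pi.zero_apply]; positivity
  have h2 := Real.rpow_le_rpow (by positivity) h1 hp0'.le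
  rwa [← Real.rpow_mul h0, inv_mul_cancel₀ hp0'.ne', Real.rpow_one] at h2

variable {Ω : Set (Eu n)} {f : ℝ → ℝ} {ls : ℝ} {u : ℝ → Eu n → ℝ} {us : Eu n → ℝ}

theorem SolFamily.integral_A2w_le (F : SolFamily n Ω f ls u us) {l : ℝ} (hl : l ∈ Set.Ioo 0 ls)
    (hs : SemiStable Ω (fun t => l * f t) (u l)) (hη : ContDiff ℝ ∞ η)
    (hc : HasCompactSupport η) (hηΩ : tsupport η ⊆ Ω) :
    ∫ x, A2w (u l) x * η x ^ 2 ≤ ∫ x, cw (u l) x ^ 2 * ‖gradient η x‖ ^ 2 := by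
  have hd : deriv (fun t => l * f t) = fun t => l * deriv f t := by
    ext t; exact deriv_const_mul_field l
  refine hs.integral_A2w_le F.isOpen ?_ (F.smooth l hl) hη hc hηΩ (fun x hx i => ?_) fun x hx => ?_
  · rw [hd]
    exact continuous_const.mul (F.f_smooth.continuous_deriv le_rfl)
  · rw [hd, ← lap_dd (F.smooth l hl), F.lap_dd_eq hl hx]
  · rw [hd]
    exact mul_nonneg hl.1.le (F.deriv_nonneg (F.pos l hl x hx))

theorem SolFamily.exists_uniform_bound (F : SolFamily n Ω f ls u us) (hne : Ω.Nonempty)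
    (hs : ∀ l ∈ Set.Ioo 0 ls, SemiStable Ω (fun t => l * f t) (u l)) :
    ∃ K, ∀ l ∈ Set.Ioo 0 ls, ∫ x in Ω, u l x ^ (2 * n / (n - 4) : ℝ) ≤ K := by
  obtain ⟨δ, hδ, M, hM⟩ := F.bounded_near_frontier
  have hM' : ∀ l ∈ Set.Ioo 0 ls, ∀ x ∈ Ω, Metric.infDist x (frontier Ω) < δ → u l x ≤ max M 0 :=
    fun l hl x hx hd => (hM l hl x hx hd).trans (le_max_left _ _)
  have hM0 : 0 ≤ max M 0 := le_max_right _ _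
  generalize max M 0 = M at hM' hM0
  have hfr := F.nonempty_frontier hne
  have hdc : Continuous fun x : Eu n => Metric.infDist x (frontier Ω) :=
    Metric.continuous_infDist_pt _
  have hmem : ∀ x ∈ closure Ω, 0 < Metric.infDist x (frontier Ω) → x ∈ Ω := fun x hx hd => by
    by_contra h
    have : x ∈ frontier Ω := by rw [F.isOpen.frontier_eq]; exact ⟨hx, h⟩
    exact hd.ne' (Metric.infDist_zero_of_mem this)
  obtain ⟨C, hC0, hC⟩ := F.grad_bound (ρ := δ / 8) (M := M) (by positivity)
  obtain ⟨η, hη, h1, h2, h3⟩ := exists_cutoff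
    (K := closure Ω ∩ {x | δ / 2 ≤ Metric.infDist x (frontier Ω)})
    (U := Ω ∩ {x | δ / 4 < Metric.infDist x (frontier Ω)})
    (isClosed_closure.inter (isClosed_le continuous_const hdc))
    (F.isOpen.inter (isOpen_lt continuous_const hdc))
    (fun x hx => by
      have hx2 : δ / 2 ≤ Metric.infDist x (frontier Ω) := hx.2
      refine ⟨hmem x hx.1 (by linarith), ?_⟩
      change δ / 4 < Metric.infDist x (frontier Ω)
      linarith)
  have hts : tsupport η ⊆ closure Ω ∩ {x | δ / 4 ≤ Metric.infDist x (frontier Ω)} := by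
    refine closure_minimal (fun x hx => ?_)
      (isClosed_closure.inter (isClosed_le continuous_const hdc))
    by_contra h
    refine hx (h2 x fun h' => h ⟨subset_closure h'.1, ?_⟩)
    have : δ / 4 < Metric.infDist x (frontier Ω) := h'.2
    exact this.le
  have hcs : HasCompactSupport η := F.bdd.isCompact_closure.of_isClosed_subset
    (isClosed_tsupport η) (hts.trans Set.inter_subset_left)
  have htd : ∀ x ∈ tsupport η, δ / 4 ≤ Metric.infDist x (frontier Ω) := fun x hx => (hts hx).2
  have htΩ : tsupport η ⊆ Ω := fun x hx => hmem x (hts hx).1 (by linarith [htd x hx])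
  have hη1 : ∀ x ∈ Ω, δ / 2 ≤ Metric.infDist x (frontier Ω) → ∀ᶠ y in 𝓝 x, η y = 1 :=
    fun x hx hd => h1.filter_mono (nhds_le_nhdsSet (Set.mem_inter (subset_closure hx) hd))
  obtain ⟨K, hK⟩ := exists_interior_bound F.dim hη hcs h3 (C := 1 + C) (by positivity) hM0
  have hn' : (5 : ℝ) ≤ n := by exact_mod_cast F.dim
  have hp0 : (0 : ℝ) < 2 * n / (n - 4) := div_pos (by linarith) (by linarith)
  have hvol : volume Ω ≠ ⊤ := F.bdd.measure_lt_top.ne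
  refine ⟨K + M ^ (2 * n / (n - 4) : ℝ) * volume.real Ω, fun l hl => ?_⟩
  have hb := hK (u l) (F.smooth l hl) (fun x hx => ?_)
    (F.integral_A2w_le hl (hs l hl) hη hcs htΩ) fun x => ?_
  · have hu := F.smooth l hl
    have iu : IntegrableOn (fun x => u l x ^ (2 * n / (n - 4) : ℝ)) Ω :=
      ((hu.continuous.rpow_const fun x => .inr hp0.le).continuousOn.integrableOn_compact
        F.bdd.isCompact_closure).mono_set subset_closure
    have iη : Integrable fun x => |η x * u l x| ^ (2 * n / (n - 4) : ℝ) :=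
      Continuous.integrable_of_hasCompactSupport
        ((hη.mul hu).continuous.abs.rpow_const fun x => .inr hp0.le)
        ((HasCompactSupport.mul_right (f' := u l) hcs).comp_left
          (g := fun t => |t| ^ (2 * n / (n - 4) : ℝ)) (by simp [Real.zero_rpow hp0.ne']))
    have iM : IntegrableOn (fun _ : Eu n => M ^ (2 * n / (n - 4) : ℝ)) Ω :=
      integrableOn_const hvol
    calc ∫ x in Ω, u l x ^ (2 * n / (n - 4) : ℝ)
        ≤ ∫ x in Ω, (|η x * u l x| ^ (2 * n / (n - 4) : ℝ) + M ^ (2 * n / (n - 4) : ℝ)) := by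
          refine setIntegral_mono_on iu (iη.integrableOn.add iM) F.isOpen.measurableSet
            fun x hx => ?_
          have hux := (F.pos l hl x hx).le
          by_cases hd : δ / 2 ≤ Metric.infDist x (frontier Ω)
          · rw [(hη1 x hx hd).self_of_nhds, one_mul, abs_of_nonneg hux]
            have : 0 ≤ M ^ (2 * n / (n - 4) : ℝ) := by positivity
            linarith
          · have h4 := hM' l hl x hx (by linarith)
            have h5 : u l x ^ (2 * n / (n - 4) : ℝ) ≤ M ^ (2 * n / (n - 4) : ℝ) := by gcongr
            have h6 : 0 ≤ |η x * u l x| ^ (2 * n / (n - 4) : ℝ) := by positivity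
            linarith
      _ = (∫ x in Ω, |η x * u l x| ^ (2 * n / (n - 4) : ℝ))
          + M ^ (2 * n / (n - 4) : ℝ) * volume.real Ω := by
          rw [integral_add iη.integrableOn iM, setIntegral_const, smul_eq_mul, mul_comm (M ^ _)]
      _ ≤ _ := by
          gcongr
          exact (setIntegral_le_integral iη (ae_of_all _ fun x => by
            simp only [Pi.zero_apply]; positivity)).trans hb
  · have hxΩ := htΩ (subset_tsupport η hx)
    have := F.eq l hl x hxΩ
    have := mul_pos hl.1 (F.f_pos _ (F.pos l hl x hxΩ).le)
    linarith
  · by_cases hx : x ∈ tsupport η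
    · have hxΩ := htΩ hx
      by_cases hd : δ / 2 ≤ Metric.infDist x (frontier Ω)
      · exact .inl ⟨gradient_eq_zero_of_eventually_eq_one (hη1 x hxΩ hd),
          .inr (hη1 x hxΩ hd).self_of_nhds⟩
      · have hball := ball_subset_of_le_infDist_frontier hxΩ (r := δ / 8) (by linarith [htd x hx])
        refine .inr ⟨cw_le.trans (add_le_add_right (hC l hl x hball fun y hy =>
          hM' l hl y (hball hy) ?_) 1), ?_⟩
        · have := Metric.infDist_le_infDist_add_dist (s := frontier Ω) (x := y) (y := x)
          rw [Metric.mem_ball] at hy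
          linarith
        · rw [abs_of_nonneg (F.pos l hl x hxΩ).le]
          exact hM' l hl x hxΩ (by linarith)
    · exact .inl ⟨gradient_eq_zero_of_notMem_tsupport hx,
        .inl (image_eq_zero_of_notMem_tsupport hx)⟩

theorem SolFamily.integrableOn_star_rpow (F : SolFamily n Ω f ls u us)
    (hs : ∀ l ∈ Set.Ioo 0 ls, SemiStable Ω (fun t => l * f t) (u l)) :
    IntegrableOn (fun x => us x ^ (2 * n / (n - 4) : ℝ)) Ω := by
  rcases Ω.eq_empty_or_nonempty with rfl | hne
  · exact integrableOn_empty
  obtain ⟨K, hK⟩ := F.exists_uniform_bound hne hs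
  have hn' : (5 : ℝ) ≤ n := by exact_mod_cast F.dim
  set p : ℝ := 2 * n / (n - 4) with hp
  have hp0 : 0 < p := div_pos (by linarith) (by linarith)
  obtain ⟨s, -, hsl, hst⟩ := exists_seq_strictMono_tendsto' F.ls_pos
  have hst' : Tendsto s atTop (𝓝[<] ls) :=
    tendsto_nhdsWithin_iff.2 ⟨hst, .of_forall fun k => (hsl k).2⟩
  have hcont : ∀ k, Continuous fun x => u (s k) x ^ p := fun k =>
    (F.smooth _ (hsl k)).continuous.rpow_const fun x => .inr hp0.le
  have hlim : ∀ᵐ x ∂volume.restrict Ω, Tendsto (fun k => u (s k) x ^ p) atTop (𝓝 (us x ^ p)) :=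
    (ae_restrict_mem F.isOpen.measurableSet).mono fun x hx =>
      ((F.lim x hx).comp hst').rpow_const (.inr hp0.le)
  have hmeas : ∀ k, AEStronglyMeasurable (fun x => u (s k) x ^ p) (volume.restrict Ω) := fun k =>
    (hcont k).aestronglyMeasurable
  refine memLp_one_iff_integrable.1 ⟨aestronglyMeasurable_of_tendsto_ae atTop hmeas hlim, ?_⟩
  refine (Lp.eLpNorm_lim_le_liminf_eLpNorm hmeas _ hlim).trans_lt ?_
  refine lt_of_le_of_lt ?_ (ENNReal.ofReal_lt_top (r := K))
  refine (liminf_le_liminf (v := fun _ => ENNReal.ofReal K) (.of_forall fun k => ?_)).trans_eq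
    (liminf_const _)
  have iu : IntegrableOn (fun x => u (s k) x ^ p) Ω :=
    ((hcont k).continuousOn.integrableOn_compact F.bdd.isCompact_closure).mono_set subset_closure
  rw [eLpNorm_one_eq_lintegral_enorm, ← ofReal_integral_norm_eq_lintegral_enorm iu]
  refine ENNReal.ofReal_le_ofReal (le_trans (le_of_eq ?_) (hK _ (hsl k)))
  refine setIntegral_congr_fun F.isOpen.measurableSet fun x hx => ?_
  exact Real.norm_of_nonneg (Real.rpow_nonneg (F.pos _ (hsl k) x hx).le _)

end Final

/-- Theorem 2.2: for `n ≥ 5` and `Ω` convex, the extremal solution `u* = lim_{λ↑λ*} u_λ`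
of `-Δu = λ f(u)` belongs to `L^{2n/(n-4)}(Ω)`. -/
theorem stmt_15 (n : ℕ) (hn : 5 ≤ n)
    (Ω : Set (EuclideanSpace ℝ (Fin n))) (hΩo : IsOpen Ω) (hΩb : IsBounded Ω)
    (hΩc : Convex ℝ Ω)
    (f : ℝ → ℝ) (hf : ContDiff ℝ 1 f)
    (hfpos : ∀ t, 0 ≤ t → 0 < f t) (hfmono : StrictMonoOn f (Set.Ici 0))
    (hfsuper : Tendsto (fun t => f t / t) atTop atTop)
    (lamStar : ℝ) (hls : 0 < lamStar)
    (u : ℝ → EuclideanSpace ℝ (Fin n) → ℝ)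
    (hureg : ∀ lam ∈ Set.Ioo 0 lamStar, ContDiff ℝ (⊤ : ℕ∞) (u lam))
    (hupos : ∀ lam ∈ Set.Ioo 0 lamStar, ∀ x ∈ Ω, 0 < u lam x)
    (hueq : ∀ lam ∈ Set.Ioo 0 lamStar, ∀ x ∈ Ω, -lap (u lam) x = lam * f (u lam x))
    (hubc : ∀ lam ∈ Set.Ioo 0 lamStar, ∀ x ∈ frontier Ω, u lam x = 0)
    (hustab : ∀ lam ∈ Set.Ioo 0 lamStar, SemiStable Ω (fun t => lam * f t) (u lam))
    (hmono : ∀ lam ∈ Set.Ioo 0 lamStar, ∀ mu ∈ Set.Ioo 0 lamStar, lam ≤ mu →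
      ∀ x ∈ Ω, u lam x ≤ u mu x)
    (ustar : EuclideanSpace ℝ (Fin n) → ℝ)
    (hlim : ∀ x ∈ Ω, Tendsto (fun lam => u lam x) (𝓝[<] lamStar) (𝓝 (ustar x)))
    (hL1 : IntegrableOn ustar Ω)
    (hfdist : IntegrableOn
      (fun x => f (ustar x) * Metric.infDist x (frontier Ω)) Ω) :
    IntegrableOn (fun x => ustar x ^ (2 * (n : ℝ) / ((n : ℝ) - 4))) Ω := by
  have F : SolFamily n Ω f lamStar u ustar :=
    ⟨hn, hΩo, hΩb, hΩc, hf, hfpos, hfmono, hls, hureg, hupos, hueq, hubc, hmono, hlim, hL1⟩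
  exact F.integrableOn_star_rpow hustab
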